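/- Suppose n ≥ 3, α ∈ (0,n), λ > 0, and 0 ≤ σ < g_α(λ). If u is a nonnegative solution of the Choquard–Pekar inequality problem, then u is harmonically bounded at 0; that is, as x → 0, u(x) = O(|x|^{-(n-2)}) if 0 < λ < n/(n-2), and u(x) = O(1) if λ ≥ n/(n-2). Moreover, if λ ≥ n/(n-2), then u has a C¹ extension to the origin, i.e. u = w restricted to ℝⁿ\{0} for some w ∈ C¹(ℝⁿ). -/

import Mathlib

open MeasureTheory Metric Filter Set Asymptotics Topology

/-- `ℝⁿ` as a Euclidean space. -/
abbrev Euc (n : ℕ) : Type := EuclideanSpace ℝ (Fin n)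

/-- The Laplacian `Δu(x) = ∑ i ∂²u/∂xᵢ²(x)`. -/
noncomputable def lap {n : ℕ} (u : Euc n → ℝ) (x : Euc n) : ℝ :=
  ∑ i : Fin n, iteratedFDeriv ℝ 2 u x ![EuclideanSpace.single i 1, EuclideanSpace.single i 1]

/-- `u` is a nonnegative solution of the Choquard–Pekar inequality problem:
`u ∈ C²(ℝⁿ \ {0}) ∩ L^λ(ℝⁿ)` and
`0 ≤ -Δu(x) ≤ (∫ |x-y|^(-α) u(y)^λ dy) · u(x)^σ` on `B₂(0) \ {0}`. -/
def IsCPSolution (n : ℕ) (α lam sig : ℝ) (u : Euc n → ℝ) : Prop :=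
  (∀ x, 0 ≤ u x) ∧
  ContDiffOn ℝ 2 u {0}ᶜ ∧
  Integrable (fun y => u y ^ lam) ∧
  ∀ x ∈ ball (0 : Euc n) 2 \ {0},
    0 ≤ -lap u x ∧
    -lap u x ≤ (∫ y, ‖x - y‖ ^ (-α) * u y ^ lam) * u x ^ sig

/-- The piecewise linear function `g_α`. -/
noncomputable def gAlpha (n : ℕ) (α lam : ℝ) : ℝ :=
  if lam < ((n : ℝ) - α) / ((n : ℝ) - 2) then (n : ℝ) / ((n : ℝ) - 2)
  else if lam < (n : ℝ) / ((n : ℝ) - 2) then (2 * (n : ℝ) - α) / ((n : ℝ) - 2) - lam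
  else max 0 (1 - (α - 2) / (n : ℝ) * lam)

section Basic
variable {n : ℕ}

theorem lap_eq_sum {u : Euc n → ℝ} {x : Euc n} (hu : ContDiffAt ℝ 2 u x) :
    lap u x = ∑ i : Fin n, fderiv ℝ (fun y => fderiv ℝ u y (EuclideanSpace.single i 1)) x
      (EuclideanSpace.single i 1) := by
  unfold lap
  refine Finset.sum_congr rfl fun i _ => ?_
  have hd : DifferentiableAt ℝ (fderiv ℝ u) x :=
    (hu.fderiv_right (m := 1) (by norm_num)).differentiableAt (by norm_num)
  rw [iteratedFDeriv_two_apply, fderiv_clm_apply hd (differentiableAt_const _)]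
  simp

theorem lap_radial {F F1 : ℝ → ℝ} {F2 : ℝ} {x y : Euc n}
    (h1 : ∀ᶠ t in 𝓝 (‖y - x‖ ^ 2), HasDerivAt F (F1 t) t)
    (h2 : HasDerivAt F1 F2 (‖y - x‖ ^ 2)) :
    lap (fun z => F (‖z - x‖ ^ 2)) y = 4 * ‖y - x‖ ^ 2 * F2 + 2 * n * F1 (‖y - x‖ ^ 2) := by
  have hρ : ∀ z : Euc n, HasFDerivAt (fun z : Euc n => ‖z - x‖ ^ 2)
      (2 • (innerSL ℝ (z - x))) z := by
    intro z
    have := ((hasFDerivAt_id z).sub_const x).norm_sq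
    simpa using this
  have hcont : Tendsto (fun z : Euc n => ‖z - x‖ ^ 2) (𝓝 y) (𝓝 (‖y - x‖ ^ 2)) :=
    (hρ y).continuousAt
  have e1 : fderiv ℝ (fun z => F (‖z - x‖ ^ 2)) =ᶠ[𝓝 y]
      fun z => F1 (‖z - x‖ ^ 2) • (2 • (innerSL ℝ (z - x))) := by
    filter_upwards [hcont.eventually h1] with z hz
    exact (hz.comp_hasFDerivAt z (hρ z)).fderiv
  have hL : HasFDerivAt (fun z : Euc n => 2 • (innerSL ℝ (z - x)))
      (2 • (innerSL ℝ : Euc n →L[ℝ] Euc n →L[ℝ] ℝ)) y := by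
    have := ((innerSL ℝ : Euc n →L[ℝ] Euc n →L[ℝ] ℝ).hasFDerivAt (x := y - x)).comp y
      ((hasFDerivAt_id y).sub_const x)
    exact this.const_smul 2
  have e2 := (h2.comp_hasFDerivAt y (hρ y)).smul hL
  have e3 : fderiv ℝ (fderiv ℝ (fun z => F (‖z - x‖ ^ 2))) y = _ :=
    (e1.fderiv_eq).trans e2.fderiv
  unfold lap
  simp only [iteratedFDeriv_two_apply, e3]
  have hs : ‖y - x‖ ^ 2 = ∑ i, ((y - x) i) ^ 2 := by
    rw [EuclideanSpace.norm_sq_eq]; simp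
  simp [innerSL_apply_apply, EuclideanSpace.inner_single_right, Finset.sum_add_distrib]
  have hone : ∀ i : Fin n, (innerSL ℝ : Euc n →L[ℝ] Euc n →L[ℝ] ℝ)
      (EuclideanSpace.single i (1 : ℝ)) (EuclideanSpace.single i (1 : ℝ)) = 1 := by
    intro i
    change inner ℝ (EuclideanSpace.single i (1 : ℝ)) (EuclideanSpace.single i (1 : ℝ)) = 1
    simp
  rw [hs, Finset.mul_sum, Finset.sum_mul]
  simp only [hone]
  rw [Finset.sum_const, Finset.card_univ, Fintype.card_fin, add_comm]
  congr 1
  · refine Finset.sum_congr rfl fun i _ => ?_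
    simp only [PiLp.sub_apply]
    ring
  · simp
    ring

theorem lap_eq_zero_of_notMem_tsupport {u : Euc n → ℝ} {x : Euc n} (hx : x ∉ tsupport u) :
    lap u x = 0 := by
  have h : u =ᶠ[𝓝 x] 0 := notMem_tsupport_iff_eventuallyEq.mp hx
  have := h.iteratedFDeriv ℝ 2
  unfold lap
  rw [this.eq_of_nhds]
  simp

theorem lap_congr {u v : Euc n → ℝ} {x : Euc n} (h : u =ᶠ[𝓝 x] v) : lap u x = lap v x := by
  unfold lap
  rw [(h.iteratedFDeriv ℝ 2).eq_of_nhds]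

theorem integrable_of_continuousAt_of_compact {f : Euc n → ℝ} {K : Set (Euc n)} (hK : IsCompact K)
    (hc : ∀ x ∈ K, ContinuousAt f x) (h0 : ∀ x ∉ K, f x = 0) : Integrable f := by
  have : IntegrableOn f K :=
    ContinuousOn.integrableOn_compact hK fun x hx => (hc x hx).continuousWithinAt
  exact (integrableOn_iff_integrable_of_support_subset
    (Function.support_subset_iff'.mpr h0)).mp this

/-- The second Green identity without boundary terms. -/
theorem green {ψ w : Euc n → ℝ} (hψ : ContDiff ℝ 2 ψ) (hw : ∀ x ∈ tsupport ψ, ContDiffAt ℝ 2 w x)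
    (hs : HasCompactSupport ψ ∨ HasCompactSupport w) :
    ∫ x, w x * lap ψ x = ∫ x, ψ x * lap w x := by
  set K := tsupport ψ ∩ tsupport w with hKdef
  have hK : IsCompact K := by
    rcases hs with h | h
    · exact h.isCompact.inter_right (isClosed_tsupport _)
    · exact h.isCompact.inter_left (isClosed_tsupport _)
  set e : Fin n → Euc n := fun i => EuclideanSpace.single i 1
  have dψ : ∀ i, ContDiff ℝ 1 (fun y => fderiv ℝ ψ y (e i)) := fun i =>
    (hψ.fderiv_right (m := 1) (by norm_num)).clm_apply contDiff_const
  have dw : ∀ i, ∀ x ∈ tsupport ψ, ContDiffAt ℝ 1 (fun y => fderiv ℝ w y (e i)) x := fun i x hx =>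
    ((hw x hx).fderiv_right (m := 1) (by norm_num)).clm_apply contDiffAt_const
  have ddψ : ∀ i, Continuous (fun y => fderiv ℝ (fun y => fderiv ℝ ψ y (e i)) y (e i)) := fun i =>
    ((dψ i).continuous_fderiv (by norm_num)).clm_apply continuous_const
  have ddw : ∀ i, ∀ x ∈ tsupport ψ,
      ContinuousAt (fun y => fderiv ℝ (fun y => fderiv ℝ w y (e i)) y (e i)) x := fun i x hx =>
    (((dw i x hx).fderiv_right (m := 0) (by norm_num)).clm_apply contDiffAt_const).continuousAt
  have s1 : ∀ (f : Euc n → ℝ) i, tsupport (fun y => fderiv ℝ f y (e i)) ⊆ tsupport f := fun f i =>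
    tsupport_fderiv_apply_subset ℝ (e i)
  have z : ∀ (f : Euc n → ℝ) x, x ∉ tsupport f → f x = 0 := fun f x h =>
    image_eq_zero_of_notMem_tsupport h
  have key : ∀ i, Integrable (fun x => w x * fderiv ℝ (fun y => fderiv ℝ ψ y (e i)) x (e i)) ∧
      Integrable (fun x => ψ x * fderiv ℝ (fun y => fderiv ℝ w y (e i)) x (e i)) ∧
      ∫ x, w x * fderiv ℝ (fun y => fderiv ℝ ψ y (e i)) x (e i) =
      ∫ x, ψ x * fderiv ℝ (fun y => fderiv ℝ w y (e i)) x (e i) := by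
    intro i
    have I1 : Integrable (fun x => w x * fderiv ℝ (fun y => fderiv ℝ ψ y (e i)) x (e i)) := by
      refine integrable_of_continuousAt_of_compact hK
        (fun x hx => (hw x hx.1).continuousAt.mul (ddψ i).continuousAt) fun x hx => ?_
      by_cases h : x ∈ tsupport w
      · rw [z _ x fun h' => hx ⟨s1 _ i (s1 _ i h'), h⟩, mul_zero]
      · rw [z _ x h, zero_mul]
    have I2 : Integrable (fun x => ψ x * fderiv ℝ (fun y => fderiv ℝ w y (e i)) x (e i)) := by
      refine integrable_of_continuousAt_of_compact hK
        (fun x hx => hψ.continuous.continuousAt.mul (ddw i x hx.1)) fun x hx => ?_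
      by_cases h : x ∈ tsupport ψ
      · rw [z _ x fun h' => hx ⟨h, s1 _ i (s1 _ i h')⟩, mul_zero]
      · rw [z _ x h, zero_mul]
    have I3 : Integrable (fun x => fderiv ℝ w x (e i) * fderiv ℝ ψ x (e i)) := by
      refine integrable_of_continuousAt_of_compact hK
        (fun x hx => (dw i x hx.1).continuousAt.mul (dψ i).continuous.continuousAt) fun x hx => ?_
      by_cases h : x ∈ tsupport w
      · rw [z (fun y => fderiv ℝ ψ y (e i)) x fun h' => hx ⟨s1 _ i h', h⟩, mul_zero]
      · rw [z (fun y => fderiv ℝ w y (e i)) x fun h' => h (s1 _ i h'), zero_mul]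
    have I4 : Integrable (fun x => w x * fderiv ℝ ψ x (e i)) := by
      refine integrable_of_continuousAt_of_compact hK
        (fun x hx => (hw x hx.1).continuousAt.mul (dψ i).continuous.continuousAt) fun x hx => ?_
      by_cases h : x ∈ tsupport w
      · rw [z (fun y => fderiv ℝ ψ y (e i)) x fun h' => hx ⟨s1 _ i h', h⟩, mul_zero]
      · rw [z _ x h, zero_mul]
    have I5 : Integrable (fun x => ψ x * fderiv ℝ w x (e i)) := by
      refine integrable_of_continuousAt_of_compact hK
        (fun x hx => hψ.continuous.continuousAt.mul (dw i x hx.1).continuousAt) fun x hx => ?_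
      by_cases h : x ∈ tsupport ψ
      · rw [z (fun y => fderiv ℝ w y (e i)) x fun h' => hx ⟨h, s1 _ i h'⟩, mul_zero]
      · rw [z _ x h, zero_mul]
    have A := integral_mul_fderiv_eq_neg_fderiv_mul_of_integrable (μ := volume) (v := e i)
      (f := w) (g := fun y => fderiv ℝ ψ y (e i)) I3 I1 I4
      (fun x hx => (hw x (s1 _ i hx)).differentiableAt (by norm_num))
      (fun x _ => (dψ i).differentiable (by norm_num) x)
    have B := integral_mul_fderiv_eq_neg_fderiv_mul_of_integrable (μ := volume) (v := e i)
      (f := ψ) (g := fun y => fderiv ℝ w y (e i)) (by simpa only [mul_comm] using I3) I2 I5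
      (fun x _ => hψ.differentiable (by norm_num) x)
      (fun x hx => (dw i x hx).differentiableAt (by norm_num))
    refine ⟨I1, I2, ?_⟩
    rw [A, B]
    simp only [mul_comm]
  have E1 : ∀ x, w x * lap ψ x =
      ∑ i, w x * fderiv ℝ (fun y => fderiv ℝ ψ y (e i)) x (e i) := fun x => by
    rw [lap_eq_sum hψ.contDiffAt, Finset.mul_sum]
  have E2 : ∀ x, ψ x * lap w x =
      ∑ i, ψ x * fderiv ℝ (fun y => fderiv ℝ w y (e i)) x (e i) := fun x => by
    by_cases h : x ∈ tsupport ψ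
    · rw [lap_eq_sum (hw x h), Finset.mul_sum]
    · simp [z _ x h]
  simp only [E1, E2]
  rw [integral_finsetSum, integral_finsetSum]
  · exact Finset.sum_congr rfl fun i _ => (key i).2.2
  · exact fun i _ => (key i).2.1
  · exact fun i _ => (key i).1

end Basic

section PowerIntegrals
variable {n : ℕ}

theorem setLIntegral_ball_scale (F : Euc n → ENNReal) (x c : Euc n) {r : ℝ} (hr : 0 < r) (s : ℝ) :
    ∫⁻ y in ball (x + r • c) (r * s), F y =
      ENNReal.ofReal (r ^ n) * ∫⁻ η in ball c s, F (x + r • η) := by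
  set e : Euc n ≃ᵐ Euc n :=
    ((Homeomorph.smulOfNeZero r hr.ne').trans (Homeomorph.addLeft x)).toMeasurableEquiv with he
  have hee : ∀ η, e η = x + r • η := fun η => rfl
  have hmap : Measure.map e volume = ENNReal.ofReal ((r ^ n)⁻¹) • (volume : Measure (Euc n)) := by
    have h1 : (e : Euc n → Euc n) = (fun z => x + z) ∘ (fun z => r • z) := rfl
    rw [h1, ← Measure.map_map (measurable_const_add x) (measurable_const_smul r),
      Measure.map_addHaar_smul volume hr.ne', Measure.map_smul, map_add_left_eq_self,
      finrank_euclideanSpace_fin, abs_of_pos (by positivity)]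
  have hpre : e ⁻¹' ball (x + r • c) (r * s) = ball c s := by
    ext η
    simp only [mem_preimage, hee, mem_ball, dist_eq_norm]
    rw [show x + r • η - (x + r • c) = r • (η - c) by rw [smul_sub]; abel, norm_smul,
      Real.norm_of_nonneg hr.le]
    exact mul_lt_mul_iff_right₀ hr
  have := e.measurableEmbedding.lintegral_map (μ := volume.restrict (ball c s)) F
  rw [← hpre, ← e.restrict_map, hmap, Measure.restrict_smul, lintegral_smul_measure] at this
  simp only [hee] at this
  rw [← hpre, ← this, smul_eq_mul, ← mul_assoc, ← ENNReal.ofReal_mul (by positivity),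
    mul_inv_cancel₀ (by positivity)]
  simp

theorem setLIntegral_unitBall_rpow_ne_top (hn : 0 < n) {a : ℝ} (ha : a < n) :
    ∫⁻ η in ball (0 : Euc n) 1, ENNReal.ofReal (‖η‖ ^ (-a)) ≠ ⊤ := by
  have : Nontrivial (Euc n) := by
    have : Nonempty (Fin n) := ⟨⟨0, hn⟩⟩
    infer_instance
  have : IntegrableOn (fun η : Euc n => ‖η‖ ^ (-a)) (ball 0 1) := by
    rw [integrableOn_fun_norm_addHaar volume (f := fun t : ℝ => t ^ (-a)), finrank_euclideanSpace_fin]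
    have h : IntegrableOn (fun t : ℝ => t ^ ((n : ℝ) - 1 - a)) (Ioo 0 1) :=
      (intervalIntegral.integrableOn_Ioo_rpow_iff one_pos).mpr (by linarith)
    refine h.congr_fun (fun t ht => ?_) measurableSet_Ioo
    simp only [smul_eq_mul]
    rw [← Real.rpow_natCast, ← Real.rpow_add ht.1, Nat.cast_sub hn]
    congr 1
    push_cast
    ring
  have h2 := this.lintegral_lt_top
  exact h2.ne

theorem exists_setLIntegral_ball_rpow_le (hn : 0 < n) {a : ℝ} (ha : a < n) :
    ∃ C : ℝ, 0 ≤ C ∧ ∀ (x : Euc n) (s : ℝ), 0 < s →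
      ∫⁻ y in ball x s, ENNReal.ofReal (‖y - x‖ ^ (-a)) ≤ ENNReal.ofReal (C * s ^ (n - a)) := by
  refine ⟨_, ENNReal.toReal_nonneg (a := ∫⁻ η in ball (0 : Euc n) 1, ENNReal.ofReal (‖η‖ ^ (-a))),
    fun x s hs => ?_⟩
  have h := setLIntegral_ball_scale (fun y => ENNReal.ofReal (‖y - x‖ ^ (-a))) x 0 hs 1
  simp only [smul_zero, add_zero, mul_one, add_sub_cancel_left, norm_smul,
    Real.norm_of_nonneg hs.le] at h
  rw [h]
  simp only [Real.mul_rpow hs.le (norm_nonneg _)]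
  simp only [ENNReal.ofReal_mul (Real.rpow_nonneg hs.le _)]
  rw [lintegral_const_mul' _ _ ENNReal.ofReal_ne_top, ← mul_assoc,
    ← ENNReal.ofReal_mul (by positivity), mul_comm,
    ENNReal.ofReal_mul ENNReal.toReal_nonneg,
    ENNReal.ofReal_toReal (setLIntegral_unitBall_rpow_ne_top hn ha),
    ← Real.rpow_natCast, ← Real.rpow_add hs, sub_eq_add_neg]

theorem exists_rpow_mul_rpow_le {N a b p D : ℝ} (ha : a < N) (hab : a + b < N + p) :
    ∃ C m : ℝ, 0 ≤ C ∧ m < N ∧ ∀ u v : ℝ, 0 < u → u ≤ v → v ≤ D →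
      u ^ (-a) * v ^ (p - b) ≤ C * u ^ (-m) := by
  rcases le_or_gt p b with h | h
  · refine ⟨1, a + b - p, by norm_num, by linarith, fun u v hu huv _ => ?_⟩
    rw [one_mul, show -(a + b - p) = -a + (p - b) by ring, Real.rpow_add hu]
    gcongr ?_ * ?_
    exact Real.rpow_le_rpow_of_nonpos hu huv (by linarith)
  · refine ⟨|D| ^ (p - b), a, by positivity, ha, fun u v hu huv hv => ?_⟩
    rw [mul_comm]
    gcongr ?_ * ?_
    exact Real.rpow_le_rpow (hu.le.trans huv) (hv.trans (le_abs_self D)) (by linarith)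

/-- Convolution of two power singularities. -/
theorem exists_setLIntegral_rpow_mul_rpow_le (hn : 0 < n) {a b p R : ℝ} (ha : a < n) (hb : b < n)
    (hp : 0 ≤ p) (hab : a + b < n + p) (hR : 0 < R) :
    ∃ C : ℝ, 0 ≤ C ∧ ∀ x : Euc n, x ≠ 0 → ‖x‖ ≤ R →
      ∫⁻ y in ball (0 : Euc n) R, ENNReal.ofReal (‖x - y‖ ^ (-a) * ‖y‖ ^ (-b)) ≤
        ENNReal.ofReal (C * ‖x‖ ^ (-p)) := by
  obtain ⟨C1, m1, hC1, hm1, H1⟩ := exists_rpow_mul_rpow_le (D := 2 * R) ha hab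
  obtain ⟨C2, m2, hC2, hm2, H2⟩ := exists_rpow_mul_rpow_le (N := n) (a := b) (b := a) (p := p)
    (D := 2 * R) hb (by linarith)
  obtain ⟨K1, hK1, G1⟩ := exists_setLIntegral_ball_rpow_le (n := n) hn hm1
  obtain ⟨K2, hK2, G2⟩ := exists_setLIntegral_ball_rpow_le (n := n) hn hm2
  set A1 : ℝ := 2 ^ p * C1
  set A2 : ℝ := 2 ^ p * C2
  have hA1 : 0 ≤ A1 := by positivity
  have hA2 : 0 ≤ A2 := by positivity
  refine ⟨A1 * (K1 * (2 * R) ^ (n - m1)) + A2 * (K2 * R ^ (n - m2)), by positivity, ?_⟩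
  intro x hx hxR
  have hx0 : 0 < ‖x‖ := norm_pos_iff.mpr hx
  have pt : ∀ y ∈ ball (0 : Euc n) R, y ≠ 0 → y ≠ x →
      ‖x - y‖ ^ (-a) * ‖y‖ ^ (-b) ≤
        ‖x‖ ^ (-p) * (A1 * ‖y - x‖ ^ (-m1) + A2 * ‖y‖ ^ (-m2)) := by
    intro y hy hy0 hyx
    rw [norm_sub_rev y x]
    have hv : 0 < ‖y‖ := norm_pos_iff.mpr hy0
    have hu : 0 < ‖x - y‖ := norm_pos_iff.mpr (sub_ne_zero.mpr hyx.symm)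
    have hyR : ‖y‖ < R := by simpa using hy
    have hxy : ‖x‖ ≤ ‖x - y‖ + ‖y‖ := by simpa using norm_add_le (x - y) y
    have huR : ‖x - y‖ ≤ 2 * R := (norm_sub_le x y).trans (by linarith)
    have hxp : ‖x‖ ^ (-p) * ‖x‖ ^ p = 1 := by
      rw [← Real.rpow_add hx0]; simp
    set u := ‖x - y‖
    set v := ‖y‖
    suffices h : ‖x‖ ^ p * (u ^ (-a) * v ^ (-b)) ≤ A1 * u ^ (-m1) + A2 * v ^ (-m2) by
      calc u ^ (-a) * v ^ (-b) = ‖x‖ ^ (-p) * (‖x‖ ^ p * (u ^ (-a) * v ^ (-b))) := by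
            rw [← mul_assoc, hxp, one_mul]
        _ ≤ _ := by gcongr
    rcases le_total u v with h | h
    · have h1 : ‖x‖ ^ p ≤ 2 ^ p * v ^ p := by
        rw [← Real.mul_rpow (by norm_num) hv.le]
        exact Real.rpow_le_rpow hx0.le (by linarith) hp
      have h2 := H1 u v hu h (by linarith)
      calc ‖x‖ ^ p * (u ^ (-a) * v ^ (-b)) ≤ 2 ^ p * v ^ p * (u ^ (-a) * v ^ (-b)) := by gcongr
        _ = 2 ^ p * (u ^ (-a) * v ^ (p - b)) := by
            rw [sub_eq_add_neg, Real.rpow_add hv]; ring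
        _ ≤ 2 ^ p * (C1 * u ^ (-m1)) := by gcongr
        _ = A1 * u ^ (-m1) + 0 := by ring
        _ ≤ _ := by gcongr; positivity
    · have h1 : ‖x‖ ^ p ≤ 2 ^ p * u ^ p := by
        rw [← Real.mul_rpow (by norm_num) hu.le]
        exact Real.rpow_le_rpow hx0.le (by linarith) hp
      have h2 := H2 v u hv h (by linarith)
      calc ‖x‖ ^ p * (u ^ (-a) * v ^ (-b)) ≤ 2 ^ p * u ^ p * (u ^ (-a) * v ^ (-b)) := by gcongr
        _ = 2 ^ p * (v ^ (-b) * u ^ (p - a)) := by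
            rw [sub_eq_add_neg, Real.rpow_add hu]; ring
        _ ≤ 2 ^ p * (C2 * v ^ (-m2)) := by gcongr
        _ = 0 + A2 * v ^ (-m2) := by ring
        _ ≤ _ := by gcongr; positivity
  have : Nontrivial (Euc n) := ⟨⟨x, 0, hx⟩⟩
  have hae : ∀ᵐ y ∂(volume.restrict (ball (0 : Euc n) R)),
      ENNReal.ofReal (‖x - y‖ ^ (-a) * ‖y‖ ^ (-b)) ≤
        ENNReal.ofReal (‖x‖ ^ (-p)) * (ENNReal.ofReal A1 * ENNReal.ofReal (‖y - x‖ ^ (-m1)) +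
          ENNReal.ofReal A2 * ENNReal.ofReal (‖y - 0‖ ^ (-m2))) := by
    have e0 : ∀ᵐ y ∂(volume.restrict (ball (0 : Euc n) R)), y ≠ 0 :=
      ae_restrict_of_ae (Measure.ae_ne volume 0)
    have ex : ∀ᵐ y ∂(volume.restrict (ball (0 : Euc n) R)), y ≠ x :=
      ae_restrict_of_ae (Measure.ae_ne volume x)
    filter_upwards [e0, ex, ae_restrict_mem measurableSet_ball] with y h0 h1 h2
    rw [← ENNReal.ofReal_mul hA1, ← ENNReal.ofReal_mul hA2,
      ← ENNReal.ofReal_add (by positivity) (by positivity), ← ENNReal.ofReal_mul (by positivity),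
      sub_zero]
    exact ENNReal.ofReal_le_ofReal (pt y h2 h0 h1)
  refine (lintegral_mono_ae hae).trans ?_
  rw [lintegral_const_mul' _ _ ENNReal.ofReal_ne_top, lintegral_add_left (by fun_prop),
    lintegral_const_mul' _ _ ENNReal.ofReal_ne_top, lintegral_const_mul' _ _ ENNReal.ofReal_ne_top,
    mul_comm (ENNReal.ofReal (‖x‖ ^ (-p))), ENNReal.ofReal_mul' (Real.rpow_nonneg (norm_nonneg x) _)]
  refine mul_le_mul' ?_ le_rfl
  rw [ENNReal.ofReal_add (by positivity) (by positivity), ENNReal.ofReal_mul hA1,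
    ENNReal.ofReal_mul hA2]
  gcongr
  · refine le_trans (lintegral_mono_set ?_) (G1 x (2 * R) (by positivity))
    intro y hy
    have : ‖y‖ < R := by simpa using hy
    rw [mem_ball, dist_eq_norm]
    exact (norm_sub_le y x).trans_lt (by linarith)
  · exact G2 0 R hR

end PowerIntegrals

section LocalSup
variable {n : ℕ}

theorem eventually_const_mul_rpow_le (B : ℝ) {e : ℝ} (he : e < 1) :
    ∀ᶠ M : ℝ in atTop, B * M ^ e ≤ M / 4 := by
  have h1 : Tendsto (fun M : ℝ => B * M ^ (-(1 - e))) atTop (𝓝 (B * 0)) :=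
    (tendsto_rpow_neg_atTop (by linarith)).const_mul B
  rw [mul_zero] at h1
  filter_upwards [h1.eventually_le_const (show (0 : ℝ) < 1 / 4 by norm_num),
    eventually_gt_atTop 0] with M hM hM0
  have : M ^ e = M ^ (-(1 - e)) * M := by
    rw [show M ^ (-(1 - e)) * M = M ^ (-(1 - e)) * M ^ (1 : ℝ) by rw [Real.rpow_one],
      ← Real.rpow_add hM0]
    congr 1
    ring
  rw [this, ← mul_assoc]
  nlinarith

theorem le_add_rpow_mul_rpow {T v q : ℝ} (hT : 0 < T) (hv : 0 ≤ v) (hq : 1 ≤ q) :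
    v ≤ T + T ^ (1 - q) * v ^ q := by
  rcases le_or_gt v T with h | h
  · have : 0 ≤ T ^ (1 - q) * v ^ q := by positivity
    linarith
  · have hv0 : 0 < v := hT.trans h
    have h1 : v ^ (1 - q) ≤ T ^ (1 - q) := Real.rpow_le_rpow_of_nonpos hT h.le (by linarith)
    have h2 : v ^ (1 - q) * v ^ q = v := by
      rw [← Real.rpow_add hv0]; simp
    have : v ^ (1 - q) * v ^ q ≤ T ^ (1 - q) * v ^ q := by gcongr
    linarith

theorem rpow_neg_mul_rpow_le {t v α μ q : ℝ} (ht : 0 < t) (hv : 0 ≤ v) (hμ : 0 ≤ μ) (hμq : μ < q) :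
    t ^ (-α) * v ^ μ ≤ t ^ (-(α * q / (q - μ))) + v ^ q := by
  have hd : 0 < q - μ := by linarith
  rcases le_or_gt (t ^ (-α)) (v ^ (q - μ)) with h | h
  · have : t ^ (-α) * v ^ μ ≤ v ^ (q - μ) * v ^ μ := by gcongr
    rw [← Real.rpow_add_of_nonneg hv hd.le hμ, sub_add_cancel] at this
    have : 0 ≤ t ^ (-(α * q / (q - μ))) := by positivity
    linarith
  · have h1 : v ^ μ ≤ t ^ (-α * (μ / (q - μ))) := by
      have : (v ^ (q - μ)) ^ (μ / (q - μ)) ≤ (t ^ (-α)) ^ (μ / (q - μ)) := by gcongr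
      rwa [← Real.rpow_mul hv, ← Real.rpow_mul ht.le, mul_div_cancel₀ _ hd.ne'] at this
    have h2 : t ^ (-α) * v ^ μ ≤ t ^ (-α) * t ^ (-α * (μ / (q - μ))) := by gcongr
    rw [← Real.rpow_add ht, show -α + -α * (μ / (q - μ)) = -(α * q / (q - μ)) by
      field_simp; ring] at h2
    have : 0 ≤ v ^ q := by positivity
    linarith

theorem rpow_le_one_add_rpow {v a b : ℝ} (hv : 0 ≤ v) (ha : 0 ≤ a) (hab : a ≤ b) :
    v ^ a ≤ 1 + v ^ b := by
  have hb : 0 ≤ v ^ b := by positivity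
  rcases le_or_gt v 1 with h | h
  · have := Real.rpow_le_one hv h ha
    linarith
  · have := Real.rpow_le_rpow_of_exponent_le h.le hab
    linarith

theorem exists_volume_ball_le (hn : 0 < n) :
    ∃ C : ℝ, 0 ≤ C ∧ ∀ (x : Euc n) (s : ℝ), 0 < s →
      volume (ball x s) ≤ ENNReal.ofReal (C * s ^ (n : ℝ)) := by
  obtain ⟨C, hC, h⟩ := exists_setLIntegral_ball_rpow_le (n := n) hn (a := 0) (by exact_mod_cast hn)
  refine ⟨C, hC, fun x s hs => ?_⟩
  simpa using h x s hs

theorem norm_le_norm_sub_add_norm (a b : Euc n) : ‖a‖ ≤ ‖a - b‖ + ‖b‖ := by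
  have := norm_add_le (a - b) b
  rwa [sub_add_cancel] at this

set_option maxHeartbeats 1000000 in
theorem local_sup_bound (hn : 0 < n) {α lam sig q C0 K : ℝ} (hα0 : 0 < α) (hαn : α < n)
    (hlam : 0 < lam) (hsig : 0 ≤ sig) (hq1 : 1 ≤ q) (hqlam : lam ≤ q) (hC0 : 0 ≤ C0) (hK : 0 ≤ K)
    (hcrit : sig + max 0 (lam - q * (1 - α / n)) < 1 + 2 * q / n) :
    ∃ C' : ℝ, ∀ v : Euc n → ℝ, (∀ η, 0 ≤ v η) → ContinuousOn v (ball 0 1) →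
      (∫⁻ η in ball 0 1, ENNReal.ofReal (v η ^ q) ≤ ENNReal.ofReal K) →
      (∀ (η : Euc n) (s G : ℝ), 0 < s → closedBall η s ⊆ ball 0 (1 / 2) → 0 ≤ G →
        (∀ ζ ∈ ball η s, (1 + ∫⁻ ξ in ball 0 1, ENNReal.ofReal (‖ζ - ξ‖ ^ (-α) * v ξ ^ lam)) *
          ENNReal.ofReal (v ζ ^ sig) ≤ ENNReal.ofReal G) →
        ENNReal.ofReal (v η) ≤ ENNReal.ofReal (C0 * s ^ 2 * G) +
          ENNReal.ofReal (C0 * s ^ (-(n : ℝ))) * ∫⁻ ξ in ball η s, ENNReal.ofReal (v ξ)) →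
      v 0 ≤ C' := by
  have hn' : (0 : ℝ) < n := by exact_mod_cast hn
  have hq0 : 0 < q := by linarith
  have hαn1 : 0 < 1 - α / n := by rw [sub_pos, div_lt_one hn']; exact hαn
  -- choice of the exponents
  obtain ⟨e, he1, he2⟩ : ∃ e, max 0 (lam - q * (1 - α / n)) < e ∧ e < min lam (1 + 2 * q / n - sig) :=
    exists_between (lt_min (max_lt hlam (by nlinarith)) (by linarith))
  obtain ⟨he0, he3⟩ := max_lt_iff.mp he1
  obtain ⟨he4, he5⟩ := lt_min_iff.mp he2
  have hqn : 0 < q / n := by positivity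
  obtain ⟨θ, hθ1, hθ2⟩ : ∃ θ, max 0 ((e + sig - 1) / 2) < θ ∧ θ < q / n :=
    exists_between (max_lt hqn (by
      rw [div_lt_iff₀ (by norm_num)]
      have : q / n * 2 = 2 * q / n := by ring
      linarith))
  obtain ⟨hθ0, hθ3⟩ := max_lt_iff.mp hθ1
  set μ := lam - e with hμ
  have hμ0 : 0 ≤ μ := by linarith
  have hμq' : μ < q * (1 - α / n) := by linarith
  have hμq : μ < q := by
    have : 0 < α / n := by positivity
    nlinarith
  set a := α * q / (q - μ) with ha
  have han : a < n := by
    rw [ha, div_lt_iff₀ (by linarith)]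
    have h1 : n * (q * (1 - α / n)) = n * q - q * α := by field_simp
    have h2 := mul_lt_mul_of_pos_left hμq' hn'
    nlinarith
  set k := α / e + 2 / θ with hk
  have hk0 : 0 < k := by positivity
  have hk1 : α / k ≤ e := by
    rw [div_le_iff₀ hk0, hk, mul_add, mul_div_cancel₀ _ he0.ne']
    have : 0 ≤ e * (2 / θ) := by positivity
    linarith
  have hk2 : 1 / k < θ := by
    rw [div_lt_iff₀ hk0, hk, mul_add, mul_div_cancel₀ _ hθ0.ne']
    have : 0 ≤ θ * (α / e) := by positivity
    linarith
  obtain ⟨K1, hK1, G1⟩ := exists_setLIntegral_ball_rpow_le (n := n) hn han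
  obtain ⟨K2, hK2, G2⟩ := exists_volume_ball_le (n := n) hn
  set A0 : ℝ := (2 ^ k) ^ e + 4 ^ α with hA0
  have hA0' : 0 ≤ A0 := by positivity
  set A : ℝ := A0 * (K1 * 2 ^ (n - a) + K + K2) with hA
  have hA' : 0 ≤ A := by positivity
  set B : ℝ := (1 + A) * (2 ^ k) ^ sig with hB
  have hB' : 0 ≤ B := by positivity
  set τ : ℝ := 1 / (4 * (C0 * K2 + 1)) with hτ
  have hτ0 : 0 < τ := by positivity
  have hτ1 : C0 * K2 * τ ≤ 1 / 4 := by
    rw [hτ, mul_one_div, div_le_div_iff₀ (by positivity) (by norm_num)]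
    linarith
  have hM0 : ∀ᶠ M : ℝ in atTop, 1 ≤ M ∧ M ^ (-θ + 1 / k) ≤ 1 / 8 ∧
      C0 * B * M ^ (e + sig - 2 * θ) ≤ M / 4 ∧
      C0 * K * τ ^ (1 - q) * M ^ (1 - q + n * θ) ≤ M / 4 := by
    have t1 : Tendsto (fun M : ℝ => M ^ (-(θ - 1 / k))) atTop (𝓝 0) :=
      tendsto_rpow_neg_atTop (by linarith)
    have hθn : n * θ < q := by
      have := mul_lt_mul_of_pos_left hθ2 hn'
      rwa [mul_div_cancel₀ _ hn'.ne'] at this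
    filter_upwards [eventually_ge_atTop 1,
      t1.eventually_le_const (show (0 : ℝ) < 1 / 8 by norm_num),
      eventually_const_mul_rpow_le (C0 * B) (e := e + sig - 2 * θ) (by linarith),
      eventually_const_mul_rpow_le (C0 * K * τ ^ (1 - q)) (e := 1 - q + n * θ) (by linarith)]
      with M h1 h2 h3 h4
    exact ⟨h1, by rwa [show -θ + 1 / k = -(θ - 1 / k) by ring], h3, h4⟩
  obtain ⟨M0, hM0⟩ := hM0.exists_forall_of_atTop
  refine ⟨2 ^ k * max 1 M0, fun v hv0 hvc hvK hmv => ?_⟩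
  clear_value μ a k A0 A B τ
  -- the weighted maximum
  have hcont : ContinuousOn (fun η : Euc n => (1 / 2 - ‖η‖) ^ k * v η) (closedBall 0 (1 / 2)) := by
    refine ContinuousOn.mul ?_ (hvc.mono (closedBall_subset_ball (by norm_num)))
    exact ((continuous_const.sub continuous_norm).rpow_const fun _ => Or.inr hk0.le).continuousOn
  obtain ⟨η0, hη0, hmax⟩ := (isCompact_closedBall (0 : Euc n) (1 / 2)).exists_isMaxOn
    ⟨0, by simp⟩ hcont
  set d0 := 1 / 2 - ‖η0‖ with hd0
  set M := v η0 with hM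
  clear_value d0 M
  have hd0nn : 0 ≤ d0 := by
    have : ‖η0‖ ≤ 1 / 2 := by simpa using hη0
    linarith
  have hd01 : d0 ≤ 1 / 2 := by
    have := norm_nonneg η0
    linarith
  have hmax' : ∀ ζ : Euc n, ‖ζ‖ ≤ 1 / 2 → (1 / 2 - ‖ζ‖) ^ k * v ζ ≤ d0 ^ k * M := by
    intro ζ hζ
    rw [hd0, hM]
    exact hmax (show ζ ∈ closedBall 0 (1 / 2) by rwa [mem_closedBall_zero_iff])
  have hv00 : v 0 ≤ 2 ^ k * (d0 ^ k * M) := by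
    have := hmax' 0 (by simp)
    rw [norm_zero, sub_zero, one_div, Real.inv_rpow (by norm_num)] at this
    have h2 : (0 : ℝ) < 2 ^ k := by positivity
    calc v 0 = 2 ^ k * ((2 ^ k)⁻¹ * v 0) := by field_simp
      _ ≤ _ := by gcongr
  refine hv00.trans ?_
  gcongr
  rcases lt_or_ge (d0 ^ k * M) 1 with hL | hL
  · exact hL.le.trans (le_max_left _ _)
  have hMnn : 0 ≤ M := hM ▸ hv0 η0
  have hd0k : d0 ^ k ≤ 1 := Real.rpow_le_one hd0nn (by linarith) hk0.le
  have hMM : d0 ^ k * M ≤ M := by nlinarith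
  refine hMM.trans ?_
  by_contra hcon
  have hMgt : M0 < M := (le_max_right _ _).trans_lt (not_le.mp hcon)
  obtain ⟨hM1, hs8, hE1, hE2⟩ := hM0 M hMgt.le
  have hMpos : 0 < M := by linarith
  have hd0pos : 0 < d0 := by
    rcases hd0nn.eq_or_lt with h | h
    · rw [← h, Real.zero_rpow hk0.ne'] at hL
      norm_num at hL
    · exact h
  have hd0M : M ^ (-(1 / k)) ≤ d0 := by
    have h1 : M⁻¹ ≤ d0 ^ k := by
      rw [inv_le_iff_one_le_mul₀ hMpos]; exact hL
    have h2 : (M⁻¹) ^ (1 / k) ≤ (d0 ^ k) ^ (1 / k) := by gcongr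
    rwa [← Real.rpow_mul hd0nn, mul_one_div_cancel hk0.ne', Real.rpow_one,
      Real.inv_rpow hMpos.le, ← Real.rpow_neg hMpos.le] at h2
  set s := M ^ (-θ) with hs
  have hs0 : 0 < s := by positivity
  clear_value s
  have hsd : s ≤ d0 / 8 := by
    have : s = M ^ (-θ + 1 / k) * M ^ (-(1 / k)) := by
      rw [hs, ← Real.rpow_add hMpos]; congr 1; ring
    rw [this]
    calc _ ≤ 1 / 8 * d0 := by gcongr
      _ = d0 / 8 := by ring
  have hvle : ∀ ζ ∈ ball η0 (d0 / 2), v ζ ≤ 2 ^ k * M := by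
    intro ζ hζ
    have h1 : ‖ζ‖ ≤ ‖ζ - η0‖ + ‖η0‖ := norm_le_norm_sub_add_norm ζ η0
    have h2 : ‖ζ - η0‖ < d0 / 2 := by rwa [mem_ball, dist_eq_norm] at hζ
    have h3 : d0 / 2 ≤ 1 / 2 - ‖ζ‖ := by linarith
    have h4 := hmax' ζ (by linarith)
    have h5 : (d0 / 2) ^ k * v ζ ≤ (1 / 2 - ‖ζ‖) ^ k * v ζ :=
      mul_le_mul_of_nonneg_right (Real.rpow_le_rpow (by positivity) h3 hk0.le) (hv0 _)
    have h6 := h5.trans h4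
    rw [Real.div_rpow hd0nn (by norm_num), div_mul_eq_mul_div,
      div_le_iff₀ (by positivity), mul_assoc] at h6
    have := le_of_mul_le_mul_left h6 (by positivity)
    linarith
  have hJ : ∀ ζ ∈ ball η0 s,
      ∫⁻ ξ in ball 0 1, ENNReal.ofReal (‖ζ - ξ‖ ^ (-α) * v ξ ^ lam) ≤
        ENNReal.ofReal (A * M ^ e) := by
    intro ζ hζ
    have hζs : ‖ζ - η0‖ < s := by rwa [mem_ball, dist_eq_norm] at hζ
    have hζ1 : ‖ζ‖ < 1 := by
      have h1 : ‖ζ‖ ≤ ‖ζ - η0‖ + ‖η0‖ := norm_le_norm_sub_add_norm ζ η0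
      linarith
    have pt : ∀ ξ : Euc n, ‖ζ - ξ‖ ^ (-α) * v ξ ^ lam ≤
        A0 * M ^ e * (‖ξ - ζ‖ ^ (-a) + v ξ ^ q + 1) := by
      intro ξ
      rw [norm_sub_rev ξ ζ]
      have hq' : 0 ≤ v ξ ^ q := Real.rpow_nonneg (hv0 _) _
      rcases eq_or_lt_of_le (norm_nonneg (ζ - ξ)) with h0 | h0
      · rw [← h0, Real.zero_rpow (by linarith), zero_mul]
        positivity
      by_cases hξ : ξ ∈ ball η0 (d0 / 2)
      · have h1 : v ξ ^ lam = v ξ ^ e * v ξ ^ μ := by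
          rw [← Real.rpow_add_of_nonneg (hv0 _) he0.le hμ0, hμ]; congr 1; ring
        have h2 : v ξ ^ e ≤ (2 ^ k * M) ^ e := Real.rpow_le_rpow (hv0 _) (hvle ξ hξ) he0.le
        have h3 := rpow_neg_mul_rpow_le (α := α) h0 (hv0 ξ) hμ0 hμq
        rw [← ha] at h3
        have h4 : 0 ≤ v ξ ^ μ := Real.rpow_nonneg (hv0 _) _
        calc ‖ζ - ξ‖ ^ (-α) * v ξ ^ lam = v ξ ^ e * (‖ζ - ξ‖ ^ (-α) * v ξ ^ μ) := by rw [h1]; ring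
          _ ≤ (2 ^ k * M) ^ e * (‖ζ - ξ‖ ^ (-a) + v ξ ^ q) :=
            mul_le_mul h2 h3 (by positivity) (by positivity)
          _ = (2 ^ k) ^ e * M ^ e * (‖ζ - ξ‖ ^ (-a) + v ξ ^ q) := by
            rw [Real.mul_rpow (by positivity) hMnn]
          _ ≤ _ := by
            refine mul_le_mul (mul_le_mul_of_nonneg_right ?_ (by positivity)) (by linarith)
              (by positivity) (by positivity)
            rw [hA0]
            have : (0 : ℝ) ≤ 4 ^ α := by positivity
            linarith
      · have h1 : d0 / 2 ≤ ‖ξ - η0‖ := by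
          rw [mem_ball, dist_eq_norm, not_lt] at hξ; exact hξ
        have h2 : ‖ξ - η0‖ ≤ ‖ζ - ξ‖ + ‖ζ - η0‖ := by
          have := norm_sub_le (ζ - η0) (ζ - ξ)
          rw [show ζ - η0 - (ζ - ξ) = ξ - η0 by abel] at this
          linarith
        have h3 : d0 / 4 ≤ ‖ζ - ξ‖ := by linarith
        have h4 : ‖ζ - ξ‖ ^ (-α) ≤ 4 ^ α * M ^ e := by
          calc ‖ζ - ξ‖ ^ (-α) ≤ (d0 / 4) ^ (-α) :=
                Real.rpow_le_rpow_of_nonpos (by positivity) h3 (by linarith)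
            _ = 4 ^ α * d0 ^ (-α) := by
                rw [Real.div_rpow hd0nn (by norm_num), Real.rpow_neg (by norm_num : (0 : ℝ) ≤ 4),
                  div_inv_eq_mul, mul_comm]
            _ ≤ 4 ^ α * (M ^ (-(1 / k))) ^ (-α) := by
                gcongr ?_ * ?_
                exact Real.rpow_le_rpow_of_nonpos (by positivity) hd0M (by linarith)
            _ = 4 ^ α * M ^ (α / k) := by
                rw [← Real.rpow_mul hMnn]; congr 2; ring
            _ ≤ 4 ^ α * M ^ e := by
                gcongr
        have h5 := rpow_le_one_add_rpow (hv0 ξ) hlam.le hqlam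
        have h6 : 0 ≤ ‖ζ - ξ‖ ^ (-a) := by positivity
        calc ‖ζ - ξ‖ ^ (-α) * v ξ ^ lam ≤ 4 ^ α * M ^ e * (1 + v ξ ^ q) :=
              mul_le_mul h4 h5 (Real.rpow_nonneg (hv0 _) _) (by positivity)
          _ ≤ _ := by
            refine mul_le_mul (mul_le_mul_of_nonneg_right ?_ (by positivity)) (by linarith)
              (by positivity) (by positivity)
            rw [hA0]
            have : (0 : ℝ) ≤ (2 ^ k) ^ e := by positivity
            linarith
    have i1 : ∫⁻ ξ in ball 0 1, ENNReal.ofReal (‖ξ - ζ‖ ^ (-a)) ≤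
        ENNReal.ofReal (K1 * 2 ^ (n - a)) := by
      refine (lintegral_mono_set ?_).trans (G1 ζ 2 (by norm_num))
      intro ξ hξ
      have : ‖ξ‖ < 1 := by simpa using hξ
      rw [mem_ball, dist_eq_norm]
      exact (norm_sub_le ξ ζ).trans_lt (by linarith)
    calc ∫⁻ ξ in ball 0 1, ENNReal.ofReal (‖ζ - ξ‖ ^ (-α) * v ξ ^ lam)
        ≤ ∫⁻ ξ in ball 0 1, ENNReal.ofReal (A0 * M ^ e) *
            (ENNReal.ofReal (‖ξ - ζ‖ ^ (-a)) + (ENNReal.ofReal (v ξ ^ q) + 1)) := by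
          refine lintegral_mono fun ξ => ?_
          have hq' : 0 ≤ v ξ ^ q := Real.rpow_nonneg (hv0 _) _
          rw [← ENNReal.ofReal_one, ← ENNReal.ofReal_add hq' (by norm_num),
            ← ENNReal.ofReal_add (by positivity) (by positivity),
            ← ENNReal.ofReal_mul (by positivity)]
          refine ENNReal.ofReal_le_ofReal ((pt ξ).trans (le_of_eq ?_))
          ring
      _ = ENNReal.ofReal (A0 * M ^ e) * ((∫⁻ ξ in ball 0 1, ENNReal.ofReal (‖ξ - ζ‖ ^ (-a))) +
            ((∫⁻ ξ in ball (0 : Euc n) 1, ENNReal.ofReal (v ξ ^ q)) + volume (ball (0 : Euc n) 1))) := by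
          rw [lintegral_const_mul' _ _ ENNReal.ofReal_ne_top, lintegral_add_left (by fun_prop),
            lintegral_add_right _ measurable_const]
          simp
      _ ≤ ENNReal.ofReal (A0 * M ^ e) * (ENNReal.ofReal (K1 * 2 ^ (n - a)) +
            (ENNReal.ofReal K + ENNReal.ofReal (K2 * 1 ^ (n : ℝ)))) := by
          gcongr
          exact G2 0 1 (by norm_num)
      _ = ENNReal.ofReal (A * M ^ e) := by
          rw [← ENNReal.ofReal_add hK (by positivity),
            ← ENNReal.ofReal_add (by positivity) (by positivity),
            ← ENNReal.ofReal_mul (by positivity), Real.one_rpow]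
          congr 1
          rw [hA]; ring
  have hG : ∀ ζ ∈ ball η0 s,
      (1 + ∫⁻ ξ in ball 0 1, ENNReal.ofReal (‖ζ - ξ‖ ^ (-α) * v ξ ^ lam)) *
        ENNReal.ofReal (v ζ ^ sig) ≤ ENNReal.ofReal (B * M ^ (e + sig)) := by
    intro ζ hζ
    have h1 : v ζ ≤ 2 ^ k * M := hvle ζ (ball_subset_ball (by linarith) hζ)
    have h2 : v ζ ^ sig ≤ (2 ^ k) ^ sig * M ^ sig := by
      rw [← Real.mul_rpow (by positivity) hMnn]
      exact Real.rpow_le_rpow (hv0 _) h1 hsig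
    have h3 : (1 : ℝ) ≤ M ^ e := Real.one_le_rpow hM1 he0.le
    calc _ ≤ (1 + ENNReal.ofReal (A * M ^ e)) * ENNReal.ofReal ((2 ^ k) ^ sig * M ^ sig) := by
          gcongr
          exact hJ ζ hζ
      _ = ENNReal.ofReal ((1 + A * M ^ e) * ((2 ^ k) ^ sig * M ^ sig)) := by
          rw [← ENNReal.ofReal_one, ← ENNReal.ofReal_add (by norm_num) (by positivity),
            ← ENNReal.ofReal_mul (by positivity)]
      _ ≤ _ := by
          refine ENNReal.ofReal_le_ofReal ?_
          rw [hB, Real.rpow_add hMpos]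
          calc _ ≤ (M ^ e + A * M ^ e) * ((2 ^ k) ^ sig * M ^ sig) := by gcongr
            _ = _ := by ring
  have hsub : closedBall η0 s ⊆ ball 0 (1 / 2) := by
    intro ζ hζ
    rw [mem_closedBall, dist_eq_norm] at hζ
    have h1 : ‖ζ‖ ≤ ‖ζ - η0‖ + ‖η0‖ := norm_le_norm_sub_add_norm ζ η0
    rw [mem_ball_zero_iff]
    linarith
  have hfin := hmv η0 s _ hs0 hsub (by positivity) hG
  have hT : 0 < τ * M := by positivity
  have hInt : ∫⁻ ξ in ball η0 s, ENNReal.ofReal (v ξ) ≤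
      ENNReal.ofReal (τ * M * (K2 * s ^ (n : ℝ)) + (τ * M) ^ (1 - q) * K) := by
    calc ∫⁻ ξ in ball η0 s, ENNReal.ofReal (v ξ)
        ≤ ∫⁻ ξ in ball η0 s, (ENNReal.ofReal (τ * M) +
            ENNReal.ofReal ((τ * M) ^ (1 - q)) * ENNReal.ofReal (v ξ ^ q)) := by
          refine lintegral_mono fun ξ => ?_
          have hq' : 0 ≤ v ξ ^ q := Real.rpow_nonneg (hv0 _) _
          rw [← ENNReal.ofReal_mul (by positivity), ← ENNReal.ofReal_add hT.le (by positivity)]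
          exact ENNReal.ofReal_le_ofReal (le_add_rpow_mul_rpow hT (hv0 _) hq1)
      _ = ENNReal.ofReal (τ * M) * volume (ball η0 s) + ENNReal.ofReal ((τ * M) ^ (1 - q)) *
            ∫⁻ ξ in ball η0 s, ENNReal.ofReal (v ξ ^ q) := by
          rw [lintegral_add_left measurable_const, lintegral_const_mul' _ _ ENNReal.ofReal_ne_top]
          simp
      _ ≤ ENNReal.ofReal (τ * M) * ENNReal.ofReal (K2 * s ^ (n : ℝ)) +
            ENNReal.ofReal ((τ * M) ^ (1 - q)) * ENNReal.ofReal K := by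
          gcongr
          · exact G2 _ _ hs0
          · refine (lintegral_mono_set ?_).trans hvK
            exact ball_subset_closedBall.trans (hsub.trans (ball_subset_ball (by norm_num)))
      _ = _ := by
          rw [← ENNReal.ofReal_mul (by positivity), ← ENNReal.ofReal_mul (by positivity),
            ← ENNReal.ofReal_add (by positivity) (by positivity)]
  have hfin2 : M ≤ C0 * s ^ 2 * (B * M ^ (e + sig)) + C0 * s ^ (-(n : ℝ)) *
      (τ * M * (K2 * s ^ (n : ℝ)) + (τ * M) ^ (1 - q) * K) := by
    rw [← ENNReal.ofReal_le_ofReal_iff (by positivity),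
      ENNReal.ofReal_add (by positivity) (by positivity),
      ENNReal.ofReal_mul (p := C0 * s ^ (-(n : ℝ))) (by positivity)]
    rw [hM]
    rw [hM] at hfin hInt
    exact hfin.trans (add_le_add_right (mul_le_mul_right hInt _) _)
  have r1 : C0 * s ^ 2 * (B * M ^ (e + sig)) = C0 * B * M ^ (e + sig - 2 * θ) := by
    have : s ^ 2 = M ^ (-(2 * θ)) := by
      rw [hs, ← Real.rpow_natCast, ← Real.rpow_mul hMnn]; congr 1; push_cast; ring
    rw [this, sub_eq_add_neg (e + sig), Real.rpow_add hMpos (e + sig)]; ring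
  have r2 : C0 * s ^ (-(n : ℝ)) * (τ * M * (K2 * s ^ (n : ℝ)) + (τ * M) ^ (1 - q) * K) =
      C0 * K2 * τ * M + C0 * K * τ ^ (1 - q) * M ^ (1 - q + n * θ) := by
    have h1 : s ^ (-(n : ℝ)) * s ^ (n : ℝ) = 1 := by
      rw [← Real.rpow_add hs0]; simp
    have h2 : s ^ (-(n : ℝ)) = M ^ (n * θ) := by
      rw [hs, ← Real.rpow_mul hMnn]; congr 1; ring
    rw [Real.rpow_add hMpos, ← h2, Real.mul_rpow hτ0.le hMnn]
    linear_combination (C0 * K2 * τ * M) * h1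
  rw [r1, r2] at hfin2
  have : C0 * K2 * τ * M ≤ 1 / 4 * M := by gcongr
  linarith

end LocalSup

section Kernel
variable {n : ℕ}

theorem exists_cutoff : ∃ χ : ℝ → ℝ, ContDiff ℝ 2 χ ∧ (∀ t ≤ 1 / 4, χ t = 1) ∧ (∀ t, 3 / 4 ≤ t → χ t = 0) ∧
    (∀ t, 0 ≤ χ t) ∧ (∀ t, χ t ≤ 1) ∧
    (∀ t, t < 1 / 4 ∨ 3 / 4 < t → deriv χ t = 0 ∧ deriv (deriv χ) t = 0) ∧
    ∃ B : ℝ, ∀ t, |deriv χ t| ≤ B ∧ |deriv (deriv χ) t| ≤ B := by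
  set χ : ℝ → ℝ := fun t => 1 - Real.smoothTransition (2 * t - 1 / 2) with hχdef
  have hχ : ContDiff ℝ 2 χ := by
    have h1 : ContDiff ℝ 2 Real.smoothTransition := Real.smoothTransition.contDiff (n := 2)
    exact contDiff_const.sub (h1.comp (by fun_prop))
  have h1 : ∀ t ≤ 1 / 4, χ t = 1 := fun t ht => by
    simp only [hχdef]
    rw [Real.smoothTransition.zero_of_nonpos (by linarith), sub_zero]
  have h0 : ∀ t, 3 / 4 ≤ t → χ t = 0 := fun t ht => by
    simp only [hχdef]
    rw [Real.smoothTransition.one_of_one_le (by linarith), sub_self]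
  have loc : ∀ t, t < 1 / 4 ∨ 3 / 4 < t → ∃ c : ℝ, χ =ᶠ[𝓝 t] fun _ => c := by
    rintro t (ht | ht)
    · exact ⟨1, (eventually_lt_nhds ht).mono fun s hs => h1 s hs.le⟩
    · exact ⟨0, (eventually_gt_nhds ht).mono fun s hs => h0 s hs.le⟩
  have hd : ∀ t, t < 1 / 4 ∨ 3 / 4 < t → deriv χ t = 0 ∧ deriv (deriv χ) t = 0 := by
    intro t ht
    obtain ⟨c, hc⟩ := loc t ht
    have h2 := hc.deriv
    simp only [deriv_const'] at h2
    refine ⟨h2.eq_of_nhds, ?_⟩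
    rw [h2.deriv_eq, deriv_const']
  have hχ1 : ContDiff ℝ 1 (deriv χ) := by
    rw [show (2 : WithTop ℕ∞) = 1 + 1 by norm_num, contDiff_succ_iff_deriv] at hχ
    exact hχ.2.2
  have hs1 : HasCompactSupport (deriv χ) := by
    refine HasCompactSupport.intro (K := Icc (1 / 4) (3 / 4)) isCompact_Icc fun t ht => (hd t ?_).1
    by_contra! h
    exact ht h
  have hs2 : HasCompactSupport (deriv (deriv χ)) := hs1.deriv
  obtain ⟨B1, hB1⟩ := hs1.exists_bound_of_continuous hχ1.continuous
  obtain ⟨B2, hB2⟩ := hs2.exists_bound_of_continuous (hχ1.continuous_deriv le_rfl)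
  refine ⟨χ, hχ, h1, h0, fun t => ?_, fun t => ?_, hd, max B1 B2, fun t =>
    ⟨(hB1 t).trans (le_max_left _ _), (hB2 t).trans (le_max_right _ _)⟩⟩
  · simp only [hχdef]
    linarith [Real.smoothTransition.le_one (2 * t - 1 / 2)]
  · simp only [hχdef]
    linarith [Real.smoothTransition.nonneg (2 * t - 1 / 2)]

theorem lap_cutoff_mul_radial {χ k k1 : ℝ → ℝ} {k2 : ℝ} {x y : Euc n} (hχ : ContDiff ℝ 2 χ)
    (h1 : ∀ᶠ t in 𝓝 (‖y - x‖ ^ 2), HasDerivAt k (k1 t) t)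
    (h2 : HasDerivAt k1 k2 (‖y - x‖ ^ 2)) (S : ℝ) :
    lap (fun z => χ (S * ‖z - x‖ ^ 2) * k (‖z - x‖ ^ 2)) y =
      χ (S * ‖y - x‖ ^ 2) * (4 * ‖y - x‖ ^ 2 * k2 + 2 * n * k1 (‖y - x‖ ^ 2)) +
      (8 * ‖y - x‖ ^ 2 * S * deriv χ (S * ‖y - x‖ ^ 2) * k1 (‖y - x‖ ^ 2) +
        4 * ‖y - x‖ ^ 2 * S ^ 2 * deriv (deriv χ) (S * ‖y - x‖ ^ 2) * k (‖y - x‖ ^ 2) +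
        2 * n * S * deriv χ (S * ‖y - x‖ ^ 2) * k (‖y - x‖ ^ 2)) := by
  have hχ1 : ContDiff ℝ 1 (deriv χ) := by
    rw [show (2 : WithTop ℕ∞) = 1 + 1 by norm_num, contDiff_succ_iff_deriv] at hχ
    exact hχ.2.2
  have d1 : ∀ t, HasDerivAt (fun t => χ (S * t)) (deriv χ (S * t) * S) t := fun t => by
    have := (hχ.differentiable (by norm_num) (S * t)).hasDerivAt.comp t ((hasDerivAt_id t).const_mul S)
    simpa [Function.comp_def] using this
  have d2 : ∀ t, HasDerivAt (fun t => deriv χ (S * t)) (deriv (deriv χ) (S * t) * S) t := fun t => by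
    have := (hχ1.differentiable (by norm_num) (S * t)).hasDerivAt.comp t
      ((hasDerivAt_id t).const_mul S)
    simpa [Function.comp_def] using this
  rw [lap_radial (F := fun t => χ (S * t) * k t) (h1.mono fun t ht => (d1 t).mul ht)
    ((((d2 _).mul_const S).mul h1.self_of_nhds).add ((d1 _).mul h2))]
  ring

/-- The regularised Newton kernel, as a function of the squared distance. -/
noncomputable def regKernel (n : ℕ) (ε ρ : ℝ) : ℝ := (ρ + ε ^ 2) ^ (-(((n : ℝ) - 2) / 2))

/-- The total mass of minus the Laplacian of the regularised Newton kernel. -/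
noncomputable def newtonConst (n : ℕ) : ℝ :=
  n * (n - 2) * ∫ y : Euc n, ((1 : ℝ) + ‖y‖ ^ 2) ^ (-((n : ℝ) + 2) / 2)

theorem integral_japanese_pos :
    0 < ∫ y : Euc n, ((1 : ℝ) + ‖y‖ ^ 2) ^ (-((n : ℝ) + 2) / 2) := by
  have hi : Integrable fun y : Euc n => ((1 : ℝ) + ‖y‖ ^ 2) ^ (-((n : ℝ) + 2) / 2) :=
    integrable_rpow_neg_one_add_norm_sq (by simp)
  rw [integral_pos_iff_support_of_nonneg (fun y => by positivity) hi]
  have : Function.support (fun y : Euc n => ((1 : ℝ) + ‖y‖ ^ 2) ^ (-((n : ℝ) + 2) / 2)) = univ := by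
    ext y
    simp only [Function.mem_support, mem_univ, iff_true]
    positivity
  rw [this]
  exact isOpen_univ.measure_pos _ univ_nonempty

theorem newtonConst_pos (hn : 3 ≤ n) : 0 < newtonConst n := by
  have : (3 : ℝ) ≤ n := by exact_mod_cast hn
  exact mul_pos (mul_pos (by linarith) (by linarith)) integral_japanese_pos

theorem tendsto_integral_mul_regularised {g : Euc n → ℝ} {x : Euc n} (hg : Integrable g)
    (hgx : ContinuousAt g x) :
    Tendsto (fun ε : ℝ => ∫ y, g y *
        (n * (n - 2) * ε ^ 2 * (‖y - x‖ ^ 2 + ε ^ 2) ^ (-((n : ℝ) + 2) / 2)))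
      (𝓝[>] 0) (𝓝 (newtonConst n * g x)) := by
  set A := ∫ y : Euc n, ((1 : ℝ) + ‖y‖ ^ 2) ^ (-((n : ℝ) + 2) / 2) with hA
  have hApos : 0 < A := integral_japanese_pos
  set φ : Euc n → ℝ := fun y => A⁻¹ * ((1 : ℝ) + ‖y‖ ^ 2) ^ (-((n : ℝ) + 2) / 2) with hφ
  have h1 : ∀ y, 0 ≤ φ y := fun y => by positivity
  have h2 : ∫ y, φ y = 1 := by
    rw [hφ, integral_const_mul, ← hA, inv_mul_cancel₀ hApos.ne']
  clear_value A
  have h3 : Tendsto (fun y : Euc n => ‖y‖ ^ Module.finrank ℝ (Euc n) * φ y)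
      (Bornology.cobounded (Euc n)) (𝓝 0) := by
    have hlim : Tendsto (fun t : ℝ => A⁻¹ * t ^ (-2 : ℝ)) atTop (𝓝 (A⁻¹ * 0)) :=
      (tendsto_rpow_neg_atTop (by norm_num)).const_mul _
    rw [mul_zero] at hlim
    have hlim' := hlim.comp (tendsto_norm_cobounded_atTop (E := Euc n))
    refine squeeze_zero' (Eventually.of_forall fun y => by positivity) ?_ hlim'
    filter_upwards [(tendsto_norm_cobounded_atTop (E := Euc n)).eventually_gt_atTop 0] with y hy
    simp only [hφ, finrank_euclideanSpace_fin, Function.comp]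
    have : ((1 : ℝ) + ‖y‖ ^ 2) ^ (-((n : ℝ) + 2) / 2) ≤ (‖y‖ ^ 2) ^ (-((n : ℝ) + 2) / 2) :=
      Real.rpow_le_rpow_of_nonpos (by positivity) (by linarith)
        (by have : (0 : ℝ) ≤ n := n.cast_nonneg
            linarith)
    calc ‖y‖ ^ n * (A⁻¹ * ((1 : ℝ) + ‖y‖ ^ 2) ^ (-((n : ℝ) + 2) / 2))
        ≤ ‖y‖ ^ n * (A⁻¹ * (‖y‖ ^ 2) ^ (-((n : ℝ) + 2) / 2)) := by gcongr
      _ = A⁻¹ * ‖y‖ ^ (-2 : ℝ) := by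
        rw [← Real.rpow_natCast ‖y‖ 2, ← Real.rpow_mul hy.le, mul_left_comm, ← Real.rpow_natCast,
          ← Real.rpow_add hy]
        congr 2
        push_cast
        ring
  have key := (tendsto_integral_comp_smul_smul_of_integrable' h1 h2 h3 hg hgx).comp
    tendsto_inv_nhdsGT_zero
  have key2 := key.const_mul (newtonConst n)
  refine key2.congr' ?_
  filter_upwards [self_mem_nhdsWithin] with ε hε
  have hε0 : (0 : ℝ) < ε := hε
  simp only [Function.comp, finrank_euclideanSpace_fin]
  rw [← integral_const_mul]
  congr 1
  ext y
  have e1 : (1 : ℝ) + ‖ε⁻¹ • (x - y)‖ ^ 2 = (ε ^ 2)⁻¹ * (‖y - x‖ ^ 2 + ε ^ 2) := by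
    rw [norm_smul, Real.norm_of_nonneg (by positivity), norm_sub_rev]
    field_simp
    ring
  have e2 : ((ε ^ 2)⁻¹ : ℝ) ^ (-((n : ℝ) + 2) / 2) = ε ^ n * ε ^ 2 := by
    rw [← Real.rpow_natCast ε 2, ← Real.rpow_neg hε0.le, ← Real.rpow_mul hε0.le,
      ← Real.rpow_natCast ε n, ← Real.rpow_add hε0]
    congr 1
    push_cast
    ring
  simp only [hφ, newtonConst, smul_eq_mul]
  rw [e1, Real.mul_rpow (by positivity) (by positivity), e2, ← hA, inv_pow]
  field_simp

theorem regKernel_nonneg {ε ρ : ℝ} (hρ : 0 ≤ ρ) : 0 ≤ regKernel n ε ρ := by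
  unfold regKernel; positivity

theorem regKernel_sq_le (hn : 3 ≤ n) {t : ℝ} (ε : ℝ) (ht : 0 < t) :
    regKernel n ε (t ^ 2) ≤ t ^ (-((n : ℝ) - 2)) := by
  have hn' : (3 : ℝ) ≤ n := by exact_mod_cast hn
  calc regKernel n ε (t ^ 2) ≤ (t ^ 2) ^ (-(((n : ℝ) - 2) / 2)) :=
        Real.rpow_le_rpow_of_nonpos (by positivity) (by nlinarith [sq_nonneg ε]) (by linarith)
    _ = _ := by
      rw [← Real.rpow_natCast t 2, ← Real.rpow_mul ht.le]
      congr 1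
      push_cast
      ring

/-- The derivative of `regKernel`. -/
noncomputable def regKernelDeriv (n : ℕ) (ε ρ : ℝ) : ℝ :=
  -(((n : ℝ) - 2) / 2) * (ρ + ε ^ 2) ^ (-(((n : ℝ) - 2) / 2) - 1)

theorem hasDerivAt_regKernel {ε ρ : ℝ} (h : 0 < ρ + ε ^ 2) :
    HasDerivAt (regKernel n ε) (regKernelDeriv n ε ρ) ρ := by
  have := ((hasDerivAt_id ρ).add_const (ε ^ 2)).rpow_const (p := -(((n : ℝ) - 2) / 2)) (Or.inl h.ne')
  refine (show HasDerivAt (regKernel n ε) _ ρ from this).congr_deriv ?_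
  simp [regKernelDeriv]

theorem hasDerivAt_regKernelDeriv {ε ρ : ℝ} (h : 0 < ρ + ε ^ 2) :
    HasDerivAt (regKernelDeriv n ε) (((n : ℝ) - 2) / 2 * (n / 2) * (ρ + ε ^ 2) ^
      (-((n : ℝ) + 2) / 2)) ρ := by
  have := (((hasDerivAt_id ρ).add_const (ε ^ 2)).rpow_const (p := -(((n : ℝ) - 2) / 2) - 1)
    (Or.inl h.ne')).const_mul (-(((n : ℝ) - 2) / 2))
  refine (show HasDerivAt (regKernelDeriv n ε) _ ρ from this).congr_deriv ?_
  simp only [id]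
  rw [show -(((n : ℝ) - 2) / 2) - 1 - 1 = -((n : ℝ) + 2) / 2 by ring]
  ring

theorem regKernel_radial_lap {ε ρ : ℝ} (h : 0 < ρ + ε ^ 2) :
    4 * ρ * (((n : ℝ) - 2) / 2 * (n / 2) * (ρ + ε ^ 2) ^ (-((n : ℝ) + 2) / 2)) +
      2 * n * regKernelDeriv n ε ρ =
      -(n * (n - 2) * ε ^ 2 * (ρ + ε ^ 2) ^ (-((n : ℝ) + 2) / 2)) := by
  unfold regKernelDeriv
  rw [show -(((n : ℝ) - 2) / 2) - 1 = -((n : ℝ) + 2) / 2 + 1 by ring, Real.rpow_add_one h.ne']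
  ring

theorem contDiff_regKernel {ε : ℝ} (hε : 0 < ε) (z : Euc n) :
    ContDiff ℝ 2 fun y => regKernel n ε (‖y - z‖ ^ 2) := by
  unfold regKernel
  refine ContDiff.rpow_const_of_ne ?_ fun y => by positivity
  exact ((contDiff_id.sub contDiff_const).norm_sq ℝ).add contDiff_const

theorem lap_regKernel {ε : ℝ} (hε : 0 < ε) (z y : Euc n) :
    lap (fun y => regKernel n ε (‖y - z‖ ^ 2)) y =
      -(n * (n - 2) * ε ^ 2 * (‖y - z‖ ^ 2 + ε ^ 2) ^ (-((n : ℝ) + 2) / 2)) := by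
  have hpos : 0 < ‖y - z‖ ^ 2 + ε ^ 2 := by positivity
  rw [lap_radial (F := regKernel n ε) (F1 := regKernelDeriv n ε) ?_ (hasDerivAt_regKernelDeriv hpos),
    regKernel_radial_lap hpos]
  have : ∀ᶠ t in 𝓝 (‖y - z‖ ^ 2), 0 < t + ε ^ 2 :=
    (continuous_id.add continuous_const).continuousAt.eventually (lt_mem_nhds hpos)
  exact this.mono fun t ht => hasDerivAt_regKernel ht

end Kernel

section Representation
variable {n : ℕ}

theorem abs_cutoff_error_le (hn : 3 ≤ n) {χ : ℝ → ℝ} {B : ℝ}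
    (hd : ∀ t, t < 1 / 4 ∨ 3 / 4 < t → deriv χ t = 0 ∧ deriv (deriv χ) t = 0)
    (hB : ∀ t, |deriv χ t| ≤ B ∧ |deriv (deriv χ) t| ≤ B) {ε s t : ℝ}
    (hs : 0 < s) (ht : 0 ≤ t) :
    |8 * t ^ 2 * (s ^ 2)⁻¹ * deriv χ ((s ^ 2)⁻¹ * t ^ 2) * regKernelDeriv n ε (t ^ 2) +
      4 * t ^ 2 * (s ^ 2)⁻¹ ^ 2 * deriv (deriv χ) ((s ^ 2)⁻¹ * t ^ 2) * regKernel n ε (t ^ 2) +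
      2 * n * (s ^ 2)⁻¹ * deriv χ ((s ^ 2)⁻¹ * t ^ 2) * regKernel n ε (t ^ 2)| ≤
    B * 2 ^ ((n : ℝ) - 2) * (4 * (n - 2) + 4 + 2 * n) * s ^ (-(n : ℝ)) := by
  have hn' : (3 : ℝ) ≤ n := by exact_mod_cast hn
  have hB0 : 0 ≤ B := (abs_nonneg _).trans (hB 0).1
  by_cases h : (s ^ 2)⁻¹ * t ^ 2 < 1 / 4 ∨ 3 / 4 < (s ^ 2)⁻¹ * t ^ 2
  · rw [(hd _ h).1, (hd _ h).2]
    simp only [mul_zero, zero_mul, add_zero, abs_zero]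
    have : 0 ≤ 4 * ((n : ℝ) - 2) + 4 + 2 * n := by linarith
    positivity
  push Not at h
  obtain ⟨h1, h2⟩ := h
  set S := (s ^ 2)⁻¹ with hS
  have hS0 : 0 < S := by positivity
  have hts : s / 2 ≤ t := by
    have : s ^ 2 * (1 / 4) ≤ t ^ 2 := by
      rw [hS, inv_mul_eq_div, le_div_iff₀ (by positivity)] at h1
      linarith
    nlinarith
  have ht0 : 0 < t := by linarith
  set k := regKernel n ε (t ^ 2) with hk
  have hk0 : 0 ≤ k := regKernel_nonneg (by positivity)
  have hk1 : k ≤ 2 ^ ((n : ℝ) - 2) * s ^ (-((n : ℝ) - 2)) := by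
    refine (regKernel_sq_le hn ε ht0).trans ?_
    calc t ^ (-((n : ℝ) - 2)) ≤ (s / 2) ^ (-((n : ℝ) - 2)) :=
          Real.rpow_le_rpow_of_nonpos (by positivity) hts (by linarith)
      _ = _ := by
        rw [Real.div_rpow hs.le (by norm_num), Real.rpow_neg (by norm_num : (0 : ℝ) ≤ 2),
          div_inv_eq_mul, mul_comm]
  have hk2 : t ^ 2 * |regKernelDeriv n ε (t ^ 2)| ≤ (n - 2) / 2 * k := by
    have hpos : 0 < t ^ 2 + ε ^ 2 := by positivity
    have hm : (0 : ℝ) ≤ (n - 2) / 2 := by linarith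
    rw [regKernelDeriv, abs_mul, abs_neg, abs_of_nonneg hm, abs_of_nonneg (by positivity), hk,
      regKernel, Real.rpow_sub_one hpos.ne']
    have hX : 0 ≤ (t ^ 2 + ε ^ 2) ^ (-(((n : ℝ) - 2) / 2)) := by positivity
    have : t ^ 2 * ((t ^ 2 + ε ^ 2) ^ (-(((n : ℝ) - 2) / 2)) / (t ^ 2 + ε ^ 2)) ≤
        (t ^ 2 + ε ^ 2) ^ (-(((n : ℝ) - 2) / 2)) := by
      rw [mul_div_assoc', div_le_iff₀ hpos, mul_comm]
      gcongr
      nlinarith [sq_nonneg ε]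
    calc _ = ((n : ℝ) - 2) / 2 * (t ^ 2 * ((t ^ 2 + ε ^ 2) ^ (-(((n : ℝ) - 2) / 2)) /
          (t ^ 2 + ε ^ 2))) := by ring
      _ ≤ _ := by gcongr
  have b1 := (hB (S * t ^ 2)).1
  have b2 := (hB (S * t ^ 2)).2
  set X := deriv χ (S * t ^ 2)
  set Y := deriv (deriv χ) (S * t ^ 2)
  set Z := regKernelDeriv n ε (t ^ 2)
  have e1 : |8 * t ^ 2 * S * X * Z| ≤ S * B * k * (4 * (n - 2)) := by
    rw [show 8 * t ^ 2 * S * X * Z = 8 * S * X * (t ^ 2 * Z) by ring, abs_mul, abs_mul,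
      abs_of_nonneg (by positivity : (0 : ℝ) ≤ 8 * S), abs_mul (t ^ 2), abs_of_nonneg (sq_nonneg t)]
    calc 8 * S * |X| * (t ^ 2 * |Z|) ≤ 8 * S * B * ((n - 2) / 2 * k) := by gcongr
      _ = _ := by ring
  have e2 : |4 * t ^ 2 * S ^ 2 * Y * k| ≤ S * B * k * 4 := by
    rw [show 4 * t ^ 2 * S ^ 2 * Y * k = 4 * S * k * (S * t ^ 2) * Y by ring, abs_mul,
      abs_of_nonneg (by positivity : (0 : ℝ) ≤ 4 * S * k * (S * t ^ 2))]
    calc 4 * S * k * (S * t ^ 2) * |Y| ≤ 4 * S * k * 1 * B := by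
          gcongr
          linarith
      _ = _ := by ring
  have e3 : |2 * n * S * X * k| ≤ S * B * k * (2 * n) := by
    rw [show 2 * n * S * X * k = 2 * n * S * k * X by ring, abs_mul,
      abs_of_nonneg (by positivity : (0 : ℝ) ≤ 2 * n * S * k)]
    calc 2 * n * S * k * |X| ≤ 2 * n * S * k * B := by gcongr
      _ = _ := by ring
  have e4 : S * s ^ (-((n : ℝ) - 2)) = s ^ (-(n : ℝ)) := by
    rw [hS, ← Real.rpow_natCast s 2, ← Real.rpow_neg hs.le, ← Real.rpow_add hs]
    congr 1
    push_cast
    ring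
  calc _ ≤ |8 * t ^ 2 * S * X * Z| + |4 * t ^ 2 * S ^ 2 * Y * k| + |2 * n * S * X * k| :=
        abs_add_three _ _ _
    _ ≤ S * B * k * (4 * (n - 2) + 4 + 2 * n) := by linarith
    _ ≤ S * B * (2 ^ ((n : ℝ) - 2) * s ^ (-((n : ℝ) - 2))) * (4 * (n - 2) + 4 + 2 * n) := by
        have : 0 ≤ 4 * ((n : ℝ) - 2) + 4 + 2 * n := by linarith
        gcongr
    _ = _ := by
        rw [← e4]; ring

theorem continuousAt_lap {u : Euc n → ℝ} {x : Euc n} (hu : ContDiffAt ℝ 2 u x) :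
    ContinuousAt (lap u) x := by
  unfold lap
  refine tendsto_finsetSum _ fun i _ => ?_
  have := hu.continuousAt_iteratedFDeriv (k := 2) le_rfl
  exact ((ContinuousMultilinearMap.apply ℝ (fun _ : Fin 2 => Euc n) ℝ
    ![EuclideanSpace.single i 1, EuclideanSpace.single i 1]).continuous.continuousAt.comp this)

theorem ae_ne_point (hn : 0 < n) (z : Euc n) : ∀ᵐ y : Euc n, y ≠ z := by
  have : Nontrivial (Euc n) := by
    have : Nonempty (Fin n) := ⟨⟨0, hn⟩⟩
    infer_instance
  simp [ae_iff]

theorem exists_local_representation (hn : 3 ≤ n) :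
    ∃ C : ℝ, 0 ≤ C ∧ ∀ (w : Euc n → ℝ) (z : Euc n) (s : ℝ), 0 < s →
      (∀ y ∈ ball z s, ContDiffAt ℝ 2 w y) → (∀ y ∈ ball z s, 0 ≤ w y) →
      (∀ y ∈ ball z s, 0 ≤ -lap w y) →
      ENNReal.ofReal (w z) ≤
        ENNReal.ofReal C * (∫⁻ y in ball z s, ENNReal.ofReal (‖y - z‖ ^ (-((n : ℝ) - 2)) * -lap w y)) +
        ENNReal.ofReal (C * s ^ (-(n : ℝ))) * ∫⁻ y in ball z s, ENNReal.ofReal (w y) := by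
  have hn' : (3 : ℝ) ≤ n := by exact_mod_cast hn
  obtain ⟨χ, hχ, χ1, χ0, χnn, χle, hd, B, hB⟩ := exists_cutoff
  have hB0 : 0 ≤ B := (abs_nonneg _).trans (hB 0).1
  set C1 : ℝ := B * 2 ^ ((n : ℝ) - 2) * (4 * (n - 2) + 4 + 2 * n) with hC1
  have hC10 : 0 ≤ C1 := by
    have : 0 ≤ 4 * ((n : ℝ) - 2) + 4 + 2 * n := by linarith
    positivity
  have hN := newtonConst_pos hn
  set N := newtonConst n with hNdef
  refine ⟨N⁻¹ * (1 + C1), by positivity, fun w z s hs hw hw0 hf0 => ?_⟩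
  set S := (s ^ 2)⁻¹ with hS
  have hS0 : 0 < S := by positivity
  have hmem : ∀ y : Euc n, S * ‖y - z‖ ^ 2 < 1 → y ∈ ball z s := by
    intro y hy
    rw [hS, inv_mul_lt_iff₀ (by positivity), mul_one] at hy
    rw [mem_ball, dist_eq_norm]
    exact lt_of_pow_lt_pow_left₀ 2 hs.le hy
  have hcl : IsClosed {y : Euc n | S * ‖y - z‖ ^ 2 ≤ 3 / 4} :=
    isClosed_le (by fun_prop) continuous_const
  have hcpt : IsCompact {y : Euc n | S * ‖y - z‖ ^ 2 ≤ 3 / 4} := by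
    refine (isCompact_closedBall z s).of_isClosed_subset hcl fun y hy => ?_
    exact ball_subset_closedBall (hmem y (lt_of_le_of_lt hy (by norm_num)))
  have hχy : ContDiff ℝ 2 fun y : Euc n => χ (S * ‖y - z‖ ^ 2) :=
    hχ.comp (contDiff_const.mul ((contDiff_id.sub contDiff_const).norm_sq ℝ))
  -- the cut-off function
  set g : Euc n → ℝ := fun y => w y * χ (S * ‖y - z‖ ^ 2) with hg
  have hgi : Integrable g := by
    refine integrable_of_continuousAt_of_compact hcpt (fun y hy => ?_) fun y hy => ?_
    · exact (hw y (hmem y (lt_of_le_of_lt hy (by norm_num)))).continuousAt.mul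
        hχy.continuous.continuousAt
    · simp only [mem_ofPred_eq, not_le] at hy
      simp [hg, χ0 _ hy.le]
  have hgz : g z = w z := by simp [hg, χ1 0 (by norm_num)]
  have hgc : ContinuousAt g z :=
    (hw z (mem_ball_self hs)).continuousAt.mul hχy.continuous.continuousAt
  have hlim := tendsto_integral_mul_regularised hgi hgc
  rw [hgz] at hlim
  have hmain : ∀ ε : ℝ, 0 < ε →
      ENNReal.ofReal (∫ y, g y *
        (n * (n - 2) * ε ^ 2 * (‖y - z‖ ^ 2 + ε ^ 2) ^ (-((n : ℝ) + 2) / 2))) ≤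
      (∫⁻ y in ball z s, ENNReal.ofReal (‖y - z‖ ^ (-((n : ℝ) - 2)) * -lap w y)) +
        ENNReal.ofReal (C1 * s ^ (-(n : ℝ))) * ∫⁻ y in ball z s, ENNReal.ofReal (w y) := by
    intro ε hε
    set ψ : Euc n → ℝ := fun y => χ (S * ‖y - z‖ ^ 2) * regKernel n ε (‖y - z‖ ^ 2) with hψ
    have hψ2 : ContDiff ℝ 2 ψ := hχy.mul (contDiff_regKernel hε z)
    have hts : tsupport ψ ⊆ {y : Euc n | S * ‖y - z‖ ^ 2 ≤ 3 / 4} := by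
      refine closure_minimal (fun y hy => ?_) hcl
      by_contra h
      simp only [mem_ofPred_eq, not_le] at h
      exact hy (by simp [hψ, χ0 _ h.le])
    have hψc : HasCompactSupport ψ := hcpt.of_isClosed_subset (isClosed_tsupport _) hts
    have hwψ : ∀ y ∈ tsupport ψ, ContDiffAt ℝ 2 w y := fun y hy =>
      hw y (hmem y (lt_of_le_of_lt (hts hy) (by norm_num)))
    have hgreen := green hψ2 hwψ (Or.inl hψc)
    set E : Euc n → ℝ := fun y =>
      8 * ‖y - z‖ ^ 2 * S * deriv χ (S * ‖y - z‖ ^ 2) * regKernelDeriv n ε (‖y - z‖ ^ 2) +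
        4 * ‖y - z‖ ^ 2 * S ^ 2 * deriv (deriv χ) (S * ‖y - z‖ ^ 2) * regKernel n ε (‖y - z‖ ^ 2) +
        2 * n * S * deriv χ (S * ‖y - z‖ ^ 2) * regKernel n ε (‖y - z‖ ^ 2) with hE
    set D : Euc n → ℝ := fun y =>
      n * (n - 2) * ε ^ 2 * (‖y - z‖ ^ 2 + ε ^ 2) ^ (-((n : ℝ) + 2) / 2) with hD
    have hlap : ∀ y, lap ψ y = -(χ (S * ‖y - z‖ ^ 2) * D y) + E y := by
      intro y
      have hpos : 0 < ‖y - z‖ ^ 2 + ε ^ 2 := by positivity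
      have hev : ∀ᶠ t in 𝓝 (‖y - z‖ ^ 2), 0 < t + ε ^ 2 :=
        (continuous_id.add continuous_const).continuousAt.eventually (lt_mem_nhds hpos)
      rw [hψ, lap_cutoff_mul_radial hχ (hev.mono fun t ht => hasDerivAt_regKernel ht)
        (hasDerivAt_regKernelDeriv hpos), regKernel_radial_lap hpos, mul_neg]
    have i1 : Integrable fun y => ψ y * lap w y := by
      refine integrable_of_continuousAt_of_compact hψc (fun y hy => ?_) fun y hy => ?_
      · exact hψ2.continuous.continuousAt.mul (continuousAt_lap (hwψ y hy))
      · rw [image_eq_zero_of_notMem_tsupport hy, zero_mul]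
    have i2 : Integrable fun y => w y * lap ψ y := by
      refine integrable_of_continuousAt_of_compact hψc (fun y hy => ?_) fun y hy => ?_
      · exact (hwψ y hy).continuousAt.mul (continuousAt_lap hψ2.contDiffAt)
      · rw [lap_eq_zero_of_notMem_tsupport hy, mul_zero]
    have hgD : Integrable fun y => g y * D y := by
      have hDc : Continuous D := by
        refine continuous_const.mul (Continuous.rpow_const (by fun_prop) fun y => Or.inl ?_)
        positivity
      refine integrable_of_continuousAt_of_compact hcpt (fun y hy => ?_) fun y hy => ?_
      · exact ((hw y (hmem y (lt_of_le_of_lt hy (by norm_num)))).continuousAt.mul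
          hχy.continuous.continuousAt).mul hDc.continuousAt
      · simp only [mem_ofPred_eq, not_le] at hy
        simp [hg, χ0 _ hy.le]
    have hid : ∫ y, g y * D y = ∫ y, (-(ψ y * lap w y) + w y * E y) := by
      have e : (fun y => -(ψ y * lap w y) + w y * E y) =
          fun y => -(ψ y * lap w y) + (w y * lap ψ y + g y * D y) := by
        ext y
        rw [hlap, hg]; ring
      have e1 : ∫ y, (-(ψ y * lap w y) + (w y * lap ψ y + g y * D y)) =
          (∫ y, -(ψ y * lap w y)) + ∫ y, (w y * lap ψ y + g y * D y) :=
        integral_add i1.neg (i2.add hgD)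
      rw [e, e1, integral_neg, integral_add i2 hgD, hgreen]
      ring
    rw [hid]
    calc ENNReal.ofReal (∫ y, (-(ψ y * lap w y) + w y * E y))
        ≤ ‖∫ y, (-(ψ y * lap w y) + w y * E y)‖ₑ := Real.ofReal_le_enorm _
      _ ≤ ∫⁻ y, ‖-(ψ y * lap w y) + w y * E y‖ₑ := enorm_integral_le_lintegral_enorm _
      _ ≤ ∫⁻ y, (ball z s).indicator (fun y =>
            ENNReal.ofReal (‖y - z‖ ^ (-((n : ℝ) - 2)) * -lap w y) +
            ENNReal.ofReal (C1 * s ^ (-(n : ℝ))) * ENNReal.ofReal (w y)) y := by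
          refine lintegral_mono_ae ?_
          filter_upwards [ae_ne_point (by omega) z] with y hyz
          by_cases hy : y ∈ ball z s
          · rw [indicator_of_mem hy, Real.enorm_eq_ofReal_abs, ← ENNReal.ofReal_mul (by positivity),
              ← ENNReal.ofReal_add (mul_nonneg (by positivity) (hf0 y hy))
                (mul_nonneg (by positivity) (hw0 y hy))]
            refine ENNReal.ofReal_le_ofReal ((abs_add_le _ _).trans (add_le_add ?_ ?_))
            · have hr : 0 < ‖y - z‖ := norm_pos_iff.mpr (sub_ne_zero.mpr hyz)
              have k0 : 0 ≤ regKernel n ε (‖y - z‖ ^ 2) := regKernel_nonneg (by positivity)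
              rw [← mul_neg, abs_of_nonneg (mul_nonneg (mul_nonneg (χnn _) k0) (hf0 y hy))]
              refine mul_le_mul_of_nonneg_right ?_ (hf0 y hy)
              calc _ ≤ 1 * regKernel n ε (‖y - z‖ ^ 2) := by
                    gcongr
                    exact χle _
                _ ≤ _ := by
                    rw [one_mul]
                    exact regKernel_sq_le hn ε hr
            · rw [abs_mul, abs_of_nonneg (hw0 y hy), mul_comm]
              refine mul_le_mul_of_nonneg_right ?_ (hw0 y hy)
              exact abs_cutoff_error_le hn hd hB hs (norm_nonneg _)
          · have h1 : 1 ≤ S * ‖y - z‖ ^ 2 := by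
              by_contra h
              exact hy (hmem y (not_le.mp h))
            have h2 : χ (S * ‖y - z‖ ^ 2) = 0 := χ0 _ (by linarith)
            have h3 := hd (S * ‖y - z‖ ^ 2) (Or.inr (by linarith))
            simp [hψ, hE, h2, h3.1, h3.2]
      _ = _ := by
          have hwm : AEMeasurable (fun y => ENNReal.ofReal (w y)) (volume.restrict (ball z s)) := by
            have : ContinuousOn w (ball z s) := fun y hy => (hw y hy).continuousAt.continuousWithinAt
            exact (this.aemeasurable measurableSet_ball).ennreal_ofReal
          rw [lintegral_indicator measurableSet_ball, lintegral_add_right' _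
            (hwm.const_mul _), lintegral_const_mul' _ _ ENNReal.ofReal_ne_top]
  have hfin : ENNReal.ofReal (N * w z) ≤
      (∫⁻ y in ball z s, ENNReal.ofReal (‖y - z‖ ^ (-((n : ℝ) - 2)) * -lap w y)) +
        ENNReal.ofReal (C1 * s ^ (-(n : ℝ))) * ∫⁻ y in ball z s, ENNReal.ofReal (w y) := by
    refine le_of_tendsto ((ENNReal.continuous_ofReal.tendsto _).comp hlim) ?_
    filter_upwards [self_mem_nhdsWithin] with ε hε
    exact hmain ε hε
  calc ENNReal.ofReal (w z) = ENNReal.ofReal N⁻¹ * ENNReal.ofReal (N * w z) := by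
        rw [← ENNReal.ofReal_mul (by positivity), inv_mul_cancel_left₀ hN.ne']
    _ ≤ ENNReal.ofReal N⁻¹ * ((∫⁻ y in ball z s,
          ENNReal.ofReal (‖y - z‖ ^ (-((n : ℝ) - 2)) * -lap w y)) +
        ENNReal.ofReal (C1 * s ^ (-(n : ℝ))) * ∫⁻ y in ball z s, ENNReal.ofReal (w y)) := by gcongr
    _ ≤ _ := by
        rw [mul_add, ← mul_assoc, ← ENNReal.ofReal_mul (by positivity), ← mul_assoc]
        have hi : 0 ≤ N⁻¹ := by positivity
        gcongr
        · nlinarith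
        · linarith

theorem exists_local_mean_value (hn : 3 ≤ n) :
    ∃ C : ℝ, 0 ≤ C ∧ ∀ (w : Euc n → ℝ) (z : Euc n) (s G : ℝ), 0 < s → 0 ≤ G →
      (∀ y ∈ ball z s, ContDiffAt ℝ 2 w y) → (∀ y ∈ ball z s, 0 ≤ w y) →
      (∀ y ∈ ball z s, 0 ≤ -lap w y) → (∀ y ∈ ball z s, -lap w y ≤ G) →
      ENNReal.ofReal (w z) ≤ ENNReal.ofReal (C * s ^ 2 * G) +
        ENNReal.ofReal (C * s ^ (-(n : ℝ))) * ∫⁻ y in ball z s, ENNReal.ofReal (w y) := by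
  obtain ⟨C, hC, H⟩ := exists_local_representation hn
  obtain ⟨K, hK, HK⟩ := exists_setLIntegral_ball_rpow_le (n := n) (by omega) (a := (n : ℝ) - 2)
    (by linarith)
  refine ⟨C * (1 + K), by positivity, fun w z s G hs hG hw hw0 hf0 hfG => ?_⟩
  refine (H w z s hs hw hw0 hf0).trans (add_le_add ?_ ?_)
  · calc _ ≤ ENNReal.ofReal C * ∫⁻ y in ball z s,
          ENNReal.ofReal (‖y - z‖ ^ (-((n : ℝ) - 2))) * ENNReal.ofReal G := by
          refine mul_le_mul' le_rfl (setLIntegral_mono' measurableSet_ball fun y hy => ?_)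
          rw [← ENNReal.ofReal_mul (by positivity)]
          refine ENNReal.ofReal_le_ofReal ?_
          gcongr
          exact hfG y hy
      _ ≤ ENNReal.ofReal C * (ENNReal.ofReal (K * s ^ ((n : ℝ) - ((n : ℝ) - 2))) *
            ENNReal.ofReal G) := by
          rw [lintegral_mul_const' _ _ ENNReal.ofReal_ne_top]
          gcongr
          exact HK z s hs
      _ ≤ _ := by
          rw [← ENNReal.ofReal_mul (by positivity), ← ENNReal.ofReal_mul hC]
          refine ENNReal.ofReal_le_ofReal ?_
          rw [sub_sub_cancel, show (2 : ℝ) = (2 : ℕ) by norm_num, Real.rpow_natCast]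
          have : 0 ≤ C * s ^ 2 * G := by positivity
          nlinarith
  · gcongr
    nlinarith

end Representation

section SingularTest
variable {n : ℕ}

theorem hasDerivAt_max_zero_pow (k : ℕ) (t : ℝ) :
    HasDerivAt (fun t : ℝ => max t 0 ^ (k + 2)) ((k + 2) * max t 0 ^ (k + 1)) t := by
  rcases lt_trichotomy t 0 with h | h | h
  · have : (fun t : ℝ => max t 0 ^ (k + 2)) =ᶠ[𝓝 t] fun _ => 0 := by
      filter_upwards [gt_mem_nhds h] with x hx
      simp [max_eq_right (le_of_lt hx)]
    rw [max_eq_right h.le]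
    simpa using (hasDerivAt_const t (0 : ℝ)).congr_of_eventuallyEq this
  · subst h
    rw [hasDerivAt_iff_isLittleO]
    have h2 : (fun x : ℝ => x ^ (k + 2)) =o[𝓝 0] fun x => x := by
      exact Asymptotics.isLittleO_pow_id (by omega)
    refine IsBigO.trans_isLittleO (IsBigO.of_bound 1 (Eventually.of_forall fun x => ?_))
      (by simpa using h2)
    have h3 : |max x 0| ≤ |x| := by
      rcases le_total x 0 with hx | hx
      · simp [max_eq_right hx]
      · simp [max_eq_left hx]
    simp only [max_self, ne_eq, Nat.add_eq_zero_iff, OfNat.ofNat_ne_zero, and_false,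
      not_false_eq_true, zero_pow, sub_zero, one_ne_zero, mul_zero, smul_zero, norm_pow,
      Real.norm_eq_abs, one_mul]
    gcongr
  · have : (fun t : ℝ => max t 0 ^ (k + 2)) =ᶠ[𝓝 t] fun t => t ^ (k + 2) := by
      filter_upwards [lt_mem_nhds h] with x hx
      simp [max_eq_left (le_of_lt hx)]
    rw [max_eq_left h.le]
    refine ((hasDerivAt_pow (k + 2) t).congr_of_eventuallyEq this).congr_deriv ?_
    push_cast
    simp

theorem contDiff_max_zero_pow_three : ContDiff ℝ 2 fun t : ℝ => max t 0 ^ 3 := by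
  have e1 : deriv (fun t : ℝ => max t 0 ^ 3) = fun t => 3 * max t 0 ^ 2 := by
    ext t
    rw [(hasDerivAt_max_zero_pow 1 t).deriv]
    norm_num
  have h2 : ContDiff ℝ 1 fun t : ℝ => max t 0 ^ 2 := by
    rw [contDiff_one_iff_deriv]
    refine ⟨fun t => (hasDerivAt_max_zero_pow 0 t).differentiableAt, ?_⟩
    have : deriv (fun t : ℝ => max t 0 ^ 2) = fun t => 2 * max t 0 := by
      ext t
      rw [(hasDerivAt_max_zero_pow 0 t).deriv]
      norm_num
    rw [this]
    fun_prop
  rw [show (2 : WithTop ℕ∞) = 1 + 1 by norm_num, contDiff_succ_iff_deriv]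
  refine ⟨fun t => (hasDerivAt_max_zero_pow 1 t).differentiableAt, by simp, ?_⟩
  rw [e1]
  exact contDiff_const.mul h2

/-- A normalised regularised kernel which equals `1` at distance `r`. -/
noncomputable def barrier (n : ℕ) (r ρ : ℝ) : ℝ :=
  1 - (2 * r ^ 2) ^ (((n : ℝ) - 2) / 2) * regKernel n r ρ

theorem barrier_nonpos (hn : 3 ≤ n) {r ρ : ℝ} (hr : 0 < r) (hρ : 0 ≤ ρ) (h : ρ ≤ r ^ 2) :
    barrier n r ρ ≤ 0 := by
  have hn' : (3 : ℝ) ≤ n := by exact_mod_cast hn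
  have hpos : 0 < ρ + r ^ 2 := by positivity
  rw [barrier, regKernel, sub_nonpos, Real.rpow_neg hpos.le, ← div_eq_mul_inv,
    one_le_div (by positivity)]
  refine Real.rpow_le_rpow hpos.le (by linarith) (by linarith)

theorem scaled_regKernel_le (hn : 3 ≤ n) {r ρ M : ℝ} (hr : 0 < r) (hM : 0 < M)
    (h : M * r ^ 2 ≤ ρ + r ^ 2) :
    (2 * r ^ 2) ^ (((n : ℝ) - 2) / 2) * regKernel n r ρ ≤ (2 / M) ^ (((n : ℝ) - 2) / 2) := by
  have hn' : (3 : ℝ) ≤ n := by exact_mod_cast hn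
  have hMr : 0 < M * r ^ 2 := by positivity
  have hpos : 0 < ρ + r ^ 2 := by linarith
  rw [regKernel, Real.rpow_neg hpos.le, ← div_eq_mul_inv, ← Real.div_rpow (by positivity) hpos.le]
  refine Real.rpow_le_rpow (by positivity) ?_ (by linarith)
  rw [div_le_div_iff₀ hpos hM]
  nlinarith

theorem le_scaled_regKernel (hn : 3 ≤ n) {r ρ M : ℝ} (hr : 0 < r) (hρ : 0 ≤ ρ) (hM : 0 < M)
    (h : ρ + r ^ 2 ≤ M * r ^ 2) :
    (2 / M) ^ (((n : ℝ) - 2) / 2) ≤ (2 * r ^ 2) ^ (((n : ℝ) - 2) / 2) * regKernel n r ρ := by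
  have hn' : (3 : ℝ) ≤ n := by exact_mod_cast hn
  have hpos : 0 < ρ + r ^ 2 := by positivity
  rw [regKernel, Real.rpow_neg hpos.le, ← div_eq_mul_inv, ← Real.div_rpow (by positivity) hpos.le]
  refine Real.rpow_le_rpow (by positivity) ?_ (by linarith)
  rw [div_le_div_iff₀ hM hpos]
  nlinarith

theorem regKernelDeriv_eq {ε ρ : ℝ} (h : 0 < ρ + ε ^ 2) :
    regKernelDeriv n ε ρ = -(((n : ℝ) - 2) / 2) * (regKernel n ε ρ / (ρ + ε ^ 2)) := by
  rw [regKernelDeriv, regKernel, Real.rpow_sub_one h.ne']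

/-- The derivative of the cube of the positive part of `barrier`. -/
noncomputable def barrierCubeDeriv (n : ℕ) (r ρ : ℝ) : ℝ :=
  3 * max (barrier n r ρ) 0 ^ 2 * -((2 * r ^ 2) ^ (((n : ℝ) - 2) / 2) * regKernelDeriv n r ρ)

theorem hasDerivAt_barrier {r ρ : ℝ} (h : 0 < ρ + r ^ 2) :
    HasDerivAt (barrier n r)
      (-((2 * r ^ 2) ^ (((n : ℝ) - 2) / 2) * regKernelDeriv n r ρ)) ρ :=
  ((hasDerivAt_regKernel h).const_mul _).const_sub 1

theorem hasDerivAt_barrier_cube {r ρ : ℝ} (h : 0 < ρ + r ^ 2) :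
    HasDerivAt (fun ρ => max (barrier n r ρ) 0 ^ 3) (barrierCubeDeriv n r ρ) ρ := by
  have := (hasDerivAt_max_zero_pow 1 (barrier n r ρ)).comp ρ (hasDerivAt_barrier h)
  refine (show HasDerivAt (fun ρ => max (barrier n r ρ) 0 ^ 3) _ ρ from this).congr_deriv ?_
  norm_num [barrierCubeDeriv]

theorem exists_hasDerivAt_barrierCubeDeriv (hn : 3 ≤ n) {r ρ : ℝ} (hr : 0 < r) (hρ : 0 ≤ ρ) :
    ∃ d, HasDerivAt (barrierCubeDeriv n r) d ρ ∧
      24 * ρ * max (barrier n r ρ) 0 *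
        ((2 * r ^ 2) ^ (((n : ℝ) - 2) / 2) * regKernelDeriv n r ρ) ^ 2 ≤
      4 * ρ * d + 2 * n * barrierCubeDeriv n r ρ := by
  have hn' : (3 : ℝ) ≤ n := by exact_mod_cast hn
  have h : 0 < ρ + r ^ 2 := by positivity
  have h1 := (hasDerivAt_max_zero_pow 0 (barrier n r ρ)).comp ρ (hasDerivAt_barrier h)
  have h2 := ((hasDerivAt_regKernelDeriv (n := n) h).const_mul
    ((2 * r ^ 2) ^ (((n : ℝ) - 2) / 2))).neg
  refine ⟨_, (h1.const_mul 3).mul h2, ?_⟩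
  have h3 := regKernel_radial_lap (n := n) h
  simp only [Function.comp_apply, barrierCubeDeriv]
  set M := max (barrier n r ρ) 0
  set a := (2 * r ^ 2) ^ (((n : ℝ) - 2) / 2)
  set k1 := regKernelDeriv n r ρ
  have ha : 0 ≤ a := by positivity
  set X := (ρ + r ^ 2) ^ (-((n : ℝ) + 2) / 2)
  have hX : 0 ≤ X := by positivity
  have hX2 : 0 ≤ 3 * M ^ 2 * a * (n * (n - 2) * r ^ 2 * X) := by
    have : (0 : ℝ) ≤ n - 2 := by linarith
    positivity
  have e : 4 * ρ * (6 * M * (a * k1) ^ 2 + 3 * M ^ 2 *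
        -(a * (((n : ℝ) - 2) / 2 * (n / 2) * X))) + 2 * n * (3 * M ^ 2 * -(a * k1)) =
      24 * ρ * M * (a * k1) ^ 2 -
        3 * M ^ 2 * a * (4 * ρ * (((n : ℝ) - 2) / 2 * (n / 2) * X) + 2 * n * k1) := by ring
  rw [h3] at e
  norm_num at *
  linarith

end SingularTest

section AnnulusBounds
variable {n : ℕ}

theorem isClosed_annulus (a b : ℝ) : IsClosed {y : Euc n | a ≤ ‖y‖ ^ 2 ∧ ‖y‖ ^ 2 ≤ b} :=
  isClosed_Icc.preimage (continuous_norm.pow 2)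

theorem measurableSet_annulus (a b : ℝ) : MeasurableSet {y : Euc n | a < ‖y‖ ∧ ‖y‖ < b} :=
  measurable_norm measurableSet_Ioo

theorem abs_barrier_cutoff_error_le (hn : 3 ≤ n) {χ : ℝ → ℝ} {B r ρ : ℝ}
    (hB : ∀ t, |deriv χ t| ≤ B ∧ |deriv (deriv χ) t| ≤ B) (hr : 0 < r) (hr12 : r < 1 / 12)
    (hy1 : 1 / 4 ≤ ρ) (hy2 : ρ ≤ 3 / 4) :
    |8 * ρ * deriv χ ρ * barrierCubeDeriv n r ρ +
        4 * ρ * deriv (deriv χ) ρ * max (barrier n r ρ) 0 ^ 3 +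
        2 * n * deriv χ ρ * max (barrier n r ρ) 0 ^ 3| ≤
      72 * (((n : ℝ) - 2) / 2) * B + 3 * B + 2 * n * B := by
  have hn' : (3 : ℝ) ≤ n := by exact_mod_cast hn
  have hB0 : 0 ≤ B := (abs_nonneg _).trans (hB 0).1
  have hm0 : 0 < ((n : ℝ) - 2) / 2 := by linarith
  have hρ : 0 ≤ ρ := by linarith
  have hpos : 0 < ρ + r ^ 2 := by positivity
  have ha0 : 0 ≤ (2 * r ^ 2) ^ (((n : ℝ) - 2) / 2) := by positivity
  have ak := scaled_regKernel_le hn hr (M := 2) (ρ := ρ) (by norm_num) (by nlinarith)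
  rw [div_self two_ne_zero, Real.one_rpow] at ak
  have k0 := regKernel_nonneg (n := n) (ε := r) hρ
  have hk1 : |(2 * r ^ 2) ^ (((n : ℝ) - 2) / 2) * regKernelDeriv n r ρ| ≤
      4 * (((n : ℝ) - 2) / 2) := by
    rw [regKernelDeriv_eq hpos]
    set m := ((n : ℝ) - 2) / 2
    set a := (2 * r ^ 2) ^ m
    have ak0 : 0 ≤ a * regKernel n r ρ := mul_nonneg ha0 k0
    rw [show a * (-m * (regKernel n r ρ / (ρ + r ^ 2))) =
      -(m * (a * regKernel n r ρ) / (ρ + r ^ 2)) by ring, abs_neg, abs_of_nonneg (by positivity),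
      div_le_iff₀ hpos]
    nlinarith [sq_nonneg r]
  have T0 : 0 ≤ max (barrier n r ρ) 0 := le_max_right _ _
  have T1 : max (barrier n r ρ) 0 ≤ 1 := by
    refine max_le ?_ zero_le_one
    have ak0 := mul_nonneg ha0 k0
    rw [barrier]
    linarith
  have hH1 : |barrierCubeDeriv n r ρ| ≤ 12 * (((n : ℝ) - 2) / 2) := by
    rw [barrierCubeDeriv, abs_mul, abs_neg, abs_of_nonneg (by positivity)]
    calc _ ≤ 3 * (1 : ℝ) ^ 2 * (4 * (((n : ℝ) - 2) / 2)) := by gcongr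
      _ = _ := by ring
  have b1 := (hB ρ).1
  have b2 := (hB ρ).2
  have Hle : max (barrier n r ρ) 0 ^ 3 ≤ 1 := pow_le_one₀ T0 T1
  have H0 : 0 ≤ max (barrier n r ρ) 0 ^ 3 := by positivity
  generalize max (barrier n r ρ) 0 ^ 3 = H at Hle H0
  refine (abs_add_three _ _ _).trans ?_
  have f1 : |8 * ρ * deriv χ ρ * barrierCubeDeriv n r ρ| ≤ 72 * (((n : ℝ) - 2) / 2) * B := by
    rw [abs_mul, abs_mul, abs_of_nonneg (by positivity : 0 ≤ 8 * ρ)]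
    calc _ ≤ 8 * (3 / 4) * B * (12 * (((n : ℝ) - 2) / 2)) := by gcongr
      _ = _ := by ring
  have f2 : |4 * ρ * deriv (deriv χ) ρ * H| ≤ 3 * B := by
    rw [abs_mul, abs_mul, abs_of_nonneg (by positivity : 0 ≤ 4 * ρ), abs_of_nonneg H0]
    calc _ ≤ 4 * (3 / 4) * B * 1 := by gcongr
      _ = _ := by ring
  have f3 : |2 * n * deriv χ ρ * H| ≤ 2 * n * B := by
    rw [abs_mul, abs_mul, abs_of_nonneg (by positivity : (0 : ℝ) ≤ 2 * n), abs_of_nonneg H0]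
    calc _ ≤ 2 * n * B * 1 := by gcongr
      _ = _ := by ring
  linarith

set_option maxHeartbeats 1000000 in
theorem exists_annulus_bounds (hn : 3 ≤ n) {u : Euc n → ℝ} (hu : ∀ x, x ≠ 0 → ContDiffAt ℝ 2 u x)
    (hu0 : ∀ x, 0 ≤ u x) (hf : ∀ x ∈ ball (0 : Euc n) 1 \ {0}, 0 ≤ -lap u x) :
    ∃ C : ℝ, 0 ≤ C ∧ ∀ r, 0 < r → r < 1 / 12 →
      (∫⁻ y in {y : Euc n | 2 * r < ‖y‖ ∧ ‖y‖ < 1 / 2}, ENNReal.ofReal (-lap u y)) ≤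
        ENNReal.ofReal C ∧
      (∫⁻ y in {y : Euc n | 2 * r < ‖y‖ ∧ ‖y‖ < 6 * r}, ENNReal.ofReal (u y)) ≤
        ENNReal.ofReal (C * r ^ 2) := by
  have hn' : (3 : ℝ) ≤ n := by exact_mod_cast hn
  obtain ⟨χ, hχ, χ1, χ0, χnn, χle, hd, B, hB⟩ := exists_cutoff
  have hB0 : 0 ≤ B := (abs_nonneg _).trans (hB 0).1
  set m : ℝ := ((n : ℝ) - 2) / 2 with hm
  have hm0 : 0 < m := by rw [hm]; linarith
  set A : Set (Euc n) := {y | 1 / 4 ≤ ‖y‖ ^ 2 ∧ ‖y‖ ^ 2 ≤ 3 / 4} with hA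
  have hAcl : IsClosed A :=
    isClosed_annulus _ _
  have hAc : IsCompact A := by
    refine (isCompact_closedBall (0 : Euc n) 1).of_isClosed_subset hAcl fun y hy => ?_
    rw [mem_closedBall_zero_iff]
    nlinarith [hy.2, norm_nonneg y]
  have hAi : IntegrableOn u A := by
    refine ContinuousOn.integrableOn_compact hAc fun y hy => ?_
    refine (hu y ?_).continuousAt.continuousWithinAt
    rintro rfl
    have := hy.1
    norm_num at this
  set U : ℝ := ∫ y in A, u y with hU
  have hU0 : 0 ≤ U := integral_nonneg fun y => hu0 y
  set E0 : ℝ := 72 * m * B + 3 * B + 2 * n * B with hE0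
  have hE00 : 0 ≤ E0 := by positivity
  set τ : ℝ := (2 / 5) ^ m with hτ
  have hτ1 : τ < 1 := Real.rpow_lt_one (by norm_num) (by norm_num) hm0
  have hτ0 : 0 ≤ τ := by positivity
  set h0 : ℝ := (1 - τ) ^ 3 with hh0
  have hh00 : 0 < h0 := by
    have : 0 < 1 - τ := by linarith
    positivity
  set κ : ℝ := 96 * (1 - τ) * (m * (2 / 37) ^ m / 37) ^ 2 with hκ
  have hκ0 : 0 < κ := by
    have : 0 < 1 - τ := by linarith
    positivity
  refine ⟨E0 * U * (h0⁻¹ + κ⁻¹), by positivity, fun r hr hr12 => ?_⟩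
  -- the test function
  set a : ℝ := (2 * r ^ 2) ^ m with ha
  have ha0 : 0 ≤ a := by positivity
  set H : ℝ → ℝ := fun ρ => max (barrier n r ρ) 0 ^ 3 with hH
  have hH0 : ∀ ρ, 0 ≤ H ρ := fun ρ => by positivity
  set ψ : Euc n → ℝ := fun y => χ (1 * ‖y - 0‖ ^ 2) * H (‖y - 0‖ ^ 2) with hψ
  have hψ0 : ∀ y, 0 ≤ ψ y := fun y => mul_nonneg (χnn _) (hH0 _)
  have hψ2 : ContDiff ℝ 2 ψ := by
    refine (hχ.comp (contDiff_const.mul ((contDiff_id.sub contDiff_const).norm_sq ℝ))).mul ?_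
    refine contDiff_max_zero_pow_three.comp (contDiff_const.sub (contDiff_const.mul ?_))
    exact contDiff_regKernel hr 0
  set Z : Set (Euc n) := {y | r ^ 2 ≤ ‖y‖ ^ 2 ∧ ‖y‖ ^ 2 ≤ 3 / 4} with hZ
  have hZcl : IsClosed Z :=
    isClosed_annulus _ _
  have hZc : IsCompact Z := by
    refine (isCompact_closedBall (0 : Euc n) 1).of_isClosed_subset hZcl fun y hy => ?_
    rw [mem_closedBall_zero_iff]
    nlinarith [hy.2, norm_nonneg y]
  have hts : tsupport ψ ⊆ Z := by
    refine closure_minimal (fun y hy => ?_) hZcl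
    by_contra h
    rw [hZ, mem_ofPred_eq, not_and_or, not_le, not_le] at h
    refine hy ?_
    rcases h with h | h
    · have := barrier_nonpos hn hr (by positivity) h.le
      simp [hψ, hH, max_eq_right this]
    · simp [hψ, χ0 _ h.le]
  have hψc : HasCompactSupport ψ := hZc.of_isClosed_subset (isClosed_tsupport _) hts
  have hZ0 : ∀ y ∈ Z, y ≠ 0 := by
    rintro y hy rfl
    have := hy.1
    norm_num at this
    nlinarith
  have huψ : ∀ y ∈ tsupport ψ, ContDiffAt ℝ 2 u y := fun y hy => hu y (hZ0 y (hts hy))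
  have hgreen := green hψ2 huψ (Or.inl hψc)
  have i1 : Integrable fun y => ψ y * lap u y := by
    refine integrable_of_continuousAt_of_compact hψc (fun y hy => ?_) fun y hy => ?_
    · exact hψ2.continuous.continuousAt.mul (continuousAt_lap (huψ y hy))
    · rw [image_eq_zero_of_notMem_tsupport hy, zero_mul]
  have i2 : Integrable fun y => u y * lap ψ y := by
    refine integrable_of_continuousAt_of_compact hψc (fun y hy => ?_) fun y hy => ?_
    · exact (huψ y hy).continuousAt.mul (continuousAt_lap hψ2.contDiffAt)
    · rw [lap_eq_zero_of_notMem_tsupport hy, mul_zero]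
  have i3 : Integrable (A.indicator fun y => E0 * u y) :=
    (integrable_indicator_iff hAcl.measurableSet).mpr (hAi.const_mul E0)
  set Q : Euc n → ℝ := fun y => u y * lap ψ y - ψ y * lap u y + A.indicator (fun y => E0 * u y) y
    with hQ
  have hQi : Integrable Q := (i2.sub i1).add i3
  have hQint : ∫ y, Q y = E0 * U := by
    have e1 : ∫ y, Q y = (∫ y, (u y * lap ψ y - ψ y * lap u y)) +
        ∫ y, A.indicator (fun y => E0 * u y) y := integral_add (i2.sub i1) i3
    rw [e1, integral_sub i2 i1, hgreen, sub_self, zero_add, integral_indicator hAcl.measurableSet,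
      integral_const_mul]
  have hlap : ∀ y, χ (‖y‖ ^ 2) * (24 * ‖y‖ ^ 2 * max (barrier n r (‖y‖ ^ 2)) 0 *
      (a * regKernelDeriv n r (‖y‖ ^ 2)) ^ 2) ≤
      lap ψ y + A.indicator (fun _ => E0) y := by
    intro y
    obtain ⟨d, hd1, hd2⟩ := exists_hasDerivAt_barrierCubeDeriv hn hr (sq_nonneg ‖y - 0‖)
    have hpos : 0 < ‖y - 0‖ ^ 2 + r ^ 2 := by positivity
    have hev : ∀ᶠ t in 𝓝 (‖y - 0‖ ^ 2), 0 < t + r ^ 2 :=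
      (continuous_id.add continuous_const).continuousAt.eventually (lt_mem_nhds hpos)
    rw [hψ, lap_cutoff_mul_radial hχ (hev.mono fun t ht => hasDerivAt_barrier_cube ht) hd1]
    simp only [sub_zero, one_mul, mul_one, one_pow] at hd2 ⊢
    have e1 := mul_le_mul_of_nonneg_left hd2 (χnn (‖y‖ ^ 2))
    suffices |8 * ‖y‖ ^ 2 * deriv χ (‖y‖ ^ 2) * barrierCubeDeriv n r (‖y‖ ^ 2) +
        4 * ‖y‖ ^ 2 * deriv (deriv χ) (‖y‖ ^ 2) * H (‖y‖ ^ 2) +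
        2 * n * deriv χ (‖y‖ ^ 2) * H (‖y‖ ^ 2)| ≤ A.indicator (fun _ => E0) y by
      have := (abs_le.mp this).1
      linarith
    by_cases hy : y ∈ A
    · rw [indicator_of_mem hy]
      exact abs_barrier_cutoff_error_le hn hB hr hr12 hy.1 hy.2
    · rw [indicator_of_notMem hy]
      rw [hA, mem_ofPred_eq, not_and_or, not_le, not_le] at hy
      rw [(hd _ hy).1, (hd _ hy).2]
      simp
  have hP : ∀ y, ψ y * -lap u y + u y * (χ (‖y‖ ^ 2) * (24 * ‖y‖ ^ 2 *
      max (barrier n r (‖y‖ ^ 2)) 0 * (a * regKernelDeriv n r (‖y‖ ^ 2)) ^ 2)) ≤ Q y := by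
    intro y
    have h1 := mul_le_mul_of_nonneg_left (hlap y) (hu0 y)
    have h2 : A.indicator (fun y => E0 * u y) y = u y * A.indicator (fun _ => E0) y := by
      by_cases hy : y ∈ A
      · simp [hy, mul_comm]
      · simp [hy]
    rw [hQ]
    simp only [h2]
    linarith
  have hPf : ∀ y, 0 ≤ ψ y * -lap u y := by
    intro y
    by_cases hy : y ∈ Z
    · refine mul_nonneg (hψ0 y) (hf y ⟨?_, hZ0 y hy⟩)
      rw [mem_ball_zero_iff]
      nlinarith [hy.2, norm_nonneg y]
    · rw [image_eq_zero_of_notMem_tsupport fun h => hy (hts h), zero_mul]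
  have hPu : ∀ y, 0 ≤ u y * (χ (‖y‖ ^ 2) * (24 * ‖y‖ ^ 2 *
      max (barrier n r (‖y‖ ^ 2)) 0 * (a * regKernelDeriv n r (‖y‖ ^ 2)) ^ 2)) := fun y =>
    mul_nonneg (hu0 y) (mul_nonneg (χnn _) (by positivity))
  have hQl : ∫⁻ y, ENNReal.ofReal (Q y) = ENNReal.ofReal (E0 * U) := by
    rw [← hQint, ofReal_integral_eq_lintegral_ofReal hQi (Eventually.of_forall fun y => ?_)]
    exact (add_nonneg (hPf y) (hPu y)).trans (hP y)
  have hT : ∀ y : Euc n, 2 * r < ‖y‖ → 1 - τ ≤ max (barrier n r (‖y‖ ^ 2)) 0 := by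
    intro y hy
    refine le_trans ?_ (le_max_left _ _)
    have := scaled_regKernel_le hn hr (M := 5) (ρ := ‖y‖ ^ 2) (by norm_num) (by nlinarith)
    rw [barrier]
    linarith
  have hχ1 : ∀ y : Euc n, ‖y‖ < 1 / 2 → χ (‖y‖ ^ 2) = 1 := fun y hy =>
    χ1 _ (by nlinarith [norm_nonneg y])
  have key : ∀ (b : ℝ), 0 < b → ∀ (s : Set (Euc n)) (g : Euc n → ℝ), MeasurableSet s →
      (∀ y ∈ s, b * g y ≤ Q y) →
      ∫⁻ y in s, ENNReal.ofReal (g y) ≤ ENNReal.ofReal (b⁻¹ * (E0 * U)) := by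
    intro b hb s g hs hg
    calc ∫⁻ y in s, ENNReal.ofReal (g y)
        ≤ ∫⁻ y in s, ENNReal.ofReal b⁻¹ * ENNReal.ofReal (Q y) := by
          refine setLIntegral_mono' hs fun y hy => ?_
          rw [← ENNReal.ofReal_mul (by positivity)]
          refine ENNReal.ofReal_le_ofReal ?_
          rw [le_inv_mul_iff₀ hb]
          exact hg y hy
      _ ≤ ∫⁻ y, ENNReal.ofReal b⁻¹ * ENNReal.ofReal (Q y) := setLIntegral_le_lintegral _ _
      _ = _ := by
          rw [lintegral_const_mul' _ _ ENNReal.ofReal_ne_top, hQl,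
            ← ENNReal.ofReal_mul (by positivity)]
  have hEU : 0 ≤ E0 * U := by positivity
  constructor
  · refine (key h0 hh00 _ _ (measurableSet_annulus _ _) fun y hy => ?_).trans (ENNReal.ofReal_le_ofReal ?_)
    · refine le_trans ?_ ((le_add_of_nonneg_right (hPu y)).trans (hP y))
      refine mul_le_mul_of_nonneg_right ?_ (hf y ⟨?_, ?_⟩)
      · simp only [hψ, sub_zero, one_mul, hχ1 y hy.2, hH]
        exact pow_le_pow_left₀ (by linarith) (hT y hy.1) 3
      · rw [mem_ball_zero_iff]
        linarith [hy.2]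
      · exact norm_pos_iff.mp (by linarith [hy.1])
    · have : 0 ≤ κ⁻¹ := by positivity
      nlinarith
  · refine (key (κ / r ^ 2) (by positivity) _ _ (measurableSet_annulus _ _) fun y hy => ?_).trans
      (ENNReal.ofReal_le_ofReal ?_)
    · refine le_trans ?_ ((le_add_of_nonneg_left (hPf y)).trans (hP y))
      rw [mul_comm]
      refine mul_le_mul_of_nonneg_left ?_ (hu0 y)
      rw [hχ1 y (by linarith [hy.2]), one_mul]
      obtain ⟨hy1, hy2⟩ := hy
      have hρ1 : 4 * r ^ 2 ≤ ‖y‖ ^ 2 := by nlinarith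
      have hρ2 : ‖y‖ ^ 2 + r ^ 2 ≤ 37 * r ^ 2 := by nlinarith [norm_nonneg y]
      have hTy := hT y hy1
      set ρ := ‖y‖ ^ 2
      have hρ : 0 ≤ ρ := by positivity
      have hpos : 0 < ρ + r ^ 2 := by positivity
      have ak := le_scaled_regKernel hn hr hρ (M := 37) (by norm_num) hρ2
      rw [← hm, ← ha] at ak
      have hk : m * (2 / 37) ^ m / (37 * r ^ 2) ≤ |a * regKernelDeriv n r ρ| := by
        have hk0 : 0 ≤ a * regKernel n r ρ := le_trans (by positivity) ak
        rw [regKernelDeriv_eq hpos, ← hm, show a * (-m * (regKernel n r ρ / (ρ + r ^ 2))) =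
          -(m * (a * regKernel n r ρ) / (ρ + r ^ 2)) by ring, abs_neg, abs_of_nonneg (by positivity)]
        gcongr
      have hT0 : 0 ≤ 1 - τ := by linarith
      calc κ / r ^ 2 = 24 * (4 * r ^ 2) * (1 - τ) * (m * (2 / 37) ^ m / (37 * r ^ 2)) ^ 2 := by
            rw [hκ]
            field_simp
            ring
        _ ≤ 24 * ρ * max (barrier n r ρ) 0 * |a * regKernelDeriv n r ρ| ^ 2 := by gcongr
        _ = _ := by rw [sq_abs]
    · rw [inv_div, div_eq_mul_inv]
      have : 0 ≤ h0⁻¹ := by positivity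
      have h5 : 0 ≤ E0 * U * r ^ 2 := by positivity
      nlinarith

end AnnulusBounds

section Riesz
variable {n : ℕ}

theorem rpow_lintegral_mul_le {X : Type*} [MeasurableSpace X] {μ : Measure X} {k F : X → ENNReal}
    (hk : Measurable k) (hF : Measurable F) {q : ℝ} (hq : 1 < q) :
    (∫⁻ y, k y * F y ∂μ) ^ q ≤ (∫⁻ y, F y ∂μ) ^ (q - 1) * ∫⁻ y, k y ^ q * F y ∂μ := by
  have hq0 : 0 < q := by linarith
  have hc := Real.HolderConjugate.conjExponent hq
  set q' := q.conjExponent with hq'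
  have hq'0 : 0 < q' := hc.symm.pos
  have h := ENNReal.lintegral_mul_le_Lp_mul_Lq μ hc (f := fun y => k y * F y ^ q⁻¹)
    (g := fun y => F y ^ q'⁻¹) (hk.mul (hF.pow_const _)).aemeasurable (hF.pow_const _).aemeasurable
  have e1 : ∀ y, F y ^ q⁻¹ * F y ^ q'⁻¹ = F y := fun y => by
    rw [← ENNReal.rpow_add_of_nonneg _ _ (by positivity) (by positivity), hc.inv_add_inv_eq_one,
      ENNReal.rpow_one]
  have e2 : (∫⁻ y, k y * F y ∂μ) = ∫⁻ y, ((fun y => k y * F y ^ q⁻¹) * fun y => F y ^ q'⁻¹) y ∂μ := by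
    refine lintegral_congr fun y => ?_
    rw [Pi.mul_apply, mul_assoc, e1]
  have e3 : (q - 1) = q / q' := by
    rw [hq', Real.conjExponent]
    field_simp
  calc (∫⁻ y, k y * F y ∂μ) ^ q ≤ ((∫⁻ y, (k y * F y ^ q⁻¹) ^ q ∂μ) ^ (1 / q) *
        (∫⁻ y, (F y ^ q'⁻¹) ^ q' ∂μ) ^ (1 / q')) ^ q := by
        rw [e2]
        gcongr
    _ = (∫⁻ y, F y ∂μ) ^ (q - 1) * ∫⁻ y, k y ^ q * F y ∂μ := by
        rw [ENNReal.mul_rpow_of_nonneg _ _ hq0.le, ← ENNReal.rpow_mul, ← ENNReal.rpow_mul, mul_comm,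
          one_div_mul_cancel hq0.ne', ENNReal.rpow_one, e3]
        congr 1
        · simp_rw [← ENNReal.rpow_mul, inv_mul_cancel₀ hq'0.ne', ENNReal.rpow_one]
          congr 1
          ring
        · simp_rw [ENNReal.mul_rpow_of_nonneg _ _ hq0.le, ← ENNReal.rpow_mul,
            inv_mul_cancel₀ hq0.ne', ENNReal.rpow_one]

theorem exists_lintegral_truncated_riesz_le (hn : 0 < n) {b : ℝ} (hb : b < n) :
    ∃ C : ℝ, 0 ≤ C ∧ ∀ F : Euc n → ENNReal, Measurable F →
      ∫⁻ z, ENNReal.ofReal (‖z‖ ^ (-(n - b))) *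
        ∫⁻ y in ball z (‖z‖ / 2), ENNReal.ofReal (‖y - z‖ ^ (-b)) * F y ≤
      ENNReal.ofReal C * ∫⁻ y, F y := by
  obtain ⟨K, hK, HK⟩ := exists_setLIntegral_ball_rpow_le hn hb
  refine ⟨(2 / 3) ^ (-(n - b)) * K, by positivity, fun F hF => ?_⟩
  set S : Set (Euc n × Euc n) := {p | dist p.2 p.1 < ‖p.1‖ / 2} with hS
  have hSm : MeasurableSet S :=
    measurableSet_lt (by fun_prop) (by fun_prop)
  set Φ : Euc n → Euc n → ENNReal := fun z y => S.indicator (fun p =>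
    ENNReal.ofReal (‖p.1‖ ^ (-(n - b))) * (ENNReal.ofReal (‖p.2 - p.1‖ ^ (-b)) * F p.2)) (z, y)
    with hΦ
  have hΦm : Measurable (Function.uncurry Φ) := by
    refine Measurable.indicator ?_ hSm
    fun_prop
  calc _ = ∫⁻ z, ∫⁻ y, Φ z y := by
        refine lintegral_congr fun z => ?_
        rw [← lintegral_indicator measurableSet_ball, ← lintegral_const_mul' _ _ ENNReal.ofReal_ne_top]
        refine lintegral_congr fun y => ?_
        by_cases h : (z, y) ∈ S
        · have h' : y ∈ ball z (‖z‖ / 2) := h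
          simp [hΦ, h, h']
        · have h' : y ∉ ball z (‖z‖ / 2) := h
          simp [hΦ, h, h']
    _ = ∫⁻ y, ∫⁻ z, Φ z y := lintegral_lintegral_swap hΦm.aemeasurable
    _ ≤ ∫⁻ y, ENNReal.ofReal ((2 / 3) ^ (-(n - b)) * K) * F y := by
        refine lintegral_mono fun y => ?_
        rcases eq_or_ne y 0 with rfl | hy
        · have : ∀ z, Φ z 0 = 0 := by
            intro z
            refine indicator_of_notMem (fun h => ?_) _
            have h1 : dist 0 z < ‖z‖ / 2 := h
            rw [dist_zero_left] at h1
            linarith [norm_nonneg z]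
          simp [this]
        have hy0 : 0 < ‖y‖ := norm_pos_iff.mpr hy
        calc ∫⁻ z, Φ z y ≤ ∫⁻ z, (ball y ‖y‖).indicator (fun z =>
              ENNReal.ofReal ((2 / 3 * ‖y‖) ^ (-(n - b))) * F y *
                ENNReal.ofReal (‖z - y‖ ^ (-b))) z := by
              refine lintegral_mono fun z => ?_
              by_cases h : (z, y) ∈ S
              · have h1 : dist y z < ‖z‖ / 2 := h
                rw [dist_eq_norm] at h1
                have h2 := norm_le_norm_sub_add_norm y z
                have h3 := norm_le_norm_sub_add_norm z y
                rw [norm_sub_rev] at h3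
                have h4 : z ∈ ball y ‖y‖ := by
                  rw [mem_ball, dist_eq_norm, norm_sub_rev]
                  linarith
                rw [indicator_of_mem h4]
                simp only [hΦ, indicator_of_mem h]
                rw [norm_sub_rev z y, mul_assoc]
                refine mul_le_mul' (ENNReal.ofReal_le_ofReal ?_) (mul_comm _ _).le
                exact Real.rpow_le_rpow_of_nonpos (by positivity) (by linarith) (by linarith)
              · simp [hΦ, h]
          _ = ENNReal.ofReal ((2 / 3 * ‖y‖) ^ (-(n - b))) * F y *
                ∫⁻ z in ball y ‖y‖, ENNReal.ofReal (‖z - y‖ ^ (-b)) := by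
              rw [lintegral_indicator measurableSet_ball, lintegral_const_mul]
              fun_prop
          _ ≤ ENNReal.ofReal ((2 / 3 * ‖y‖) ^ (-(n - b))) * F y *
                ENNReal.ofReal (K * ‖y‖ ^ (n - b)) := by
              gcongr
              exact HK y _ hy0
          _ = _ := by
              rw [mul_right_comm, ← ENNReal.ofReal_mul (by positivity),
                Real.mul_rpow (by norm_num) hy0.le, Real.rpow_neg hy0.le]
              congr 2
              have : ‖y‖ ^ ((n : ℝ) - b) ≠ 0 := by positivity
              field_simp
    _ = _ := lintegral_const_mul _ hF

end Riesz

/-- Nonnegative `C²` functions on the punctured space, superharmonic in `B₂(0) \ {0}`. -/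
structure PosSuperharmonic {n : ℕ} (u : Euc n → ℝ) : Prop where
  nonneg : ∀ x, 0 ≤ u x
  contDiffAt : ∀ x, x ≠ 0 → ContDiffAt ℝ 2 u x
  neg_lap_nonneg : ∀ x ∈ ball (0 : Euc n) 2 \ {0}, 0 ≤ -lap u x

section Super
variable {n : ℕ} {u : Euc n → ℝ}

theorem notMem_ball_half {x y : Euc n} (hy : y ∈ ball x (‖x‖ / 2)) :
    ‖x‖ / 2 < ‖y‖ ∧ ‖y‖ < 3 / 2 * ‖x‖ := by
  rw [mem_ball, dist_eq_norm] at hy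
  have h1 := norm_le_norm_sub_add_norm y x
  have h2 := norm_le_norm_sub_add_norm x y
  rw [norm_sub_rev] at h2
  constructor <;> linarith

theorem PosSuperharmonic.exists_bounds (hn : 3 ≤ n) (hu : PosSuperharmonic u) :
    ∃ M : ℝ, 0 ≤ M ∧
      (∫⁻ y in ball (0 : Euc n) (1 / 2), ENNReal.ofReal (-lap u y)) ≤ ENNReal.ofReal M ∧
      ∀ x : Euc n, x ≠ 0 → ‖x‖ < 1 / 3 →
        (∫⁻ y in ball x (‖x‖ / 2), ENNReal.ofReal (u y)) ≤ ENNReal.ofReal (M * ‖x‖ ^ 2) := by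
  obtain ⟨C, hC, H⟩ := exists_annulus_bounds hn hu.contDiffAt hu.nonneg fun x hx =>
    hu.neg_lap_nonneg x ⟨ball_subset_ball (by norm_num) hx.1, hx.2⟩
  refine ⟨C, hC, ?_, fun x hx hx3 => ?_⟩
  · set s : ℕ → Set (Euc n) := fun k => {y | 2 * (1 / ((k : ℝ) + 13)) < ‖y‖ ∧ ‖y‖ < 1 / 2} with hs
    have hmono : Monotone s := by
      intro i j hij y hy
      refine ⟨lt_of_le_of_lt ?_ hy.1, hy.2⟩
      gcongr
    have hU : ball (0 : Euc n) (1 / 2) \ {0} ⊆ ⋃ k, s k := by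
      rintro y ⟨hy1, hy2⟩
      have hy0 : 0 < ‖y‖ := norm_pos_iff.mpr hy2
      obtain ⟨k, hk⟩ := exists_nat_gt (2 / ‖y‖)
      refine mem_iUnion.mpr ⟨k, ?_, mem_ball_zero_iff.mp hy1⟩
      rw [mul_one_div, div_lt_iff₀ (by positivity)]
      rw [div_lt_iff₀ hy0] at hk
      nlinarith
    have hae : ball (0 : Euc n) (1 / 2) ≤ᵐ[volume] (ball (0 : Euc n) (1 / 2) \ {0} : Set (Euc n)) := by
      filter_upwards [ae_ne_point (by omega) (0 : Euc n)] with y hy h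
      exact ⟨h, hy⟩
    calc _ ≤ ∫⁻ y in ⋃ k, s k, ENNReal.ofReal (-lap u y) :=
          (lintegral_mono' (Measure.restrict_mono_ae hae) le_rfl).trans (lintegral_mono_set hU)
      _ = ⨆ k, ∫⁻ y in s k, ENNReal.ofReal (-lap u y) :=
          setLIntegral_iUnion_of_directed _ hmono.directed_le
      _ ≤ _ := by
          refine iSup_le fun k => (H (1 / ((k : ℝ) + 13)) (by positivity) ?_).1
          rw [div_lt_div_iff₀ (by positivity) (by norm_num)]
          have : (0 : ℝ) ≤ k := by positivity
          linarith
  · have hx0 : 0 < ‖x‖ := norm_pos_iff.mpr hx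
    refine (lintegral_mono_set fun y hy => ?_).trans
      ((H (‖x‖ / 4) (by linarith) (by linarith)).2.trans (ENNReal.ofReal_le_ofReal ?_))
    · obtain ⟨h1, h2⟩ := notMem_ball_half hy
      exact ⟨by linarith, by linarith⟩
    · have : 0 ≤ C * ‖x‖ ^ 2 := by positivity
      nlinarith

theorem PosSuperharmonic.continuousOn_lap (hu : PosSuperharmonic u) :
    ContinuousOn (lap u) {0}ᶜ := fun x hx =>
  (continuousAt_lap (hu.contDiffAt x hx)).continuousWithinAt

theorem PosSuperharmonic.exists_rpow_le_add (hn : 3 ≤ n) (hu : PosSuperharmonic u) {q : ℝ}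
    (hq1 : 1 < q) (hq : ((n : ℝ) - 2) * q < n) :
    ∃ C : ℝ, 0 ≤ C ∧ ∃ W : Euc n → ENNReal,
      (∀ z : Euc n, z ≠ 0 → ‖z‖ < 1 / 3 →
        ENNReal.ofReal (u z ^ q) ≤ ENNReal.ofReal (C * ‖z‖ ^ (-(((n : ℝ) - 2) * q))) + W z) ∧
      ∫⁻ z in ball (0 : Euc n) (1 / 3), ENNReal.ofReal (‖z‖ ^ (-(n - ((n : ℝ) - 2) * q))) * W z ≤
        ENNReal.ofReal C := by
  obtain ⟨M, hM, HM1, HM2⟩ := hu.exists_bounds hn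
  obtain ⟨C0, hC0, HC0⟩ := exists_local_representation hn
  obtain ⟨C1, hC1, HC1⟩ := exists_lintegral_truncated_riesz_le (n := n) (by omega) hq
  have hq0 : 0 < q := by linarith
  set S : Set (Euc n) := ball 0 (1 / 2) \ {0} with hS
  have hSm : MeasurableSet S := measurableSet_ball.diff (measurableSet_singleton 0)
  set F : Euc n → ENNReal := S.indicator fun y => ENNReal.ofReal (-lap u y) with hF
  have hFm : Measurable F := by
    have h1 : Measurable (S.indicator fun y => -lap u y) := by
      classical
      have := (hu.continuousOn_lap.neg.mono (fun y hy => hy.2 : S ⊆ {0}ᶜ)).measurable_piecewise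
        (g := 0) continuousOn_const hSm
      rwa [Set.piecewise_eq_indicator] at this
    have h2 : F = fun y => ENNReal.ofReal (S.indicator (fun y => -lap u y) y) := by
      ext y
      by_cases hy : y ∈ S <;> simp [hF, hy]
    rw [h2]
    exact h1.ennreal_ofReal
  have hFint : ∫⁻ y, F y ≤ ENNReal.ofReal M := by
    rw [hF, lintegral_indicator hSm]
    exact (lintegral_mono_set sdiff_subset).trans HM1
  have hsub : ∀ z : Euc n, z ≠ 0 → ‖z‖ < 1 / 3 → ball z (‖z‖ / 2) ⊆ S := by
    intro z hz hz3 y hy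
    obtain ⟨h1, h2⟩ := notMem_ball_half hy
    refine ⟨mem_ball_zero_iff.mpr (by linarith), ?_⟩
    rintro rfl
    have hz0 := norm_pos_iff.mpr hz
    rw [norm_zero] at h1
    linarith
  set D : ℝ := 2 ^ (q - 1) * (C0 ^ q * M ^ (q - 1)) with hD
  have hD0 : 0 ≤ D := by positivity
  set D2 : ℝ := 2 ^ (q - 1) * (C0 * 2 ^ (n : ℝ) * M) ^ q with hD2
  have hD20 : 0 ≤ D2 := by positivity
  refine ⟨D2 + D * C1 * M, by positivity, fun z => ENNReal.ofReal D *
    ∫⁻ y in ball z (‖z‖ / 2), ENNReal.ofReal (‖y - z‖ ^ (-(((n : ℝ) - 2) * q))) * F y,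
    fun z hz hz3 => ?_, ?_⟩
  · have hz0 := norm_pos_iff.mpr hz
    have hne : ∀ y ∈ ball z (‖z‖ / 2), y ≠ 0 := fun y hy => (hsub z hz hz3 hy).2
    have hrep := HC0 u z (‖z‖ / 2) (by positivity) (fun y hy => hu.contDiffAt y (hne y hy))
      (fun y _ => hu.nonneg y) fun y hy => hu.neg_lap_nonneg y
        ⟨ball_subset_ball (by norm_num) (hsub z hz hz3 hy).1, hne y hy⟩
    have e1 : ∫⁻ y in ball z (‖z‖ / 2), ENNReal.ofReal (‖y - z‖ ^ (-((n : ℝ) - 2)) * -lap u y) =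
        ∫⁻ y in ball z (‖z‖ / 2), ENNReal.ofReal (‖y - z‖ ^ (-((n : ℝ) - 2))) * F y := by
      refine setLIntegral_congr_fun measurableSet_ball fun y hy => ?_
      simp only [hF, indicator_of_mem (hsub z hz hz3 hy)]
      rw [ENNReal.ofReal_mul (by positivity)]
    have e2 : ENNReal.ofReal (C0 * (‖z‖ / 2) ^ (-(n : ℝ))) *
        ∫⁻ y in ball z (‖z‖ / 2), ENNReal.ofReal (u y) ≤
        ENNReal.ofReal (C0 * 2 ^ (n : ℝ) * M * ‖z‖ ^ (-((n : ℝ) - 2))) := by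
      calc _ ≤ ENNReal.ofReal (C0 * (‖z‖ / 2) ^ (-(n : ℝ))) * ENNReal.ofReal (M * ‖z‖ ^ 2) := by
            gcongr
            exact HM2 z hz hz3
        _ = _ := by
            rw [← ENNReal.ofReal_mul (by positivity), Real.div_rpow hz0.le (by norm_num),
              Real.rpow_neg (by norm_num : (0 : ℝ) ≤ 2), div_inv_eq_mul, neg_sub, sub_eq_add_neg,
              Real.rpow_add hz0, Real.rpow_two]
            congr 1
            ring
    rw [e1] at hrep
    have hJ := rpow_lintegral_mul_le (μ := volume.restrict (ball z (‖z‖ / 2)))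
      (k := fun y => ENNReal.ofReal (‖y - z‖ ^ (-((n : ℝ) - 2)))) (by fun_prop) hFm hq1
    set V := ∫⁻ y in ball z (‖z‖ / 2), ENNReal.ofReal (‖y - z‖ ^ (-((n : ℝ) - 2))) * F y
    have e3 : ∀ y, ENNReal.ofReal (‖y - z‖ ^ (-((n : ℝ) - 2))) ^ q =
        ENNReal.ofReal (‖y - z‖ ^ (-(((n : ℝ) - 2) * q))) := fun y => by
      rw [ENNReal.ofReal_rpow_of_nonneg (by positivity) hq0.le, ← Real.rpow_mul (norm_nonneg _),
        neg_mul]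
    simp only [e3] at hJ
    have e4 : (2 : ENNReal) ^ (q - 1) = ENNReal.ofReal (2 ^ (q - 1)) := by
      rw [← ENNReal.ofReal_rpow_of_nonneg (by norm_num) (by linarith)]
      simp
    calc ENNReal.ofReal (u z ^ q) = ENNReal.ofReal (u z) ^ q :=
          (ENNReal.ofReal_rpow_of_nonneg (hu.nonneg z) hq0.le).symm
      _ ≤ (ENNReal.ofReal C0 * V +
            ENNReal.ofReal (C0 * 2 ^ (n : ℝ) * M * ‖z‖ ^ (-((n : ℝ) - 2)))) ^ q := by
          gcongr
          exact hrep.trans (add_le_add le_rfl e2)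
      _ ≤ 2 ^ (q - 1) * ((ENNReal.ofReal C0 * V) ^ q +
            ENNReal.ofReal (C0 * 2 ^ (n : ℝ) * M * ‖z‖ ^ (-((n : ℝ) - 2))) ^ q) :=
          ENNReal.rpow_add_le_mul_rpow_add_rpow _ _ hq1.le
      _ = ENNReal.ofReal (D2 * ‖z‖ ^ (-(((n : ℝ) - 2) * q))) +
            ENNReal.ofReal (2 ^ (q - 1) * C0 ^ q) * V ^ q := by
          rw [mul_add, add_comm]
          congr 1
          · rw [ENNReal.ofReal_rpow_of_nonneg (by positivity) hq0.le,
              e4, ← ENNReal.ofReal_mul (by positivity),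
              Real.mul_rpow (by positivity) (by positivity), ← Real.rpow_mul hz0.le, neg_mul, hD2,
              ← mul_assoc]
          · rw [ENNReal.mul_rpow_of_nonneg _ _ hq0.le, ENNReal.ofReal_rpow_of_nonneg hC0 hq0.le,
              e4, ← mul_assoc, ← ENNReal.ofReal_mul (by positivity)]
      _ ≤ _ := by
          refine add_le_add (ENNReal.ofReal_le_ofReal ?_) ?_
          · gcongr
            have : 0 ≤ D * C1 * M := by positivity
            linarith
          · have e5 : ENNReal.ofReal D =
                ENNReal.ofReal (2 ^ (q - 1) * C0 ^ q) * ENNReal.ofReal (M ^ (q - 1)) := by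
              rw [← ENNReal.ofReal_mul (by positivity), hD, mul_assoc]
            simp only [e5]
            rw [mul_assoc]
            refine mul_le_mul' le_rfl (hJ.trans (mul_le_mul' ?_ le_rfl))
            rw [← ENNReal.ofReal_rpow_of_nonneg hM (by linarith)]
            gcongr
            exact (setLIntegral_le_lintegral _ _).trans hFint
  · calc _ ≤ ∫⁻ z, ENNReal.ofReal (‖z‖ ^ (-(n - ((n : ℝ) - 2) * q))) * (ENNReal.ofReal D *
          ∫⁻ y in ball z (‖z‖ / 2), ENNReal.ofReal (‖y - z‖ ^ (-(((n : ℝ) - 2) * q))) * F y) :=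
          setLIntegral_le_lintegral _ _
      _ = ENNReal.ofReal D * ∫⁻ z, ENNReal.ofReal (‖z‖ ^ (-(n - ((n : ℝ) - 2) * q))) *
          ∫⁻ y in ball z (‖z‖ / 2), ENNReal.ofReal (‖y - z‖ ^ (-(((n : ℝ) - 2) * q))) * F y := by
          rw [← lintegral_const_mul' _ _ ENNReal.ofReal_ne_top]
          refine lintegral_congr fun z => ?_
          rw [mul_left_comm]
      _ ≤ ENNReal.ofReal D * (ENNReal.ofReal C1 * ENNReal.ofReal M) := by
          gcongr
          exact (HC1 F hFm).trans (by gcongr)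
      _ ≤ _ := by
          rw [← ENNReal.ofReal_mul hC1, ← ENNReal.ofReal_mul hD0]
          refine ENNReal.ofReal_le_ofReal ?_
          rw [← mul_assoc]
          linarith

end Super

section SuperIntegrability
variable {n : ℕ} {u : Euc n → ℝ}

theorem PosSuperharmonic.exists_setLIntegral_rpow_le (hn : 3 ≤ n) (hu : PosSuperharmonic u) {q : ℝ}
    (hq1 : 1 < q) (hq : ((n : ℝ) - 2) * q < n) :
    ∃ K : ℝ, 0 ≤ K ∧ ∀ x : Euc n, x ≠ 0 → ‖x‖ < 2 / 9 →
      (∫⁻ z in ball x (‖x‖ / 2), ENNReal.ofReal (u z ^ q)) ≤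
        ENNReal.ofReal (K * ‖x‖ ^ (n - ((n : ℝ) - 2) * q)) := by
  have hn' : (3 : ℝ) ≤ n := by exact_mod_cast hn
  obtain ⟨C, hC, W, HW1, HW2⟩ := hu.exists_rpow_le_add hn hq1 hq
  obtain ⟨V, hV, HV⟩ := exists_volume_ball_le (n := n) (by omega)
  set b := ((n : ℝ) - 2) * q with hb
  have hb0 : 0 ≤ b := mul_nonneg (by linarith) (by linarith)
  refine ⟨C * (1 / 2) ^ (-b) * (V * (1 / 2) ^ (n : ℝ)) + (3 / 2) ^ (n - b) * C, by positivity,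
    fun x hx hx9 => ?_⟩
  have hx0 := norm_pos_iff.mpr hx
  have hsub : ball x (‖x‖ / 2) ⊆ ball 0 (1 / 3) := fun z hz => by
    rw [mem_ball_zero_iff]
    linarith [(notMem_ball_half hz).2]
  calc _ ≤ ∫⁻ z in ball x (‖x‖ / 2), (ENNReal.ofReal (C * (‖x‖ / 2) ^ (-b)) +
        ENNReal.ofReal ((3 / 2 * ‖x‖) ^ (n - b)) * (ENNReal.ofReal (‖z‖ ^ (-(n - b))) * W z)) := by
        refine setLIntegral_mono' measurableSet_ball fun z hz => ?_
        obtain ⟨h1, h2⟩ := notMem_ball_half hz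
        have hz0 : 0 < ‖z‖ := by linarith
        refine (HW1 z (norm_pos_iff.mp hz0) (by linarith)).trans (add_le_add ?_ ?_)
        · refine ENNReal.ofReal_le_ofReal (mul_le_mul_of_nonneg_left ?_ hC)
          exact Real.rpow_le_rpow_of_nonpos (by positivity) h1.le (by linarith)
        · rw [← mul_assoc, ← ENNReal.ofReal_mul (by positivity)]
          refine le_mul_of_one_le_left' ?_
          rw [ENNReal.one_le_ofReal, Real.rpow_neg hz0.le, ← div_eq_mul_inv,
            one_le_div (by positivity)]
          exact Real.rpow_le_rpow hz0.le h2.le (by linarith)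
    _ ≤ ENNReal.ofReal (C * (‖x‖ / 2) ^ (-b)) * ENNReal.ofReal (V * (‖x‖ / 2) ^ (n : ℝ)) +
        ENNReal.ofReal ((3 / 2 * ‖x‖) ^ (n - b)) * ENNReal.ofReal C := by
        rw [lintegral_add_left measurable_const, setLIntegral_const,
          lintegral_const_mul' _ _ ENNReal.ofReal_ne_top]
        gcongr
        · exact HV x _ (by positivity)
        · exact (lintegral_mono_set hsub).trans HW2
    _ = _ := by
        rw [← ENNReal.ofReal_mul (by positivity), ← ENNReal.ofReal_mul (by positivity),
          ← ENNReal.ofReal_add (by positivity) (by positivity), div_eq_mul_one_div ‖x‖,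
          Real.mul_rpow hx0.le (by norm_num), Real.mul_rpow hx0.le (by norm_num),
          Real.mul_rpow (by norm_num) hx0.le, sub_eq_add_neg (n : ℝ) b, Real.rpow_add hx0]
        congr 1
        ring

theorem PosSuperharmonic.exists_setLIntegral_weighted_le (hn : 3 ≤ n) (hu : PosSuperharmonic u)
    {q lam c : ℝ} (hq1 : 1 < q) (hq : ((n : ℝ) - 2) * q < n) (hlam : 0 < lam) (hlq : lam ≤ q)
    (hc : c + (n - 2) * lam < n) :
    ∃ K : ℝ, 0 ≤ K ∧ (∫⁻ z in ball (0 : Euc n) (1 / 3), ENNReal.ofReal (‖z‖ ^ (-c) * u z ^ lam)) ≤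
        ENNReal.ofReal K := by
  have hn' : (3 : ℝ) ≤ n := by exact_mod_cast hn
  obtain ⟨C, hC, W, HW1, HW2⟩ := hu.exists_rpow_le_add hn hq1 hq
  obtain ⟨V, hV, HV⟩ := exists_setLIntegral_ball_rpow_le (n := n) (by omega) hc
  have HV' := HV 0 (1 / 3) (by norm_num)
  simp only [sub_zero] at HV'
  set e := c + ((n : ℝ) - 2) * lam with he
  set b := ((n : ℝ) - 2) * q with hb
  refine ⟨(1 + C) * (V * (1 / 3) ^ (n - e)) + C, by positivity, ?_⟩
  calc _ ≤ ∫⁻ z in ball (0 : Euc n) (1 / 3), (ENNReal.ofReal (1 + C) * ENNReal.ofReal (‖z‖ ^ (-e)) +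
        ENNReal.ofReal (‖z‖ ^ (-(n - b))) * W z) := by
        refine setLIntegral_mono_ae' measurableSet_ball ?_
        filter_upwards [ae_ne_point (by omega) (0 : Euc n)] with z hz hz3
        have hz0 := norm_pos_iff.mpr hz
        rw [mem_ball_zero_iff] at hz3
        have hu0 := hu.nonneg z
        have h1 := rpow_le_one_add_rpow (v := u z * ‖z‖ ^ ((n : ℝ) - 2)) (by positivity) hlam.le hlq
        have h2 : ‖z‖ ^ (-c) * u z ^ lam ≤ ‖z‖ ^ (-e) + ‖z‖ ^ (b - e) * u z ^ q := by
          have h3 := mul_le_mul_of_nonneg_left h1 (by positivity : 0 ≤ ‖z‖ ^ (-e))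
          rw [Real.mul_rpow hu0 (by positivity), Real.mul_rpow hu0 (by positivity),
            ← Real.rpow_mul hz0.le, ← Real.rpow_mul hz0.le, ← hb] at h3
          have h4 : ‖z‖ ^ (-c) = ‖z‖ ^ (-e) * ‖z‖ ^ (((n : ℝ) - 2) * lam) := by
            rw [← Real.rpow_add hz0, he]
            congr 1
            ring
          have h5 : ‖z‖ ^ (b - e) = ‖z‖ ^ (-e) * ‖z‖ ^ b := by
            rw [← Real.rpow_add hz0]
            congr 1
            ring
          rw [h4, h5]
          linarith
        calc _ ≤ ENNReal.ofReal (‖z‖ ^ (-e) + ‖z‖ ^ (b - e) * u z ^ q) := ENNReal.ofReal_le_ofReal h2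
          _ = ENNReal.ofReal (‖z‖ ^ (-e)) +
              ENNReal.ofReal (‖z‖ ^ (b - e)) * ENNReal.ofReal (u z ^ q) := by
              rw [ENNReal.ofReal_add (by positivity) (by positivity),
                ENNReal.ofReal_mul (by positivity)]
          _ ≤ ENNReal.ofReal (‖z‖ ^ (-e)) +
              ENNReal.ofReal (‖z‖ ^ (b - e)) * (ENNReal.ofReal (C * ‖z‖ ^ (-b)) + W z) := by
              gcongr
              exact HW1 z hz hz3
          _ = ENNReal.ofReal (1 + C) * ENNReal.ofReal (‖z‖ ^ (-e)) +
              ENNReal.ofReal (‖z‖ ^ (b - e)) * W z := by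
              rw [mul_add, ← add_assoc, ← ENNReal.ofReal_mul (by positivity),
                ← ENNReal.ofReal_mul (by positivity), ← ENNReal.ofReal_add (by positivity)
                (by positivity), mul_left_comm, ← Real.rpow_add hz0]
              congr 2
              rw [show b - e + -b = -e by ring]
              ring
          _ ≤ _ := by
              refine add_le_add le_rfl (mul_le_mul' (ENNReal.ofReal_le_ofReal ?_) le_rfl)
              exact Real.rpow_le_rpow_of_exponent_ge hz0 (by linarith) (by linarith)
    _ = ENNReal.ofReal (1 + C) * (∫⁻ z in ball (0 : Euc n) (1 / 3), ENNReal.ofReal (‖z‖ ^ (-e))) +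
        ∫⁻ z in ball (0 : Euc n) (1 / 3), ENNReal.ofReal (‖z‖ ^ (-(n - b))) * W z := by
        rw [lintegral_add_left (by fun_prop), lintegral_const_mul' _ _ ENNReal.ofReal_ne_top]
    _ ≤ ENNReal.ofReal (1 + C) * ENNReal.ofReal (V * (1 / 3) ^ (n - e)) + ENNReal.ofReal C := by
        gcongr
    _ = _ := by
        rw [← ENNReal.ofReal_mul (by positivity), ← ENNReal.ofReal_add (by positivity) hC]

end SuperIntegrability

section LocalBound
variable {n : ℕ} {u : Euc n → ℝ}

/-- The nonlocal term as an extended nonnegative real. -/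
noncomputable def rieszPotential (α lam : ℝ) (u : Euc n → ℝ) (x : Euc n) : ENNReal :=
  ∫⁻ y, ENNReal.ofReal (‖x - y‖ ^ (-α) * u y ^ lam)

theorem rieszPotential_le_near_add_far (hn : 0 < n) (hu : ∀ x, 0 ≤ u x) {α lam β K r : ℝ}
    (hβ0 : 0 ≤ β) (hβα : β ≤ α)
    (hK : ∫⁻ y, ENNReal.ofReal (‖y‖ ^ (-(α - β)) * u y ^ lam) ≤ ENNReal.ofReal K)
    (hr : 0 < r) {x y : Euc n} (hx : ‖x‖ = 2 * r) (hy : ‖y - x‖ < r / 2) :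
    rieszPotential α lam u y ≤
      (∫⁻ w in ball x r, ENNReal.ofReal (‖y - w‖ ^ (-α) * u w ^ lam)) +
        ENNReal.ofReal (2 ^ β * 6 ^ (α - β) * K * r ^ (-β)) := by
  rw [rieszPotential, ← lintegral_add_compl _ (measurableSet_ball (x := x) (ε := r))]
  refine add_le_add le_rfl ?_
  have hc : (0 : ℝ) ≤ 2 ^ β * 6 ^ (α - β) * r ^ (-β) := by positivity
  calc _ ≤ ∫⁻ w in (ball x r)ᶜ, ENNReal.ofReal (2 ^ β * 6 ^ (α - β) * r ^ (-β)) *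
        ENNReal.ofReal (‖w‖ ^ (-(α - β)) * u w ^ lam) := by
        refine setLIntegral_mono_ae' measurableSet_ball.compl ?_
        filter_upwards [ae_ne_point hn (0 : Euc n)] with w hw0 hw
        rw [mem_compl_iff, mem_ball, not_lt, dist_eq_norm] at hw
        have hw0' := norm_pos_iff.mpr hw0
        have hul : 0 ≤ u w ^ lam := Real.rpow_nonneg (hu w) _
        have h1 : r / 2 ≤ ‖y - w‖ := by
          have := norm_sub_le_norm_sub_add_norm_sub w y x
          rw [norm_sub_rev w y] at this
          linarith
        have h2 : ‖w‖ / 6 ≤ ‖y - w‖ := by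
          have h3 := norm_le_norm_sub_add_norm w y
          have h4 := norm_le_norm_sub_add_norm y x
          rw [norm_sub_rev w y] at h3
          linarith
        have hpos : 0 < ‖y - w‖ := by linarith
        rw [← ENNReal.ofReal_mul hc, ← mul_assoc]
        refine ENNReal.ofReal_le_ofReal (mul_le_mul_of_nonneg_right ?_ hul)
        calc ‖y - w‖ ^ (-α) = ‖y - w‖ ^ (-β) * ‖y - w‖ ^ (-(α - β)) := by
              rw [← Real.rpow_add hpos]
              congr 1
              ring
          _ ≤ (r / 2) ^ (-β) * (‖w‖ / 6) ^ (-(α - β)) := by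
              refine mul_le_mul ?_ ?_ (by positivity) (by positivity)
              · exact Real.rpow_le_rpow_of_nonpos (by positivity) h1 (by linarith)
              · exact Real.rpow_le_rpow_of_nonpos (by positivity) h2 (by linarith)
          _ = _ := by
              rw [Real.div_rpow hr.le (by norm_num), Real.div_rpow hw0'.le (by norm_num),
                Real.rpow_neg (by norm_num : (0 : ℝ) ≤ 2), Real.rpow_neg (by norm_num : (0 : ℝ) ≤ 6),
                div_inv_eq_mul, div_inv_eq_mul]
              ring
    _ ≤ ENNReal.ofReal (2 ^ β * 6 ^ (α - β) * r ^ (-β)) * ENNReal.ofReal K := by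
        rw [lintegral_const_mul' _ _ ENNReal.ofReal_ne_top]
        gcongr
        exact (setLIntegral_le_lintegral _ _).trans hK
    _ = _ := by
        rw [← ENNReal.ofReal_mul hc]
        congr 1
        ring

theorem PosSuperharmonic.exists_le_rpow (hn : 3 ≤ n) (hu : PosSuperharmonic u)
    {α lam sig p q β K1 K2 R : ℝ} (hα0 : 0 < α) (hαn : α < n) (hlam : 0 < lam) (hsig : 0 ≤ sig)
    (hlap : ∀ x ∈ ball (0 : Euc n) 2 \ {0},
      ENNReal.ofReal (-lap u x) ≤ rieszPotential α lam u x * ENNReal.ofReal (u x ^ sig))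
    (hq1 : 1 ≤ q) (hqlam : lam ≤ q) (hβ0 : 0 ≤ β) (hβα : β ≤ α) (hK10 : 0 ≤ K1) (hK20 : 0 ≤ K2)
    (hK1 : ∫⁻ y, ENNReal.ofReal (‖y‖ ^ (-(α - β)) * u y ^ lam) ≤ ENNReal.ofReal K1)
    (hR : R ≤ 1)
    (hK2 : ∀ x : Euc n, x ≠ 0 → ‖x‖ < R →
      ∫⁻ z in ball x (‖x‖ / 2), ENNReal.ofReal (u z ^ q) ≤ ENNReal.ofReal (K2 * ‖x‖ ^ (n - p * q)))
    (he1 : β ≤ 2 + p - p * sig) (he2 : 0 ≤ 2 + p - p * sig + n - α - p * lam)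
    (hcrit : sig + max 0 (lam - q * (1 - α / n)) < 1 + 2 * q / n) :
    ∃ C : ℝ, 0 ≤ C ∧ ∀ x : Euc n, x ≠ 0 → ‖x‖ < R → u x ≤ C * ‖x‖ ^ (-p) := by
  obtain ⟨C, hC, HC⟩ := exists_local_mean_value hn
  set A : ℝ := 1 + 2 ^ β * 6 ^ (α - β) * K1 with hA
  have hA1 : 0 ≤ 2 ^ β * 6 ^ (α - β) * K1 := by positivity
  have hA0 : 1 ≤ A := by linarith
  clear_value A
  obtain ⟨C', HC'⟩ := local_sup_bound (n := n) (by omega) hα0 hαn hlam hsig hq1 hqlam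
    (C0 := C * A) (K := K2 * 2 ^ (n - p * q)) (by positivity) (by positivity) hcrit
  refine ⟨max C' 0 * 2 ^ p, by positivity, fun x hx hxR => ?_⟩
  have hx0 := norm_pos_iff.mpr hx
  obtain ⟨r, hrdef⟩ : ∃ r, r = ‖x‖ / 2 := ⟨_, rfl⟩
  have hr : 0 < r := by rw [hrdef]; positivity
  have hxr : ‖x‖ = 2 * r := by rw [hrdef]; ring
  have hr1 : r ≤ 1 := by linarith
  have hmem : ∀ η : Euc n, ‖η‖ < 1 → x + r • η ∈ ball (0 : Euc n) 2 \ {0} := by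
    intro η hη
    have h0 : ‖r • η‖ < r := by
      rw [norm_smul, Real.norm_of_nonneg hr.le]
      nlinarith
    refine ⟨?_, ?_⟩
    · rw [mem_ball_zero_iff]
      linarith [norm_add_le x (r • η)]
    · intro h
      rw [mem_singleton_iff] at h
      have := norm_le_norm_add_norm_sub' x (-(r • η))
      rw [sub_neg_eq_add, h, norm_zero, norm_neg] at this
      linarith
  set v : Euc n → ℝ := fun η => r ^ p * u (x + r • η) with hv
  have hv0 : ∀ η, 0 ≤ v η := fun η => mul_nonneg (by positivity) (hu.nonneg _)
  have huv : ∀ η, u (x + r • η) = r ^ (-p) * v η := fun η => by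
    rw [hv, ← mul_assoc, ← Real.rpow_add hr]
    simp
  have hvc : ContinuousOn v (ball 0 1) := by
    refine continuousOn_const.mul fun η hη => ContinuousAt.continuousWithinAt ?_
    have h1 := (hu.contDiffAt _ (hmem η (mem_ball_zero_iff.mp hη)).2).continuousAt
    have h2 : ContinuousAt (fun η : Euc n => x + r • η) η := by fun_prop
    exact h1.comp (f := fun η : Euc n => x + r • η) h2
  have hscale : ∀ F : Euc n → ENNReal,
      ∫⁻ y in ball x r, F y = ENNReal.ofReal (r ^ n) * ∫⁻ η in ball 0 1, F (x + r • η) := by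
    intro F
    have := setLIntegral_ball_scale F x 0 hr 1
    simpa using this
  have hvq : ∫⁻ η in ball (0 : Euc n) 1, ENNReal.ofReal (v η ^ q) ≤
      ENNReal.ofReal (K2 * 2 ^ (n - p * q)) := by
    have h1 := hK2 x hx hxR
    rw [← hrdef, hscale] at h1
    have e1 : ∀ η, ENNReal.ofReal (v η ^ q) =
        ENNReal.ofReal (r ^ (p * q)) * ENNReal.ofReal (u (x + r • η) ^ q) := fun η => by
      rw [← ENNReal.ofReal_mul (by positivity), hv, Real.mul_rpow (by positivity) (hu.nonneg _),
        ← Real.rpow_mul hr.le]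
    simp_rw [e1]
    rw [lintegral_const_mul' _ _ ENNReal.ofReal_ne_top]
    have e2 : ENNReal.ofReal (r ^ (p * q)) =
        ENNReal.ofReal (r ^ (p * q - n)) * ENNReal.ofReal (r ^ n) := by
      rw [← ENNReal.ofReal_mul (by positivity), ← Real.rpow_natCast r n, ← Real.rpow_add hr]
      congr 2
      ring
    rw [e2, mul_assoc]
    refine (mul_le_mul' le_rfl h1).trans ?_
    rw [← ENNReal.ofReal_mul (by positivity)]
    refine ENNReal.ofReal_le_ofReal (le_of_eq ?_)
    rw [hxr, Real.mul_rpow (by norm_num) hr.le,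
      show r ^ (p * q - n) = (r ^ (n - p * q))⁻¹ by rw [← Real.rpow_neg hr.le]; congr 1; ring]
    have : r ^ ((n : ℝ) - p * q) ≠ 0 := by positivity
    field_simp
  have hmain : ∀ (η : Euc n) (s G : ℝ), 0 < s → closedBall η s ⊆ ball 0 (1 / 2) → 0 ≤ G →
      (∀ ζ ∈ ball η s, (1 + ∫⁻ ξ in ball (0 : Euc n) 1, ENNReal.ofReal (‖ζ - ξ‖ ^ (-α) * v ξ ^ lam)) *
        ENNReal.ofReal (v ζ ^ sig) ≤ ENNReal.ofReal G) →
      ENNReal.ofReal (v η) ≤ ENNReal.ofReal (C * A * s ^ 2 * G) +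
        ENNReal.ofReal (C * A * s ^ (-(n : ℝ))) * ∫⁻ ξ in ball η s, ENNReal.ofReal (v ξ) := by
    intro η s G hs hηs hG HG
    have hpt : ∀ y ∈ ball (x + r • η) (r * s), ∃ ζ ∈ ball η s, y = x + r • ζ := by
      intro y hy
      refine ⟨r⁻¹ • (y - x), ?_, ?_⟩
      · rw [mem_ball, dist_eq_norm] at hy ⊢
        have : r⁻¹ • (y - x) - η = r⁻¹ • (y - (x + r • η)) := by
          rw [sub_add_eq_sub_sub, smul_sub r⁻¹ (y - x), inv_smul_smul₀ hr.ne']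
        rw [this, norm_smul, Real.norm_of_nonneg (by positivity), inv_mul_lt_iff₀ hr]
        exact hy
      · rw [smul_inv_smul₀ hr.ne']
        abel
    have hζ : ∀ ζ ∈ ball η s, ‖ζ‖ < 1 / 2 := fun ζ h =>
      mem_ball_zero_iff.mp (hηs (ball_subset_closedBall h))
    have hlapG : ∀ y ∈ ball (x + r • η) (r * s), -lap u y ≤ A * G * r ^ (-(2 + p)) := by
      intro y hy
      obtain ⟨ζ, hζs, rfl⟩ := hpt y hy
      have hζ2 := hζ ζ hζs
      have h1 := hlap _ (hmem ζ (by linarith))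
      have hyx : ‖x + r • ζ - x‖ < r / 2 := by
        rw [add_sub_cancel_left, norm_smul, Real.norm_of_nonneg hr.le]
        nlinarith
      have h2 := rieszPotential_le_near_add_far (by omega) hu.nonneg hβ0 hβα hK1 hr hxr hyx
      set J := ∫⁻ ξ in ball (0 : Euc n) 1, ENNReal.ofReal (‖ζ - ξ‖ ^ (-α) * v ξ ^ lam) with hJ
      have h3 : ∫⁻ w in ball x r, ENNReal.ofReal (‖x + r • ζ - w‖ ^ (-α) * u w ^ lam) =
          ENNReal.ofReal (r ^ (n - α - p * lam)) * J := by
        rw [hscale, hJ, ← lintegral_const_mul' _ _ ENNReal.ofReal_ne_top,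
          ← lintegral_const_mul' _ _ ENNReal.ofReal_ne_top]
        refine lintegral_congr fun ξ => ?_
        have e : r ^ (n - α - p * lam) = r ^ n * r ^ (-α) * r ^ (-p * lam) := by
          rw [← Real.rpow_natCast r n, ← Real.rpow_add hr, ← Real.rpow_add hr]
          congr 1
          ring
        rw [← ENNReal.ofReal_mul (by positivity), ← ENNReal.ofReal_mul (by positivity),
          add_sub_add_left_eq_sub, ← smul_sub, norm_smul, Real.norm_of_nonneg hr.le, huv,
          Real.mul_rpow hr.le (norm_nonneg _), Real.mul_rpow (by positivity) (hv0 ξ),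
          ← Real.rpow_mul hr.le, e]
        congr 1
        ring
      have hrr : r ^ (n - α - p * lam) ≤ r ^ (-(2 + p - p * sig)) :=
        Real.rpow_le_rpow_of_exponent_ge hr hr1 (by linarith)
      have hrr2 : r ^ (-β) ≤ r ^ (-(2 + p - p * sig)) :=
        Real.rpow_le_rpow_of_exponent_ge hr hr1 (by linarith)
      have h4 : rieszPotential α lam u (x + r • ζ) ≤
          ENNReal.ofReal (A * r ^ (-(2 + p - p * sig))) * (1 + J) := by
        rw [h3] at h2
        refine h2.trans ?_
        rw [mul_add, mul_one, add_comm]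
        refine add_le_add (ENNReal.ofReal_le_ofReal ?_)
          (mul_le_mul' (ENNReal.ofReal_le_ofReal ?_) le_rfl)
        · refine mul_le_mul (by linarith) hrr2 (by positivity) (by linarith)
        · refine hrr.trans (le_mul_of_one_le_left (by positivity) hA0)
      have h5 : ENNReal.ofReal (-lap u (x + r • ζ)) ≤ ENNReal.ofReal (A * G * r ^ (-(2 + p))) := by
        calc _ ≤ ENNReal.ofReal (A * r ^ (-(2 + p - p * sig))) * (1 + J) *
              ENNReal.ofReal (u (x + r • ζ) ^ sig) := h1.trans (mul_le_mul' h4 le_rfl)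
          _ = ENNReal.ofReal (A * r ^ (-(2 + p))) * ((1 + J) * ENNReal.ofReal (v ζ ^ sig)) := by
              have e1 : ENNReal.ofReal (u (x + r • ζ) ^ sig) =
                  ENNReal.ofReal (r ^ (-p * sig)) * ENNReal.ofReal (v ζ ^ sig) := by
                rw [huv, Real.mul_rpow (by positivity) (hv0 ζ), ← Real.rpow_mul hr.le,
                  ENNReal.ofReal_mul (by positivity)]
              have e2 : ENNReal.ofReal (A * r ^ (-(2 + p))) =
                  ENNReal.ofReal (A * r ^ (-(2 + p - p * sig))) *
                    ENNReal.ofReal (r ^ (-p * sig)) := by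
                rw [← ENNReal.ofReal_mul (by positivity), mul_assoc, ← Real.rpow_add hr]
                congr 3
                ring
              rw [e1, e2]
              ring
          _ ≤ ENNReal.ofReal (A * r ^ (-(2 + p))) * ENNReal.ofReal G := mul_le_mul' le_rfl (HG ζ hζs)
          _ = _ := by
              rw [← ENNReal.ofReal_mul (by positivity)]
              congr 1
              ring
      exact (ENNReal.ofReal_le_ofReal_iff (by positivity)).mp h5
    have hball : ∀ y ∈ ball (x + r • η) (r * s), y ∈ ball (0 : Euc n) 2 \ {0} := by
      intro y hy
      obtain ⟨ζ, hζs, rfl⟩ := hpt y hy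
      exact hmem ζ (by linarith [hζ ζ hζs])
    have hmv := HC u (x + r • η) (r * s) (A * G * r ^ (-(2 + p))) (by positivity) (by positivity)
      (fun y hy => hu.contDiffAt y (hball y hy).2) (fun y _ => hu.nonneg y)
      (fun y hy => hu.neg_lap_nonneg y (hball y hy)) hlapG
    rw [setLIntegral_ball_scale _ x η hr s] at hmv
    have e1 : ∫⁻ ξ in ball η s, ENNReal.ofReal (v ξ) =
        ENNReal.ofReal (r ^ p) * ∫⁻ ξ in ball η s, ENNReal.ofReal (u (x + r • ξ)) := by
      rw [← lintegral_const_mul' _ _ ENNReal.ofReal_ne_top]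
      refine lintegral_congr fun ξ => ?_
      rw [← ENNReal.ofReal_mul (by positivity)]
    have hCA : C ≤ C * A := le_mul_of_one_le_right hC hA0
    calc ENNReal.ofReal (v η) = ENNReal.ofReal (r ^ p) * ENNReal.ofReal (u (x + r • η)) := by
          rw [← ENNReal.ofReal_mul (by positivity)]
      _ ≤ _ := mul_le_mul' le_rfl hmv
      _ = ENNReal.ofReal (C * A * s ^ 2 * G) + ENNReal.ofReal (C * s ^ (-(n : ℝ))) *
            ∫⁻ ξ in ball η s, ENNReal.ofReal (v ξ) := by
          have e2 : ENNReal.ofReal (r ^ p) *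
              ENNReal.ofReal (C * (r * s) ^ 2 * (A * G * r ^ (-(2 + p)))) =
                ENNReal.ofReal (C * A * s ^ 2 * G) := by
            rw [← ENNReal.ofReal_mul (by positivity)]
            congr 1
            rw [Real.rpow_neg hr.le, Real.rpow_add hr, Real.rpow_two]
            have : r ^ p ≠ 0 := by positivity
            field_simp
          have e3 : ENNReal.ofReal (C * (r * s) ^ (-(n : ℝ))) * ENNReal.ofReal (r ^ n) =
              ENNReal.ofReal (C * s ^ (-(n : ℝ))) := by
            rw [← ENNReal.ofReal_mul (by positivity)]
            congr 1
            rw [Real.mul_rpow hr.le hs.le, Real.rpow_neg hr.le, Real.rpow_natCast]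
            field_simp
          rw [e1, mul_add, e2, ← e3]
          ring
      _ ≤ _ := by gcongr
  have hfin := HC' v hv0 hvc hvq hmain
  have h0 : u x = r ^ (-p) * v 0 := by
    have := huv 0
    simpa using this
  rw [h0]
  calc r ^ (-p) * v 0 ≤ r ^ (-p) * max C' 0 := by
        gcongr
        exact hfin.trans (le_max_left _ _)
    _ = _ := by
        rw [hrdef, Real.div_rpow hx0.le (by norm_num), Real.rpow_neg (by norm_num : (0 : ℝ) ≤ 2),
          div_inv_eq_mul]
        ring

end LocalBound

section InitialBounds
variable {n : ℕ} {u : Euc n → ℝ} {α lam sig : ℝ}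

theorem IsCPSolution.posSuperharmonic (hu : IsCPSolution n α lam sig u) : PosSuperharmonic u where
  nonneg := hu.1
  contDiffAt _ hx := hu.2.1.contDiffAt (isOpen_compl_singleton.mem_nhds hx)
  neg_lap_nonneg _ hx := (hu.2.2.2 _ hx).1

theorem IsCPSolution.lap_le (hu : IsCPSolution n α lam sig u) (x : Euc n)
    (hx : x ∈ ball (0 : Euc n) 2 \ {0}) :
    ENNReal.ofReal (-lap u x) ≤ rieszPotential α lam u x * ENNReal.ofReal (u x ^ sig) := by
  have hnn := hu.1
  refine (ENNReal.ofReal_le_ofReal (hu.2.2.2 x hx).2).trans ?_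
  rw [ENNReal.ofReal_mul' (Real.rpow_nonneg (hnn x) _)]
  refine mul_le_mul' ?_ le_rfl
  refine (Real.ofReal_le_enorm _).trans ((enorm_integral_le_lintegral_enorm _).trans ?_)
  refine lintegral_mono fun y => ?_
  rw [Real.enorm_of_nonneg (mul_nonneg (by positivity) (Real.rpow_nonneg (hnn y) _))]

theorem IsCPSolution.exists_lintegral_rpow_le (hu : IsCPSolution n α lam sig u) :
    ∃ K : ℝ, 0 ≤ K ∧ ∫⁻ y, ENNReal.ofReal (u y ^ lam) ≤ ENNReal.ofReal K := by
  have h := hu.2.2.1.lintegral_lt_top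
  exact ⟨_, ENNReal.toReal_nonneg, (ENNReal.ofReal_toReal h.ne).ge⟩

theorem PosSuperharmonic.exists_lintegral_weighted_le (hn : 3 ≤ n) (hu : PosSuperharmonic u)
    {c q K : ℝ} (hq1 : 1 < q) (hq : ((n : ℝ) - 2) * q < n) (hlam : 0 < lam) (hlq : lam ≤ q)
    (hc0 : 0 ≤ c) (hc : c + (n - 2) * lam < n) (hK0 : 0 ≤ K)
    (hK : ∫⁻ y, ENNReal.ofReal (u y ^ lam) ≤ ENNReal.ofReal K) :
    ∃ K' : ℝ, 0 ≤ K' ∧ ∫⁻ y, ENNReal.ofReal (‖y‖ ^ (-c) * u y ^ lam) ≤ ENNReal.ofReal K' := by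
  obtain ⟨K1, hK10, hK1⟩ := hu.exists_setLIntegral_weighted_le hn hq1 hq hlam hlq hc
  refine ⟨K1 + (1 / 3) ^ (-c) * K, by positivity, ?_⟩
  rw [← lintegral_add_compl _ (measurableSet_ball (x := (0 : Euc n)) (ε := 1 / 3)),
    ENNReal.ofReal_add hK10 (by positivity)]
  refine add_le_add hK1 ?_
  calc _ ≤ ∫⁻ y in (ball (0 : Euc n) (1 / 3))ᶜ, ENNReal.ofReal ((1 / 3) ^ (-c)) *
        ENNReal.ofReal (u y ^ lam) := by
        refine setLIntegral_mono' measurableSet_ball.compl fun y hy => ?_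
        rw [mem_compl_iff, mem_ball_zero_iff, not_lt] at hy
        rw [← ENNReal.ofReal_mul (by positivity)]
        refine ENNReal.ofReal_le_ofReal (mul_le_mul_of_nonneg_right ?_
          (Real.rpow_nonneg (hu.nonneg y) _))
        exact Real.rpow_le_rpow_of_nonpos (by norm_num) hy (by linarith)
    _ ≤ ENNReal.ofReal ((1 / 3) ^ (-c)) * ENNReal.ofReal K := by
        rw [lintegral_const_mul' _ _ ENNReal.ofReal_ne_top]
        gcongr
        exact (setLIntegral_le_lintegral _ _).trans hK
    _ = _ := (ENNReal.ofReal_mul (by positivity)).symm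

theorem IsCPSolution.exists_le_rpow_of_lt (hn : 3 ≤ n) (hα0 : 0 < α) (hαn : α < n)
    (hlam : 0 < lam) (hsig0 : 0 ≤ sig) (hsig1 : sig < gAlpha n α lam)
    (hu : IsCPSolution n α lam sig u) (hl : lam < (n : ℝ) / ((n : ℝ) - 2)) :
    ∃ C : ℝ, ∀ x : Euc n, x ≠ 0 → ‖x‖ < 2 / 9 → u x ≤ C * ‖x‖ ^ (-((n : ℝ) - 2)) := by
  have hn' : (3 : ℝ) ≤ n := by exact_mod_cast hn
  obtain ⟨m, hm⟩ : ∃ m : ℝ, m = (n : ℝ) - 2 := ⟨_, rfl⟩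
  have hm0 : 0 < m := by linarith
  have hcond : m * sig < n ∧ m * (sig + lam) < 2 * n - α := by
    rw [gAlpha, if_pos hl, ← hm] at hsig1
    split_ifs at hsig1 with h
    · rw [lt_div_iff₀ hm0] at h hsig1
      constructor <;> nlinarith
    · rw [not_lt, div_le_iff₀ hm0] at h
      rw [lt_sub_iff_add_lt, lt_div_iff₀ hm0] at hsig1
      constructor <;> nlinarith
  rw [← hm, lt_div_iff₀ hm0] at hl
  obtain ⟨hc1, hc2⟩ := hcond
  obtain ⟨β, hβ1, hβ2⟩ : ∃ β, max 0 (α - n + m * lam) < β ∧ β < min α (n - m * sig) :=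
    exists_between (max_lt (lt_min hα0 (by linarith)) (lt_min (by linarith) (by linarith)))
  obtain ⟨hβ0, hβ3⟩ := max_lt_iff.mp hβ1
  obtain ⟨hβα, hβ4⟩ := lt_min_iff.mp hβ2
  have hd : (0 : ℝ) < n - α + 2 := by linarith
  obtain ⟨q, hq1, hq2⟩ : ∃ q, max (max 1 lam) (max ((sig - 1) * n / 2)
      ((sig + lam - 1) * n / (n - α + 2))) < q ∧ q < n / m := by
    refine exists_between (max_lt (max_lt ?_ ?_) (max_lt ?_ ?_))
    · rw [lt_div_iff₀ hm0]; linarith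
    · rw [lt_div_iff₀ hm0]; linarith
    · rw [div_lt_div_iff₀ (by norm_num) hm0]; nlinarith
    · rw [div_lt_div_iff₀ hd hm0]; nlinarith
  obtain ⟨h1, h2⟩ := max_lt_iff.mp hq1
  obtain ⟨hq1', hqlam⟩ := max_lt_iff.mp h1
  obtain ⟨hq3, hq4⟩ := max_lt_iff.mp h2
  have hqm : m * q < n := by
    rw [lt_div_iff₀ hm0] at hq2
    linarith
  have hcrit : sig + max 0 (lam - q * (1 - α / n)) < 1 + 2 * q / n := by
    have hn0 : (0 : ℝ) < n := by linarith
    rw [div_lt_iff₀ (by norm_num)] at hq3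
    rw [div_lt_iff₀ hd] at hq4
    rw [← max_add_add_left]
    refine max_lt ?_ ?_
    · have : sig - 1 < 2 * q / n := by rw [lt_div_iff₀ hn0]; linarith
      linarith
    · have : sig + lam - 1 < q * (n - α + 2) / n := by rw [lt_div_iff₀ hn0]; linarith
      have e : q * (n - α + 2) / n = q * (1 - α / n) + 2 * q / n := by
        field_simp
      linarith
  obtain ⟨K, hK0, hK⟩ := hu.exists_lintegral_rpow_le
  have hP := hu.posSuperharmonic
  obtain ⟨K1, hK10, hK1⟩ := hP.exists_lintegral_weighted_le hn hq1' (hm ▸ hqm) hlam hqlam.le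
    (c := α - β) (by linarith) (by rw [← hm]; linarith) hK0 hK
  obtain ⟨K2, hK20, hK2⟩ := hP.exists_setLIntegral_rpow_le hn hq1' (hm ▸ hqm)
  obtain ⟨C, -, hC⟩ := hP.exists_le_rpow hn (p := (n : ℝ) - 2) hα0 hαn hlam hsig0 hu.lap_le hq1'.le
    hqlam.le hβ0.le hβα.le hK10 hK20 hK1 (by norm_num) hK2 (by rw [← hm]; linarith)
    (by rw [← hm]; linarith) hcrit
  exact ⟨C, hC⟩

theorem gap_of_lt_gAlpha (hn : 3 ≤ n) (hαn : α < n) (hsig0 : 0 ≤ sig)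
    (hsig1 : sig < gAlpha n α lam) (hl : (n : ℝ) / ((n : ℝ) - 2) ≤ lam) :
    0 < 2 - α + n / lam * (1 - sig) := by
  have hn' : (3 : ℝ) ≤ n := by exact_mod_cast hn
  have hm0 : (0 : ℝ) < n - 2 := by linarith
  have hlam : 0 < lam := (div_pos (by linarith) hm0).trans_le hl
  rw [gAlpha, if_neg (not_lt.mpr hl)] at hsig1
  split_ifs at hsig1 with h
  · rw [div_le_iff₀ hm0] at hl
    rw [lt_div_iff₀ hm0] at h hsig1
    have h1 : 2 - α + n / lam * (1 - sig) = ((2 - α) * lam + n * (1 - sig)) / lam := by field_simp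
    rw [h1]
    refine div_pos ?_ hlam
    nlinarith
  · have h2 : sig < 1 - (α - 2) / n * lam := by
      rcases lt_max_iff.mp hsig1 with h | h
      · linarith
      · exact h
    have e : (n : ℝ) / lam * ((α - 2) / n * lam) = α - 2 := by field_simp
    have h3 := mul_lt_mul_of_pos_left h2 (div_pos (by linarith : (0 : ℝ) < n) hlam)
    linarith [h3]

theorem IsCPSolution.exists_le_rpow_of_ge (hn : 3 ≤ n) (hα0 : 0 < α) (hαn : α < n)
    (hsig0 : 0 ≤ sig) (hl : (n : ℝ) / ((n : ℝ) - 2) ≤ lam)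
    (hgap : 0 < 2 - α + n / lam * (1 - sig)) (hu : IsCPSolution n α lam sig u) :
    ∃ C : ℝ, 0 ≤ C ∧ ∀ x : Euc n, x ≠ 0 → ‖x‖ < 1 → u x ≤ C * ‖x‖ ^ (-(n / lam)) := by
  have hn' : (3 : ℝ) ≤ n := by exact_mod_cast hn
  have hm0 : (0 : ℝ) < n - 2 := by linarith
  have hlam1 : 1 ≤ lam := by
    refine le_trans ?_ hl
    rw [le_div_iff₀ hm0]
    linarith
  have hlam : 0 < lam := by linarith
  have hP := hu.posSuperharmonic
  obtain ⟨K, hK0, hK⟩ := hu.exists_lintegral_rpow_le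
  have hn0 : (0 : ℝ) < n := by linarith
  refine hP.exists_le_rpow hn (q := lam) (β := α) (K1 := K) (K2 := K) hα0 hαn hlam hsig0 hu.lap_le
    hlam1 le_rfl hα0.le le_rfl hK0 hK0 (by simpa using hK) le_rfl ?_ (by linarith) ?_ ?_
  · intro x _ _
    rw [div_mul_cancel₀ _ hlam.ne', sub_self, Real.rpow_zero, mul_one]
    exact (setLIntegral_le_lintegral _ _).trans hK
  · rw [div_mul_cancel₀ _ hlam.ne']
    linarith
  · rw [max_eq_right (by
      have : 0 ≤ lam * (α / n) := by positivity
      linarith)]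
    have h1 := mul_pos hgap (div_pos hlam hn0)
    have e : (2 - α + n / lam * (1 - sig)) * (lam / n) =
      2 * lam / n - lam * (α / n) + (1 - sig) := by field_simp
    linarith

end InitialBounds

section RemovableGreen
variable {n : ℕ}

theorem abs_lap_le (F : Euc n → ℝ) (x : Euc n) : |lap F x| ≤ n * ‖iteratedFDeriv ℝ 2 F x‖ := by
  unfold lap
  refine (Finset.abs_sum_le_sum_abs _ _).trans ?_
  calc _ ≤ ∑ _i : Fin n, ‖iteratedFDeriv ℝ 2 F x‖ := by
        refine Finset.sum_le_sum fun i _ => ?_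
        refine ((iteratedFDeriv ℝ 2 F x).le_opNorm _).trans ?_
        simp [Fin.prod_univ_two]
    _ = _ := by simp

theorem lap_sub {f g : Euc n → ℝ} {x : Euc n} (hf : ContDiffAt ℝ 2 f x) (hg : ContDiffAt ℝ 2 g x) :
    lap (fun y => f y - g y) x = lap f x - lap g x := by
  unfold lap
  rw [← Finset.sum_sub_distrib]
  refine Finset.sum_congr rfl fun i _ => ?_
  rw [show (fun y => f y - g y) = f - g from rfl, iteratedFDeriv_sub_apply hf hg]
  rfl

/-- A cutoff function on `ℝⁿ`, equal to one near the origin. -/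
theorem exists_ball_cutoff : ∃ η : Euc n → ℝ, ContDiff ℝ 2 η ∧ (∀ x, ‖x‖ ≤ 1 / 2 → η x = 1) ∧
    (∀ x, 7 / 8 ≤ ‖x‖ → η x = 0) ∧ (∀ x, 0 ≤ η x) ∧ ∀ x, η x ≤ 1 := by
  obtain ⟨χ, hχ, χ1, χ0, χnn, χle, -⟩ := exists_cutoff
  refine ⟨fun x => χ (‖x‖ ^ 2), hχ.comp (contDiff_norm_sq ℝ), fun x hx => χ1 _ ?_,
    fun x hx => χ0 _ ?_, fun x => χnn _, fun x => χle _⟩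
  · nlinarith [norm_nonneg x]
  · nlinarith [norm_nonneg x]

theorem hasCompactSupport_of_zero_of_le {η : Euc n → ℝ} {r : ℝ} (h : ∀ x, r ≤ ‖x‖ → η x = 0) :
    HasCompactSupport η :=
  HasCompactSupport.intro (isCompact_closedBall (0 : Euc n) r) fun x hx => h x (by
    rw [mem_closedBall_zero_iff, not_le] at hx
    exact hx.le)

theorem exists_abs_lap_scaled_cutoff_mul_le {η k : Euc n → ℝ} (hη : ContDiff ℝ 2 η)
    (hηc : HasCompactSupport η) (hk : ContDiff ℝ 2 k) :
    ∃ M : ℝ, 0 ≤ M ∧ ∀ δ, 0 < δ → δ ≤ 1 → ∀ y : Euc n, ‖y‖ ≤ 1 →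
      |lap (fun y => η (δ⁻¹ • y) * k y) y| ≤ M * (δ ^ 2)⁻¹ := by
  have h1 : ∀ i : ℕ, i ≤ 2 → ∃ M : ℝ, ∀ x, ‖iteratedFDeriv ℝ i η x‖ ≤ M := fun i hi =>
    (hηc.iteratedFDeriv i).exists_bound_of_continuous (hη.continuous_iteratedFDeriv
      (by exact_mod_cast hi))
  have h2 : ∀ i : ℕ, i ≤ 2 → ∃ M : ℝ, ∀ x ∈ closedBall (0 : Euc n) 1, ‖iteratedFDeriv ℝ i k x‖ ≤ M :=
    fun i hi => (isCompact_closedBall _ _).exists_bound_of_continuousOn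
      (hk.continuous_iteratedFDeriv (by exact_mod_cast hi)).continuousOn
  obtain ⟨a0, ha0⟩ := h1 0 (by norm_num)
  obtain ⟨a1, ha1⟩ := h1 1 (by norm_num)
  obtain ⟨a2, ha2⟩ := h1 2 (by norm_num)
  obtain ⟨b0, hb0⟩ := h2 0 (by norm_num)
  obtain ⟨b1, hb1⟩ := h2 1 (by norm_num)
  obtain ⟨b2, hb2⟩ := h2 2 (by norm_num)
  have h0 : (0 : Euc n) ∈ closedBall (0 : Euc n) 1 := by simp
  have a0p : 0 ≤ a0 := (norm_nonneg _).trans (ha0 0)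
  have a1p : 0 ≤ a1 := (norm_nonneg _).trans (ha1 0)
  have a2p : 0 ≤ a2 := (norm_nonneg _).trans (ha2 0)
  have b0p : 0 ≤ b0 := (norm_nonneg _).trans (hb0 0 h0)
  have b1p : 0 ≤ b1 := (norm_nonneg _).trans (hb1 0 h0)
  have b2p : 0 ≤ b2 := (norm_nonneg _).trans (hb2 0 h0)
  refine ⟨n * (a0 * b2 + 2 * a1 * b1 + a2 * b0), by positivity, fun δ hδ hδ1 y hy => ?_⟩
  have hs : ContDiff ℝ 2 (fun y : Euc n => η (δ⁻¹ • y)) := hη.comp (by fun_prop)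
  have hy' : y ∈ closedBall (0 : Euc n) 1 := mem_closedBall_zero_iff.mpr hy
  have hδi : 1 ≤ δ⁻¹ := (one_le_inv₀ hδ).mpr hδ1
  refine (abs_lap_le _ _).trans ?_
  rw [mul_assoc]
  refine mul_le_mul_of_nonneg_left ?_ (Nat.cast_nonneg n)
  refine (norm_iteratedFDeriv_mul_le hs hk y (n := 2) le_rfl).trans ?_
  have hD : ∀ i : ℕ, i ≤ 2 → ‖iteratedFDeriv ℝ i (fun y : Euc n => η (δ⁻¹ • y)) y‖ =
      δ⁻¹ ^ i * ‖iteratedFDeriv ℝ i η (δ⁻¹ • y)‖ := fun i hi => by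
    rw [iteratedFDeriv_comp_const_smul _ (hη.of_le (by exact_mod_cast hi)), norm_smul, norm_pow,
      Real.norm_of_nonneg (by positivity)]
  rw [Finset.sum_range_succ, Finset.sum_range_succ, Finset.sum_range_one, hD 0 (by norm_num),
    hD 1 (by norm_num), hD 2 (by norm_num)]
  have e1 : 1 ≤ δ⁻¹ ^ 2 := one_le_pow₀ hδi
  have e2 : δ⁻¹ ≤ δ⁻¹ ^ 2 := le_self_pow₀ hδi (by norm_num)
  norm_num only [Nat.choose_zero_right, Nat.choose_self, Nat.choose_one_right, pow_zero, pow_one,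
    one_mul, Nat.cast_one, Nat.cast_ofNat, Nat.choose]
  calc _ ≤ δ⁻¹ ^ 2 * a0 * b2 + 2 * (δ⁻¹ ^ 2 * a1) * b1 + δ⁻¹ ^ 2 * a2 * b0 := by
        gcongr
        · exact (ha0 _).trans (le_mul_of_one_le_left a0p e1)
        · exact hb2 _ hy'
        · exact ha1 _
        · exact hb1 _ hy'
        · exact ha2 _
        · exact hb0 _ hy'
    _ = _ := by
        rw [inv_pow]
        ring

theorem integrable_mul_of_tsupport {W g : Euc n → ℝ} {S : Set (Euc n)} (hS : IsCompact S)
    (hW : Integrable W) (h0 : ∀ x ∉ S, W x = 0) (hg : Continuous g) :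
    Integrable fun x => W x * g x := by
  obtain ⟨B, hB⟩ := hS.exists_bound_of_continuousOn hg.continuousOn
  refine Integrable.mono' (hW.norm.const_mul B)
    (hW.aestronglyMeasurable.mul hg.aestronglyMeasurable) (Eventually.of_forall fun x => ?_)
  by_cases hx : x ∈ S
  · rw [norm_mul, mul_comm]
    exact mul_le_mul_of_nonneg_right (hB x hx) (norm_nonneg _)
  · simp [h0 x hx]

/-- The Green identity for a function with a point singularity that is negligible at scale `δ²`. -/
theorem green_of_singular (hn : 0 < n) {W k : Euc n → ℝ} (hW : ∀ x, x ≠ 0 → ContDiffAt ℝ 2 W x)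
    (hWc : HasCompactSupport W) (hk : ContDiff ℝ 2 k) (hWi : Integrable W)
    (hLi : Integrable (lap W))
    (hδ : Tendsto (fun δ : ℝ => (δ ^ 2)⁻¹ * ∫ y in ball 0 δ, ‖W y‖) (𝓝[>] 0) (𝓝 0)) :
    ∫ y, W y * lap k y = ∫ y, k y * lap W y := by
  obtain ⟨η, hη, η1, η0, ηnn, ηle⟩ := exists_ball_cutoff (n := n)
  have hηc := hasCompactSupport_of_zero_of_le η0
  obtain ⟨M, hM0, hM⟩ := exists_abs_lap_scaled_cutoff_mul_le hη hηc hk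
  have hlk : Continuous (lap k) := continuous_iff_continuousAt.mpr fun x =>
    continuousAt_lap hk.contDiffAt
  have hs : ∀ δ : ℝ, ContDiff ℝ 2 (fun y : Euc n => η (δ⁻¹ • y) * k y) := fun δ =>
    (hη.comp (by fun_prop)).mul hk
  have hi1 : Integrable fun y => W y * lap k y :=
    integrable_mul_of_tsupport hWc hWi (fun x hx => image_eq_zero_of_notMem_tsupport hx) hlk
  have hi2 : Integrable fun y => lap W y * k y :=
    integrable_mul_of_tsupport hWc hLi (fun x hx => lap_eq_zero_of_notMem_tsupport hx) hk.continuous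
  -- the Green identity away from the singularity
  have hG : ∀ δ : ℝ, 0 < δ → ∫ y, W y * lap (fun y => k y - η (δ⁻¹ • y) * k y) y =
      ∫ y, (k y - η (δ⁻¹ • y) * k y) * lap W y := by
    intro δ hδ0
    refine green (hk.sub (hs δ)) (fun x hx => hW x ?_) (Or.inr hWc)
    rintro rfl
    refine notMem_tsupport_iff_eventuallyEq.mpr ?_ hx
    have : ∀ᶠ y : Euc n in 𝓝 0, ‖δ⁻¹ • y‖ < 1 / 2 := by
      have hc : ContinuousAt (fun y : Euc n => ‖δ⁻¹ • y‖) 0 := by fun_prop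
      refine hc.eventually_lt continuousAt_const ?_
      simp
    filter_upwards [this] with y hy
    rw [η1 _ hy.le]
    simp
  -- the right-hand side
  have hR : Tendsto (fun δ : ℝ => ∫ y, (k y - η (δ⁻¹ • y) * k y) * lap W y) (𝓝[>] 0)
      (𝓝 (∫ y, k y * lap W y)) := by
    refine tendsto_integral_filter_of_dominated_convergence (fun y => ‖lap W y * k y‖) ?_ ?_
      hi2.norm ?_
    · refine Eventually.of_forall fun δ => ?_
      exact (hk.continuous.sub (hs δ).continuous).aestronglyMeasurable.mul hLi.aestronglyMeasurable
    · refine Eventually.of_forall fun δ => Eventually.of_forall fun y => ?_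
      rw [show (k y - η (δ⁻¹ • y) * k y) * lap W y = (1 - η (δ⁻¹ • y)) * (lap W y * k y) by ring,
        norm_mul]
      refine mul_le_of_le_one_left (norm_nonneg _) ?_
      rw [Real.norm_of_nonneg (by linarith [ηle (δ⁻¹ • y)])]
      linarith [ηnn (δ⁻¹ • y)]
    · filter_upwards [ae_ne_point hn (0 : Euc n)] with y hy
      have hy0 := norm_pos_iff.mpr hy
      refine tendsto_const_nhds.congr' ?_
      filter_upwards [self_mem_nhdsWithin, nhdsWithin_le_nhds (eventually_lt_nhds hy0)] with δ h1 h2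
      rw [η0, zero_mul, sub_zero]
      rw [norm_smul, norm_inv, Real.norm_of_nonneg (le_of_lt h1)]
      have : 1 ≤ δ⁻¹ * ‖y‖ := by
        rw [inv_mul_eq_div, le_div_iff₀ h1]
        linarith
      linarith
  -- the left-hand side
  have hL : Tendsto (fun δ : ℝ => ∫ y, W y * lap (fun y => k y - η (δ⁻¹ • y) * k y) y) (𝓝[>] 0)
      (𝓝 (∫ y, W y * lap k y)) := by
    rw [tendsto_iff_norm_sub_tendsto_zero]
    have hδ' := hδ.const_mul M
    rw [mul_zero] at hδ'
    refine squeeze_zero' (Eventually.of_forall fun _ => norm_nonneg _) ?_ hδ'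
    filter_upwards [self_mem_nhdsWithin, nhdsWithin_le_nhds (eventually_lt_nhds one_pos)] with δ h1 h2
    have h1 : 0 < δ := h1
    have e : ∀ y, W y * lap (fun y => k y - η (δ⁻¹ • y) * k y) y =
        W y * lap k y - W y * lap (fun y => η (δ⁻¹ • y) * k y) y := fun y => by
      rw [lap_sub hk.contDiffAt (hs δ).contDiffAt, mul_sub]
    have hi3 : Integrable fun y => W y * lap (fun y => η (δ⁻¹ • y) * k y) y :=
      integrable_mul_of_tsupport hWc hWi (fun x hx => image_eq_zero_of_notMem_tsupport hx)
        (continuous_iff_continuousAt.mpr fun x => continuousAt_lap (hs δ).contDiffAt)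
    simp_rw [e]
    have e2 : ∫ y, (W y * lap k y - W y * lap (fun y => η (δ⁻¹ • y) * k y) y) =
      (∫ y, W y * lap k y) - ∫ y, W y * lap (fun y => η (δ⁻¹ • y) * k y) y := integral_sub hi1 hi3
    rw [e2, sub_sub_cancel_left, norm_neg]
    rw [← setIntegral_eq_integral_of_forall_compl_eq_zero (s := ball (0 : Euc n) δ)
      (fun y hy => by
        rw [mem_ball_zero_iff, not_lt] at hy
        rw [lap_eq_zero_of_notMem_tsupport, mul_zero]
        refine notMem_tsupport_iff_eventuallyEq.mpr ?_
        have : ∀ᶠ z : Euc n in 𝓝 y, 7 / 8 < ‖δ⁻¹ • z‖ := by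
          have hc : ContinuousAt (fun y : Euc n => ‖δ⁻¹ • y‖) y := by fun_prop
          refine continuousAt_const.eventually_lt hc ?_
          rw [norm_smul, norm_inv, Real.norm_of_nonneg h1.le]
          have : 1 ≤ δ⁻¹ * ‖y‖ := by
            rw [inv_mul_eq_div, le_div_iff₀ h1]
            linarith
          linarith
        filter_upwards [this] with z hz
        rw [η0 _ hz.le]
        simp)]
    calc _ ≤ ∫ y in ball (0 : Euc n) δ, M * (δ ^ 2)⁻¹ * ‖W y‖ := by
          refine norm_integral_le_of_norm_le (hWi.norm.const_mul _).integrableOn ?_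
          refine (ae_restrict_iff' measurableSet_ball).mpr (Eventually.of_forall fun y hy => ?_)
          rw [mem_ball_zero_iff] at hy
          rw [norm_mul, mul_comm]
          exact mul_le_mul_of_nonneg_right (hM δ h1 h2.le y (by linarith)) (norm_nonneg _)
      _ = _ := by
          rw [integral_const_mul, mul_assoc]
  refine tendsto_nhds_unique hL (hR.congr' ?_)
  filter_upwards [self_mem_nhdsWithin] with δ h1
  exact (hG δ h1).symm

end RemovableGreen

section NewtonRepresentation
variable {n : ℕ} {u : Euc n → ℝ}

theorem aestronglyMeasurable_of_continuousOn_compl (hn : 0 < n) {f : Euc n → ℝ} {z : Euc n}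
    (hf : ContinuousOn f {z}ᶜ) : AEStronglyMeasurable f := by
  have := hf.aestronglyMeasurable (μ := volume) (measurableSet_singleton z).compl
  rwa [Measure.restrict_eq_self_of_ae_mem] at this
  filter_upwards [ae_ne_point hn z] with y hy using hy

theorem tendsto_volume_ball_zero (hn : 0 < n) :
    Tendsto (fun δ : ℝ => volume (ball (0 : Euc n) δ)) (𝓝[>] 0) (𝓝 0) := by
  obtain ⟨C, -, hC⟩ := exists_volume_ball_le hn
  have h1 : Tendsto (fun δ : ℝ => ENNReal.ofReal (C * δ ^ (n : ℝ))) (𝓝[>] 0) (𝓝 0) := by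
    rw [← ENNReal.ofReal_zero]
    refine (ENNReal.continuous_ofReal.tendsto _).comp ?_
    have h2 : Tendsto (fun δ : ℝ => C * δ ^ n) (𝓝 0) (𝓝 (C * 0 ^ n)) :=
      (continuous_const.mul (continuous_pow n)).tendsto 0
    rw [zero_pow hn.ne', mul_zero] at h2
    simp_rw [Real.rpow_natCast]
    exact h2.mono_left nhdsWithin_le_nhds
  refine tendsto_of_tendsto_of_tendsto_of_le_of_le' tendsto_const_nhds h1
    (Eventually.of_forall fun _ => bot_le) ?_
  filter_upwards [self_mem_nhdsWithin] with δ hδ using hC 0 δ hδ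

theorem tendsto_inv_sq_mul_setIntegral_ball (hn : 3 ≤ n) {lam : ℝ}
    (hl : (n : ℝ) / ((n : ℝ) - 2) ≤ lam) (hu : ∀ x, 0 ≤ u x)
    (hulam : Integrable fun y => u y ^ lam) {W : Euc n → ℝ} (hW : ∀ x, ‖W x‖ ≤ u x) :
    Tendsto (fun δ : ℝ => (δ ^ 2)⁻¹ * ∫ y in ball 0 δ, ‖W y‖) (𝓝[>] 0) (𝓝 0) := by
  have hn' : (3 : ℝ) ≤ n := by exact_mod_cast hn
  have hm0 : (0 : ℝ) < n - 2 := by linarith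
  have hl' : (n : ℝ) ≤ lam * (n - 2) := (div_le_iff₀ hm0).mp hl
  have hlam1 : 1 ≤ lam := by nlinarith
  obtain ⟨C, hC0, hC⟩ := exists_volume_ball_le (n := n) (by omega)
  have key : ∀ τ δ : ℝ, 0 < τ → 0 < δ → δ ≤ 1 → (δ ^ 2)⁻¹ * ∫ y in ball (0 : Euc n) δ, ‖W y‖ ≤
      τ * C + τ ^ (1 - lam) * ∫ y in ball (0 : Euc n) δ, u y ^ lam := by
    intro τ δ hτ hδ hδ1
    set T := τ * δ ^ (-((n : ℝ) - 2)) with hT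
    have hT0 : 0 < T := by positivity
    have hvol : volume.real (ball (0 : Euc n) δ) ≤ C * δ ^ (n : ℝ) :=
      ENNReal.toReal_le_of_le_ofReal (by positivity) (hC 0 δ hδ)
    have hci : IntegrableOn (fun _ => T) (ball (0 : Euc n) δ) :=
      integrableOn_const measure_ball_lt_top.ne
    have hi : IntegrableOn (fun y => T ^ (1 - lam) * u y ^ lam) (ball (0 : Euc n) δ) :=
      (hulam.const_mul _).integrableOn
    have hI0 : 0 ≤ ∫ y in ball (0 : Euc n) δ, u y ^ lam :=
      integral_nonneg fun y => Real.rpow_nonneg (hu y) _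
    have h1 : ∫ y in ball (0 : Euc n) δ, ‖W y‖ ≤
        T * (C * δ ^ (n : ℝ)) + T ^ (1 - lam) * ∫ y in ball (0 : Euc n) δ, u y ^ lam := by
      calc _ ≤ ∫ y in ball (0 : Euc n) δ, (T + T ^ (1 - lam) * u y ^ lam) :=
            integral_mono_of_nonneg (Eventually.of_forall fun _ => norm_nonneg _) (hci.add hi)
              (Eventually.of_forall fun y => (hW y).trans (le_add_rpow_mul_rpow hT0 (hu y) hlam1))
        _ = (∫ y in ball (0 : Euc n) δ, T) + ∫ y in ball (0 : Euc n) δ, T ^ (1 - lam) * u y ^ lam :=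
            integral_add hci hi
        _ ≤ _ := by
            have e : ∫ y in ball (0 : Euc n) δ, T ^ (1 - lam) * u y ^ lam =
              T ^ (1 - lam) * ∫ y in ball (0 : Euc n) δ, u y ^ lam := integral_const_mul _ _
            rw [e, setIntegral_const, smul_eq_mul, mul_comm (volume.real _)]
            exact add_le_add (mul_le_mul_of_nonneg_left hvol hT0.le) le_rfl
    have h2 : (δ ^ 2)⁻¹ * (T * (C * δ ^ (n : ℝ))) = τ * C := by
      have e : (δ ^ 2)⁻¹ * δ ^ (-((n : ℝ) - 2)) * δ ^ (n : ℝ) = 1 := by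
        rw [← Real.rpow_natCast δ 2, ← Real.rpow_neg hδ.le, ← Real.rpow_add hδ, ← Real.rpow_add hδ]
        push_cast
        ring_nf
        exact Real.rpow_zero δ
      calc _ = τ * C * ((δ ^ 2)⁻¹ * δ ^ (-((n : ℝ) - 2)) * δ ^ (n : ℝ)) := by rw [hT]; ring
        _ = _ := by rw [e, mul_one]
    have h3 : (δ ^ 2)⁻¹ * T ^ (1 - lam) ≤ τ ^ (1 - lam) := by
      rw [hT, Real.mul_rpow hτ.le (by positivity), ← Real.rpow_mul hδ.le, mul_left_comm]
      refine mul_le_of_le_one_right (by positivity) ?_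
      rw [← Real.rpow_natCast δ 2, ← Real.rpow_neg hδ.le, ← Real.rpow_add hδ]
      refine Real.rpow_le_one hδ.le hδ1 ?_
      push_cast
      nlinarith
    calc _ ≤ (δ ^ 2)⁻¹ * (T * (C * δ ^ (n : ℝ)) +
          T ^ (1 - lam) * ∫ y in ball (0 : Euc n) δ, u y ^ lam) := by gcongr
      _ = τ * C + (δ ^ 2)⁻¹ * T ^ (1 - lam) * ∫ y in ball (0 : Euc n) δ, u y ^ lam := by
          rw [mul_add, h2, mul_assoc]
      _ ≤ _ := by gcongr
  have hlim : Tendsto (fun δ : ℝ => ∫ y in ball (0 : Euc n) δ, u y ^ lam) (𝓝[>] 0) (𝓝 0) :=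
    hulam.tendsto_setIntegral_nhds_zero (tendsto_volume_ball_zero (by omega))
  refine Metric.tendsto_nhds.mpr fun e he => ?_
  obtain ⟨τ, hτ0, hτ⟩ : ∃ τ : ℝ, 0 < τ ∧ τ * C < e / 2 := by
    refine ⟨e / (2 * (C + 1)), by positivity, ?_⟩
    rw [div_mul_eq_mul_div, div_lt_div_iff₀ (by positivity) (by norm_num)]
    nlinarith
  have h4 := hlim.const_mul (τ ^ (1 - lam))
  rw [mul_zero] at h4
  filter_upwards [self_mem_nhdsWithin, nhdsWithin_le_nhds (eventually_lt_nhds one_pos),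
    h4.eventually_lt_const (half_pos he)] with δ h1 h2 h3
  have h1 : 0 < δ := h1
  rw [dist_zero_right, Real.norm_of_nonneg
    (mul_nonneg (by positivity) (integral_nonneg fun _ => norm_nonneg _))]
  linarith [key τ δ hτ0 h1 h2.le]

theorem PosSuperharmonic.exists_representation (hn : 3 ≤ n) (hu : PosSuperharmonic u) {lam : ℝ}
    (hl : (n : ℝ) / ((n : ℝ) - 2) ≤ lam) (hulam : Integrable fun y => u y ^ lam) :
    ∃ W : Euc n → ℝ, (∀ x, ‖x‖ ≤ 1 / 2 → W x = u x) ∧ (∀ x, x ≠ 0 → ContDiffAt ℝ 2 W x) ∧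
      Integrable (lap W) ∧ (∀ x, 1 ≤ ‖x‖ → lap W x = 0) ∧
      (∀ x, x ≠ 0 → ‖x‖ < 1 / 2 → lap W x = lap u x) ∧
      ∀ x, x ≠ 0 → Tendsto (fun ε : ℝ => ∫ y, regKernel n ε (‖y - x‖ ^ 2) * -lap W y) (𝓝[>] 0)
        (𝓝 (newtonConst n * W x)) := by
  have hn' : (3 : ℝ) ≤ n := by exact_mod_cast hn
  have hn0 : 0 < n := by omega
  have hm0 : (0 : ℝ) < n - 2 := by linarith
  have hl' : (n : ℝ) ≤ lam * (n - 2) := (div_le_iff₀ hm0).mp hl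
  have hlam1 : 1 ≤ lam := by nlinarith
  obtain ⟨η, hη, η1, η0, ηnn, ηle⟩ := exists_ball_cutoff (n := n)
  set W : Euc n → ℝ := fun x => η x * u x with hWdef
  have hW1 : ∀ x, ‖x‖ ≤ 1 / 2 → W x = u x := fun x hx => by simp [hWdef, η1 x hx]
  have hWz : ∀ x, 7 / 8 ≤ ‖x‖ → W x = 0 := fun x hx => by simp [hWdef, η0 x hx]
  have hWC : ∀ x, x ≠ 0 → ContDiffAt ℝ 2 W x := fun x hx => hη.contDiffAt.mul (hu.contDiffAt x hx)
  have hWc : HasCompactSupport W := hasCompactSupport_of_zero_of_le hWz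
  have hWu : ∀ x, ‖W x‖ ≤ u x := fun x => by
    rw [Real.norm_of_nonneg (mul_nonneg (ηnn x) (hu.nonneg x))]
    exact mul_le_of_le_one_left (hu.nonneg x) (ηle x)
  have hWm : AEStronglyMeasurable W := aestronglyMeasurable_of_continuousOn_compl hn0 (z := 0)
    fun x hx => (hWC x hx).continuousAt.continuousWithinAt
  have hLc : ContinuousOn (lap W) {0}ᶜ := fun x hx =>
    (continuousAt_lap (hWC x hx)).continuousWithinAt
  have hWi : Integrable W := by
    have h1 : IntegrableOn (fun y => 1 + u y ^ lam) (closedBall (0 : Euc n) 1) :=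
      (integrableOn_const (isCompact_closedBall _ _).measure_lt_top.ne).add hulam.integrableOn
    refine (integrableOn_iff_integrable_of_support_subset (s := closedBall (0 : Euc n) 1) ?_).mp
      (Integrable.mono' h1 hWm.restrict (Eventually.of_forall fun y => (hWu y).trans ?_))
    · refine Function.support_subset_iff'.mpr fun x hx => hWz x ?_
      rw [mem_closedBall_zero_iff, not_le] at hx
      linarith
    · simpa using le_add_rpow_mul_rpow one_pos (hu.nonneg y) hlam1
  have hLu : ∀ x, x ≠ 0 → ‖x‖ < 1 / 2 → lap W x = lap u x := by
    intro x _ hx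
    refine lap_congr ?_
    filter_upwards [continuous_norm.continuousAt.eventually_lt continuousAt_const hx] with y hy
    exact hW1 y (le_of_lt hy)
  have hL0 : ∀ x, 1 ≤ ‖x‖ → lap W x = 0 := by
    intro x hx
    refine lap_eq_zero_of_notMem_tsupport (notMem_tsupport_iff_eventuallyEq.mpr ?_)
    filter_upwards [continuousAt_const.eventually_lt continuous_norm.continuousAt
      (show (7 / 8 : ℝ) < ‖x‖ by linarith)] with y hy
    exact hWz y (le_of_lt hy)
  have hLm : AEStronglyMeasurable (lap W) := aestronglyMeasurable_of_continuousOn_compl hn0 hLc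
  have hLi : Integrable (lap W) := by
    obtain ⟨M, -, hM, -⟩ := hu.exists_bounds hn
    have h1 : IntegrableOn (lap W) (ball 0 (1 / 2)) := by
      refine ⟨hLm.restrict, ?_⟩
      refine lt_of_le_of_lt ?_ (hM.trans_lt ENNReal.ofReal_lt_top)
      refine setLIntegral_mono_ae' measurableSet_ball ?_
      filter_upwards [ae_ne_point hn0 (0 : Euc n)] with y hy0 hy
      rw [mem_ball_zero_iff] at hy
      rw [hLu y hy0 hy, ← enorm_neg, Real.enorm_of_nonneg]
      exact hu.neg_lap_nonneg y ⟨mem_ball_zero_iff.mpr (by linarith), hy0⟩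
    have hKc : IsCompact {x : Euc n | 1 / 2 ≤ ‖x‖ ∧ ‖x‖ ≤ 1} := by
      refine (isCompact_closedBall (0 : Euc n) 1).of_isClosed_subset
        (isClosed_Icc.preimage continuous_norm) fun x hx => mem_closedBall_zero_iff.mpr hx.2
    have h2 : IntegrableOn (lap W) {x : Euc n | 1 / 2 ≤ ‖x‖ ∧ ‖x‖ ≤ 1} := by
      refine ContinuousOn.integrableOn_compact hKc (hLc.mono fun x hx => ?_)
      rintro rfl
      have := hx.1
      rw [norm_zero] at this
      norm_num at this
    refine (integrableOn_iff_integrable_of_support_subset ?_).mp (h1.union h2)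
    refine Function.support_subset_iff'.mpr fun x hx => hL0 x ?_
    simp only [mem_union, mem_ball_zero_iff, mem_ofPred_eq, not_or, not_lt, not_and, not_le] at hx
    exact (hx.2 hx.1).le
  refine ⟨W, hW1, hWC, hLi, hL0, hLu, fun x hx => ?_⟩
  have hδ := tendsto_inv_sq_mul_setIntegral_ball hn hl hu.nonneg hulam hWu
  refine (tendsto_integral_mul_regularised hWi (hWC x hx).continuousAt).congr' ?_
  filter_upwards [self_mem_nhdsWithin] with ε hε
  have := green_of_singular hn0 hWC hWc (contDiff_regKernel hε x) hWi hLi hδ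
  simp_rw [lap_regKernel hε] at this
  simp_rw [mul_neg, integral_neg] at this ⊢
  rw [← this, neg_neg]

end NewtonRepresentation

section Bootstrap
variable {n : ℕ} {u : Euc n → ℝ}

theorem exists_lintegral_weighted_le_of_le_rpow (hn : 0 < n) (hu : ∀ x, 0 ≤ u x)
    {c p lam C K : ℝ} (hlam : 0 < lam) (hc : 0 ≤ c) (hC : 0 ≤ C)
    (hup : ∀ x : Euc n, x ≠ 0 → ‖x‖ < 1 → u x ≤ C * ‖x‖ ^ (-p)) (hK0 : 0 ≤ K)
    (hK : ∫⁻ y, ENNReal.ofReal (u y ^ lam) ≤ ENNReal.ofReal K) (hcp : c = 0 ∨ c + p * lam < n) :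
    ∃ K' : ℝ, 0 ≤ K' ∧ ∫⁻ y, ENNReal.ofReal (‖y‖ ^ (-c) * u y ^ lam) ≤ ENNReal.ofReal K' := by
  rcases hcp with rfl | hcp
  · exact ⟨K, hK0, by simpa using hK⟩
  obtain ⟨C1, hC10, hC1⟩ := exists_setLIntegral_ball_rpow_le hn hcp
  refine ⟨C ^ lam * C1 + K, by positivity, ?_⟩
  rw [← lintegral_add_compl _ (measurableSet_ball (x := (0 : Euc n)) (ε := 1)),
    ENNReal.ofReal_add (by positivity) hK0]
  refine add_le_add ?_ ?_
  · calc _ ≤ ∫⁻ y in ball (0 : Euc n) 1, ENNReal.ofReal (C ^ lam) *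
          ENNReal.ofReal (‖y - 0‖ ^ (-(c + p * lam))) := by
          refine setLIntegral_mono_ae' measurableSet_ball ?_
          filter_upwards [ae_ne_point hn (0 : Euc n)] with y hy0 hy
          rw [mem_ball_zero_iff] at hy
          have hy0' := norm_pos_iff.mpr hy0
          rw [← ENNReal.ofReal_mul (by positivity), sub_zero]
          refine ENNReal.ofReal_le_ofReal ?_
          calc _ ≤ ‖y‖ ^ (-c) * (C * ‖y‖ ^ (-p)) ^ lam := by
                refine mul_le_mul_of_nonneg_left ?_ (by positivity)
                exact Real.rpow_le_rpow (hu y) (hup y hy0 hy) hlam.le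
            _ = C ^ lam * (‖y‖ ^ (-c) * ‖y‖ ^ (-p * lam)) := by
                rw [Real.mul_rpow hC (by positivity), ← Real.rpow_mul hy0'.le]
                ring
            _ = _ := by
                rw [← Real.rpow_add hy0']
                congr 2
                ring
      _ ≤ ENNReal.ofReal (C ^ lam) * ENNReal.ofReal (C1 * 1 ^ (n - (c + p * lam))) := by
          rw [lintegral_const_mul' _ _ ENNReal.ofReal_ne_top]
          exact mul_le_mul' le_rfl (hC1 0 1 one_pos)
      _ = _ := by
          rw [Real.one_rpow, mul_one, ENNReal.ofReal_mul (by positivity)]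
  · refine le_trans ?_ ((setLIntegral_le_lintegral (ball (0 : Euc n) 1)ᶜ _).trans hK)
    refine setLIntegral_mono' measurableSet_ball.compl fun y hy => ?_
    rw [mem_compl_iff, mem_ball_zero_iff, not_lt] at hy
    refine ENNReal.ofReal_le_ofReal (mul_le_of_le_one_left (Real.rpow_nonneg (hu y) _) ?_)
    exact Real.rpow_le_one_of_one_le_of_nonpos hy (by linarith)

theorem exists_rieszPotential_le_rpow (hn : 0 < n) (hu : ∀ x, 0 ≤ u x)
    {α p j lam C K : ℝ} (hαn : α < n) (hlam : 0 < lam) (hj0 : 0 ≤ j) (hjα : j ≤ α)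
    (hp : 0 ≤ p) (hj : α + p * lam - n ≤ j) (hj' : j = α ∨ α - j + p * lam < n) (hC : 0 ≤ C)
    (hup : ∀ x : Euc n, x ≠ 0 → ‖x‖ < 1 → u x ≤ C * ‖x‖ ^ (-p)) (hK0 : 0 ≤ K)
    (hK : ∫⁻ y, ENNReal.ofReal (u y ^ lam) ≤ ENNReal.ofReal K) :
    ∃ C' : ℝ, 0 ≤ C' ∧ ∀ x : Euc n, x ≠ 0 → ‖x‖ < 1 / 2 →
      rieszPotential α lam u x ≤ ENNReal.ofReal (C' * ‖x‖ ^ (-j)) := by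
  obtain ⟨K1, hK10, hK1⟩ := exists_lintegral_weighted_le_of_le_rpow hn hu hlam (c := α - j)
    (by linarith) hC hup hK0 hK (hj'.imp_left fun h => by linarith)
  obtain ⟨C1, hC10, hC1⟩ := exists_setLIntegral_ball_rpow_le hn hαn
  refine ⟨(C ^ lam * C1 + 2 ^ j * 6 ^ (α - j) * K1) * 2 ^ j, by positivity, fun x hx hx1 => ?_⟩
  have hx0 := norm_pos_iff.mpr hx
  obtain ⟨r, hrdef⟩ : ∃ r, r = ‖x‖ / 2 := ⟨_, rfl⟩
  have hr : 0 < r := by rw [hrdef]; positivity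
  have hxr : ‖x‖ = 2 * r := by rw [hrdef]; ring
  have h1 := rieszPotential_le_near_add_far hn hu hj0 hjα hK1 hr hxr (y := x)
    (by rw [sub_self, norm_zero]; positivity)
  have h2 : ∫⁻ w in ball x r, ENNReal.ofReal (‖x - w‖ ^ (-α) * u w ^ lam) ≤
      ENNReal.ofReal (C ^ lam * C1 * r ^ (-j)) := by
    calc _ ≤ ∫⁻ w in ball x r, ENNReal.ofReal (C ^ lam * r ^ (-p * lam)) *
          ENNReal.ofReal (‖w - x‖ ^ (-α)) := by
          refine setLIntegral_mono' measurableSet_ball fun w hw => ?_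
          rw [hrdef] at hw
          obtain ⟨hw1, hw2⟩ := notMem_ball_half hw
          have hw0 : w ≠ 0 := norm_pos_iff.mp (by linarith)
          rw [← ENNReal.ofReal_mul (by positivity), norm_sub_rev x w, mul_comm]
          refine ENNReal.ofReal_le_ofReal (mul_le_mul_of_nonneg_right ?_ (by positivity))
          calc u w ^ lam ≤ (C * r ^ (-p)) ^ lam := by
                refine Real.rpow_le_rpow (hu w) ((hup w hw0 (by linarith)).trans ?_) hlam.le
                refine mul_le_mul_of_nonneg_left ?_ hC
                exact Real.rpow_le_rpow_of_nonpos hr (by linarith) (by linarith)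
            _ = _ := by
                rw [Real.mul_rpow hC (by positivity), ← Real.rpow_mul hr.le]
      _ ≤ ENNReal.ofReal (C ^ lam * r ^ (-p * lam)) * ENNReal.ofReal (C1 * r ^ (n - α)) := by
          rw [lintegral_const_mul' _ _ ENNReal.ofReal_ne_top]
          exact mul_le_mul' le_rfl (hC1 x r hr)
      _ = ENNReal.ofReal (C ^ lam * C1 * r ^ (n - α - p * lam)) := by
          rw [← ENNReal.ofReal_mul (by positivity)]
          have e : r ^ (n - α - p * lam) = r ^ (-p * lam) * r ^ (n - α) := by
            rw [← Real.rpow_add hr]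
            congr 1
            ring
          rw [e]
          congr 1
          ring
      _ ≤ _ := by
          refine ENNReal.ofReal_le_ofReal (mul_le_mul_of_nonneg_left ?_ (by positivity))
          exact Real.rpow_le_rpow_of_exponent_ge hr (by linarith) (by linarith)
  refine h1.trans ((add_le_add h2 le_rfl).trans (le_of_eq ?_))
  rw [← ENNReal.ofReal_add (by positivity) (by positivity), hxr,
    Real.mul_rpow (by norm_num) hr.le, Real.rpow_neg (by norm_num : (0 : ℝ) ≤ 2)]
  congr 1
  field_simp

theorem ofReal_le_of_tendsto_regKernel (hn : 3 ≤ n) {h : Euc n → ℝ} {x : Euc n} {L : ℝ}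
    (hL : Tendsto (fun ε : ℝ => ∫ y, regKernel n ε (‖y - x‖ ^ 2) * h y) (𝓝[>] 0) (𝓝 L)) :
    ENNReal.ofReal L ≤ ∫⁻ y, ENNReal.ofReal (‖x - y‖ ^ (-((n : ℝ) - 2)) * |h y|) := by
  refine le_of_tendsto ((ENNReal.continuous_ofReal.tendsto _).comp hL)
    (Eventually.of_forall fun ε => ?_)
  refine (Real.ofReal_le_enorm _).trans ((enorm_integral_le_lintegral_enorm _).trans ?_)
  refine lintegral_mono_ae ?_
  filter_upwards [ae_ne_point (by omega) x] with y hy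
  have hpos : 0 < ‖y - x‖ := norm_pos_iff.mpr (sub_ne_zero.mpr hy)
  rw [← ofReal_norm, norm_mul, Real.norm_of_nonneg (regKernel_nonneg (by positivity)),
    norm_sub_rev x y]
  exact ENNReal.ofReal_le_ofReal (mul_le_mul_of_nonneg_right (regKernel_sq_le hn ε hpos)
    (norm_nonneg _))

theorem exists_abs_le_mul_rpow_of_continuousOn {g : Euc n → ℝ} (hg : ContinuousOn g {0}ᶜ)
    {b M : ℝ} (hb : 0 ≤ b) (hM : 0 ≤ M)
    (h : ∀ x : Euc n, x ≠ 0 → ‖x‖ < 1 / 2 → |g x| ≤ M * ‖x‖ ^ (-b)) :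
    ∃ M' : ℝ, 0 ≤ M' ∧ ∀ x : Euc n, x ≠ 0 → ‖x‖ < 1 → |g x| ≤ M' * ‖x‖ ^ (-b) := by
  have hKc : IsCompact {x : Euc n | 1 / 2 ≤ ‖x‖ ∧ ‖x‖ ≤ 1} := by
    refine (isCompact_closedBall (0 : Euc n) 1).of_isClosed_subset
      (isClosed_Icc.preimage continuous_norm) fun x hx => mem_closedBall_zero_iff.mpr hx.2
  obtain ⟨B, hB⟩ := hKc.exists_bound_of_continuousOn (hg.mono fun x hx => by
    rintro rfl
    have := hx.1
    rw [norm_zero] at this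
    norm_num at this)
  refine ⟨max M B, hM.trans (le_max_left _ _), fun x hx hx1 => ?_⟩
  have hx0 := norm_pos_iff.mpr hx
  rcases lt_or_ge ‖x‖ (1 / 2) with h2 | h2
  · exact (h x hx h2).trans (mul_le_mul_of_nonneg_right (le_max_left _ _) (by positivity))
  · have h3 := hB x ⟨h2, hx1.le⟩
    have h4 : 1 ≤ ‖x‖ ^ (-b) := Real.one_le_rpow_of_pos_of_le_one_of_nonpos hx0 hx1.le (by linarith)
    calc |g x| ≤ max M B := h3.trans (le_max_right _ _)
      _ ≤ _ := le_mul_of_one_le_right (hM.trans (le_max_left _ _)) h4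

/-- One step of the decay improvement. -/
theorem IsCPSolution.exists_le_rpow_improve (hn : 3 ≤ n) {α lam sig p p' j C : ℝ}
    (hαn : α < n) (hsig0 : 0 ≤ sig) (hl : (n : ℝ) / ((n : ℝ) - 2) ≤ lam)
    (hu : IsCPSolution n α lam sig u) (hp : 0 ≤ p) (hp' : 0 ≤ p') (hC : 0 ≤ C)
    (hup : ∀ x : Euc n, x ≠ 0 → ‖x‖ < 1 → u x ≤ C * ‖x‖ ^ (-p))
    (hj0 : 0 ≤ j) (hjα : j ≤ α) (hj : α + p * lam - n ≤ j) (hj' : j = α ∨ α - j + p * lam < n)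
    (hjn : j + p * sig < n) (hjp : j + p * sig - 2 < p') :
    ∃ C' : ℝ, 0 ≤ C' ∧ ∀ x : Euc n, x ≠ 0 → ‖x‖ < 1 → u x ≤ C' * ‖x‖ ^ (-p') := by
  have hn' : (3 : ℝ) ≤ n := by exact_mod_cast hn
  have hn0 : 0 < n := by omega
  have hlam : 0 < lam := (div_pos (by linarith) (by linarith)).trans_le hl
  have hP := hu.posSuperharmonic
  obtain ⟨K, hK0, hK⟩ := hu.exists_lintegral_rpow_le
  obtain ⟨C1, hC10, hC1⟩ := exists_rieszPotential_le_rpow hn0 hu.1 hαn hlam hj0 hjα hp hj hj' hC hup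
    hK0 hK
  obtain ⟨W, hWu, hWC, -, hL0, hLu, hrep⟩ := hP.exists_representation hn hl hu.2.2.1
  have hLc : ContinuousOn (lap W) {0}ᶜ := fun x hx =>
    (continuousAt_lap (hWC x hx)).continuousWithinAt
  have hb0 : 0 ≤ j + p * sig := by positivity
  have hf : ∀ x : Euc n, x ≠ 0 → ‖x‖ < 1 / 2 →
      |lap W x| ≤ C1 * C ^ sig * ‖x‖ ^ (-(j + p * sig)) := by
    intro x hx hx2
    have hx0 := norm_pos_iff.mpr hx
    have hxm : x ∈ ball (0 : Euc n) 2 \ {0} := ⟨mem_ball_zero_iff.mpr (by linarith), hx⟩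
    rw [hLu x hx hx2, ← abs_neg, abs_of_nonneg (hP.neg_lap_nonneg x hxm),
      ← ENNReal.ofReal_le_ofReal_iff (by positivity)]
    refine (hu.lap_le x hxm).trans ((mul_le_mul' (hC1 x hx hx2) (ENNReal.ofReal_le_ofReal
      (Real.rpow_le_rpow (hu.1 x) (hup x hx (by linarith)) hsig0))).trans (le_of_eq ?_))
    have e : ‖x‖ ^ (-(j + p * sig)) = ‖x‖ ^ (-j) * ‖x‖ ^ (-p * sig) := by
      rw [← Real.rpow_add hx0]
      congr 1
      ring
    rw [← ENNReal.ofReal_mul (by positivity), Real.mul_rpow hC (by positivity),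
      ← Real.rpow_mul hx0.le, e]
    congr 1
    ring
  obtain ⟨M, hM0, hM⟩ := exists_abs_le_mul_rpow_of_continuousOn hLc hb0 (by positivity) hf
  obtain ⟨C2, hC20, hC2⟩ := exists_setLIntegral_rpow_mul_rpow_le hn0 (a := (n : ℝ) - 2)
    (b := j + p * sig) (p := p') (by linarith) hjn hp' (by linarith) one_pos
  have hc := newtonConst_pos hn
  have hmain : ∀ x : Euc n, x ≠ 0 → ‖x‖ < 1 / 2 →
      |u x| ≤ (newtonConst n)⁻¹ * (M * C2) * ‖x‖ ^ (-p') := by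
    intro x hx hx2
    have hx0 := norm_pos_iff.mpr hx
    have h1 := ofReal_le_of_tendsto_regKernel hn (hrep x hx)
    rw [hWu x hx2.le] at h1
    have h2 : ∫⁻ y, ENNReal.ofReal (‖x - y‖ ^ (-((n : ℝ) - 2)) * |-lap W y|) ≤
        ENNReal.ofReal (M * C2 * ‖x‖ ^ (-p')) := by
      rw [← lintegral_add_compl _ (measurableSet_ball (x := (0 : Euc n)) (ε := 1))]
      have hz : ∫⁻ y in (ball (0 : Euc n) 1)ᶜ,
          ENNReal.ofReal (‖x - y‖ ^ (-((n : ℝ) - 2)) * |-lap W y|) = 0 := by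
        rw [setLIntegral_congr_fun (g := fun _ => 0) measurableSet_ball.compl fun y hy => ?_]
        · simp
        · rw [mem_compl_iff, mem_ball_zero_iff, not_lt] at hy
          simp [hL0 y hy]
      rw [hz, add_zero]
      calc _ ≤ ∫⁻ y in ball (0 : Euc n) 1, ENNReal.ofReal M *
            ENNReal.ofReal (‖x - y‖ ^ (-((n : ℝ) - 2)) * ‖y‖ ^ (-(j + p * sig))) := by
            refine setLIntegral_mono_ae' measurableSet_ball ?_
            filter_upwards [ae_ne_point hn0 (0 : Euc n)] with y hy0 hy
            rw [mem_ball_zero_iff] at hy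
            rw [← ENNReal.ofReal_mul hM0, abs_neg, mul_left_comm]
            exact ENNReal.ofReal_le_ofReal
              (mul_le_mul_of_nonneg_left (hM y hy0 hy) (by positivity))
        _ ≤ ENNReal.ofReal M * ENNReal.ofReal (C2 * ‖x‖ ^ (-p')) := by
            rw [lintegral_const_mul' _ _ ENNReal.ofReal_ne_top]
            exact mul_le_mul' le_rfl (hC2 x hx (by linarith))
        _ = _ := by
            rw [← ENNReal.ofReal_mul hM0, mul_assoc]
    have h3 := (ENNReal.ofReal_le_ofReal_iff (by positivity)).mp (h1.trans h2)
    rw [abs_of_nonneg (hu.1 x), mul_assoc, inv_mul_eq_div, le_div_iff₀ hc]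
    linarith
  have huc : ContinuousOn u {0}ᶜ := hu.2.1.continuousOn
  obtain ⟨C', hC'0, hC'⟩ := exists_abs_le_mul_rpow_of_continuousOn huc hp' (by positivity) hmain
  exact ⟨C', hC'0, fun x hx hx1 => (le_abs_self _).trans (hC' x hx hx1)⟩

theorem IsCPSolution.exists_bound (hn : 3 ≤ n) {α lam sig : ℝ} (hα0 : 0 < α) (hαn : α < n)
    (hsig0 : 0 ≤ sig) (hl : (n : ℝ) / ((n : ℝ) - 2) ≤ lam)
    (hgap : 0 < 2 - α + n / lam * (1 - sig)) (hu : IsCPSolution n α lam sig u) :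
    ∃ C : ℝ, 0 ≤ C ∧ ∀ x : Euc n, x ≠ 0 → ‖x‖ < 1 → u x ≤ C := by
  have hn' : (3 : ℝ) ≤ n := by exact_mod_cast hn
  have hm0 : (0 : ℝ) < n - 2 := by linarith
  have hlam : 0 < lam := (div_pos (by linarith) hm0).trans_le hl
  obtain ⟨P, hP⟩ : ∃ P : ℝ, P = n / lam := ⟨_, rfl⟩
  have hPl : P * lam = n := by rw [hP, div_mul_cancel₀ _ hlam.ne']
  have hP0 : 0 < P := by rw [hP]; exact div_pos (by linarith) hlam
  have hPn : P ≤ n - 2 := by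
    rw [hP, div_le_iff₀ hlam]
    rw [div_le_iff₀ hm0] at hl
    linarith
  rw [← hP] at hgap
  obtain ⟨κ, hκ0, hκ⟩ : ∃ κ, 0 < κ ∧ κ < min 2 (2 - α + P * (1 - sig)) :=
    exists_between (lt_min two_pos hgap)
  obtain ⟨hκ2, hκD⟩ := lt_min_iff.mp hκ
  have step : ∀ p p' : ℝ, 0 ≤ p → p ≤ P → 0 ≤ p' → p - κ ≤ p' →
      (∃ C : ℝ, 0 ≤ C ∧ ∀ x : Euc n, x ≠ 0 → ‖x‖ < 1 → u x ≤ C * ‖x‖ ^ (-p)) →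
      ∃ C : ℝ, 0 ≤ C ∧ ∀ x : Euc n, x ≠ 0 → ‖x‖ < 1 → u x ≤ C * ‖x‖ ^ (-p') := by
    rintro p p' hp hpP hp' hpp' ⟨C, hC, hup⟩
    obtain ⟨j, hj0, hjα, hj1, hj2, hj3⟩ : ∃ j, 0 ≤ j ∧ j ≤ α ∧ α + p * lam - n ≤ j ∧
        (j = α ∨ α - j + p * lam < n) ∧ j < 2 + p - p * sig - κ := by
      rcases hpP.eq_or_lt with rfl | hlt
      · exact ⟨α, hα0.le, le_rfl, by linarith, Or.inl rfl, by linarith⟩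
      · have hplam : p * lam < n := by rw [← hPl]; exact mul_lt_mul_of_pos_right hlt hlam
        obtain ⟨t, ht0, ht1, ht⟩ : ∃ t, 0 ≤ t ∧ t ≤ 1 ∧ p = t * P :=
          ⟨p / P, by positivity, (div_le_one hP0).mpr hpP, by field_simp⟩
        have e1 : p * lam = t * n := by rw [ht, mul_assoc, hPl]
        have e2 : 2 + p - p * sig - κ = (1 - t) * (2 - κ) +
          t * (2 - α + P * (1 - sig) - κ) + t * α := by rw [ht]; ring
        have hpos : 0 < (1 - t) * (2 - κ) + t * (2 - α + P * (1 - sig) - κ) := by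
          rcases ht0.eq_or_lt with h | h
          · rw [← h]; linarith
          · have h1 := mul_pos h (sub_pos.mpr hκD)
            have h2 := mul_nonneg (sub_nonneg.mpr ht1) (sub_pos.mpr hκ2).le
            linarith
        obtain ⟨j, h1, h2⟩ : ∃ j, max 0 (α + p * lam - n) < j ∧ j < min α (2 + p - p * sig - κ) := by
          refine exists_between (max_lt (lt_min hα0 ?_) (lt_min (by linarith) ?_))
          · rw [e2]
            have := mul_nonneg ht0 hα0.le
            linarith
          · rw [e2, e1]
            nlinarith
        obtain ⟨h3, h4⟩ := max_lt_iff.mp h1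
        obtain ⟨h5, h6⟩ := lt_min_iff.mp h2
        exact ⟨j, h3.le, h5.le, h4.le, Or.inr (by linarith), h6⟩
    refine hu.exists_le_rpow_improve hn hαn hsig0 hl hp hp' hC hup hj0 hjα hj1 hj2 ?_ (by linarith)
    have := mul_le_mul_of_nonneg_right hpP hsig0
    linarith
  have iter : ∀ k : ℕ, ∃ C : ℝ, 0 ≤ C ∧ ∀ x : Euc n, x ≠ 0 → ‖x‖ < 1 →
      u x ≤ C * ‖x‖ ^ (-(max 0 (P - k * κ))) := by
    intro k
    induction k with
    | zero =>
      have := hu.exists_le_rpow_of_ge hn hα0 hαn hsig0 hl (by rw [← hP]; exact hgap)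
      rw [Nat.cast_zero, zero_mul, sub_zero, max_eq_right hP0.le, hP]
      exact this
    | succ k ih =>
      refine step _ _ (le_max_left _ _) (max_le hP0.le ?_) (le_max_left _ _) ?_ ih
      · have : 0 ≤ k * κ := by positivity
        linarith
      · rw [sub_le_iff_le_add]
        push_cast
        refine max_le ?_ ?_
        · have := le_max_left 0 (P - (k + 1) * κ)
          linarith
        · have := le_max_right 0 (P - (k + 1) * κ)
          linarith
  obtain ⟨k, hk⟩ := exists_nat_ge (P / κ)
  obtain ⟨C, hC, h⟩ := iter k
  refine ⟨C, hC, fun x hx hx1 => ?_⟩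
  have h1 := h x hx hx1
  rw [div_le_iff₀ hκ0] at hk
  rwa [max_eq_left (by linarith), neg_zero, Real.rpow_zero, mul_one] at h1

end Bootstrap

section Regularity
variable {n : ℕ}

theorem integrableOn_ball_norm_rpow (hn : 0 < n) {a : ℝ} (ha : a < n) {R : ℝ} (hR : 0 < R) :
    IntegrableOn (fun z : Euc n => ‖z‖ ^ (-a)) (ball 0 R) := by
  obtain ⟨C, -, h⟩ := exists_setLIntegral_ball_rpow_le (n := n) hn ha
  refine ⟨(measurable_norm.pow_const _).aestronglyMeasurable, ?_⟩
  rw [hasFiniteIntegral_iff_ofReal (Eventually.of_forall fun z => by positivity)]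
  have := h 0 R hR
  simp only [sub_zero] at this
  exact this.trans_lt ENNReal.ofReal_lt_top

theorem integrable_smul_comp_sub {E : Type*} [NormedAddCommGroup E] [NormedSpace ℝ E]
    (hn : 0 < n) {a A M : ℝ} (ha : a < n) {F : Euc n → E} (hF : StronglyMeasurable F)
    (hFA : ∀ z, z ≠ 0 → ‖F z‖ ≤ A * ‖z‖ ^ (-a)) {h : Euc n → ℝ}
    (hh : AEStronglyMeasurable h) (hM : ∀ᵐ y, |h y| ≤ M) (h0 : ∀ y, 1 ≤ ‖y‖ → h y = 0)
    (x : Euc n) : Integrable fun y => h y • F (y - x) := by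
  have hR : 0 < ‖x‖ + 1 := by positivity
  have hi : Integrable fun y : Euc n =>
      M * (ball (0 : Euc n) (‖x‖ + 1)).indicator (fun z => A * ‖z‖ ^ (-a)) (y - x) :=
    (((integrable_indicator_iff measurableSet_ball).mpr
      ((integrableOn_ball_norm_rpow hn ha hR).const_mul A)).comp_sub_right x).const_mul M
  refine hi.mono' (hh.smul (hF.comp_measurable (measurable_id.sub_const x)).aestronglyMeasurable) ?_
  filter_upwards [hM, ae_ne_point hn x] with y hy hyx
  by_cases hy1 : 1 ≤ ‖y‖
  · rw [h0 y hy1, zero_smul, norm_zero]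
    refine mul_nonneg ((abs_nonneg _).trans hy) (indicator_apply_nonneg fun _ => ?_)
    exact (norm_nonneg _).trans (hFA _ (sub_ne_zero.mpr hyx))
  · have hm : y - x ∈ ball (0 : Euc n) (‖x‖ + 1) := by
      rw [mem_ball_zero_iff]
      have := norm_sub_le y x
      linarith
    rw [indicator_of_mem hm, norm_smul, Real.norm_eq_abs]
    exact mul_le_mul hy (hFA _ (sub_ne_zero.mpr hyx)) (norm_nonneg _) ((abs_nonneg _).trans hy)

/-- The derivative of `x ↦ regKernel n ε (‖y - x‖ ^ 2)`, as a function of `z = y - x`. -/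
noncomputable def regKernelGrad (n : ℕ) (ε : ℝ) (z : Euc n) : Euc n →L[ℝ] ℝ :=
  (((n : ℝ) - 2) * (‖z‖ ^ 2 + ε ^ 2) ^ (-((n : ℝ) / 2))) • innerSL ℝ z

theorem hasFDerivAt_regKernel_sub {ε : ℝ} (hε : ε ≠ 0) (y x : Euc n) :
    HasFDerivAt (fun x => regKernel n ε (‖y - x‖ ^ 2)) (regKernelGrad n ε (y - x)) x := by
  have hpos : 0 < ‖y - x‖ ^ 2 + ε ^ 2 := by positivity
  have h1 : HasFDerivAt (fun x : Euc n => y - x) (-ContinuousLinearMap.id ℝ (Euc n)) x :=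
    (hasFDerivAt_id x).const_sub y
  have h2 := (hasDerivAt_regKernel (n := n) hpos).comp_hasFDerivAt x h1.norm_sq
  refine h2.congr_fderiv ?_
  ext v
  simp [regKernelDeriv, regKernelGrad]
  have e : -(((n : ℝ) - 2) / 2) - 1 = -((n : ℝ) / 2) := by ring
  rw [e]
  ring

theorem stronglyMeasurable_regKernelGrad (ε : ℝ) : StronglyMeasurable (regKernelGrad n ε) := by
  have h : Measurable fun z : Euc n => ((n : ℝ) - 2) * (‖z‖ ^ 2 + ε ^ 2) ^ (-((n : ℝ) / 2)) :=
    (((measurable_norm.pow_const 2).add_const _).pow_const _).const_mul _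
  exact h.stronglyMeasurable.smul (innerSL ℝ (E := Euc n)).continuous.stronglyMeasurable

theorem continuous_regKernelGrad {ε : ℝ} (hε : ε ≠ 0) : Continuous (regKernelGrad n ε) := by
  refine Continuous.smul (continuous_const.mul (Continuous.rpow_const (by fun_prop) fun z =>
    Or.inl ?_)) (innerSL ℝ (E := Euc n)).continuous
  positivity

theorem norm_regKernelGrad_le (hn : 3 ≤ n) {ε : ℝ} {z : Euc n} (h : 0 < ‖z‖ ^ 2 + ε ^ 2) :
    ‖regKernelGrad n ε z‖ ≤ ((n : ℝ) - 2) * (‖z‖ ^ 2 + ε ^ 2) ^ (-(((n : ℝ) - 1) / 2)) := by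
  have hn' : (3 : ℝ) ≤ n := by exact_mod_cast hn
  rw [regKernelGrad, norm_smul, innerSL_apply_norm, Real.norm_eq_abs,
    abs_of_nonneg (mul_nonneg (by linarith) (by positivity)), mul_assoc]
  have h1 : ‖z‖ ≤ (‖z‖ ^ 2 + ε ^ 2) ^ (1 / 2 : ℝ) := by
    rw [← Real.sqrt_eq_rpow]
    exact Real.le_sqrt_of_sq_le (by nlinarith [sq_nonneg ε])
  refine mul_le_mul_of_nonneg_left ((mul_le_mul_of_nonneg_left h1 (by positivity)).trans
    (le_of_eq ?_)) (by linarith)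
  rw [← Real.rpow_add h]
  congr 1
  ring

theorem norm_regKernelGrad_le_rpow (hn : 3 ≤ n) (ε : ℝ) {z : Euc n} (hz : z ≠ 0) :
    ‖regKernelGrad n ε z‖ ≤ ((n : ℝ) - 2) * ‖z‖ ^ (-((n : ℝ) - 1)) := by
  have hn' : (3 : ℝ) ≤ n := by exact_mod_cast hn
  have hz0 := norm_pos_iff.mpr hz
  refine (norm_regKernelGrad_le hn (by positivity)).trans
    (mul_le_mul_of_nonneg_left ?_ (by linarith))
  refine (Real.rpow_le_rpow_of_nonpos (by positivity)
    (le_add_of_nonneg_right (sq_nonneg ε)) (by linarith)).trans (le_of_eq ?_)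
  rw [← Real.rpow_natCast, ← Real.rpow_mul hz0.le]
  congr 1
  push_cast
  ring

theorem norm_regKernelGrad_le_const (hn : 3 ≤ n) {ε : ℝ} (hε : ε ≠ 0) (z : Euc n) :
    ‖regKernelGrad n ε z‖ ≤ ((n : ℝ) - 2) * (ε ^ 2) ^ (-(((n : ℝ) - 1) / 2)) := by
  have hn' : (3 : ℝ) ≤ n := by exact_mod_cast hn
  refine (norm_regKernelGrad_le hn (by positivity)).trans
    (mul_le_mul_of_nonneg_left ?_ (by linarith))
  exact Real.rpow_le_rpow_of_nonpos (by positivity)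
    (le_add_of_nonneg_left (sq_nonneg ‖z‖)) (by linarith)

theorem tendsto_regKernelGrad {z : Euc n} (hz : z ≠ 0) :
    Tendsto (fun ε => regKernelGrad n ε z) (𝓝 0) (𝓝 (regKernelGrad n 0 z)) := by
  have hz0 := norm_pos_iff.mpr hz
  have hc : ContinuousAt (fun ε : ℝ => (‖z‖ ^ 2 + ε ^ 2) ^ (-((n : ℝ) / 2))) 0 :=
    ContinuousAt.rpow_const (by fun_prop) (Or.inl (by positivity))
  exact (hc.tendsto.const_mul ((n : ℝ) - 2)).smul_const (innerSL ℝ z)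

theorem tendsto_regKernel {ρ : ℝ} (hρ : 0 < ρ) :
    Tendsto (fun ε => regKernel n ε ρ) (𝓝 0) (𝓝 (regKernel n 0 ρ)) := by
  have hc : ContinuousAt (fun ε : ℝ => (ρ + ε ^ 2) ^ (-(((n : ℝ) - 2) / 2))) 0 :=
    ContinuousAt.rpow_const (by fun_prop) (Or.inl (by positivity))
  exact hc.tendsto

theorem measurable_regKernel (ε : ℝ) : Measurable fun z : Euc n => regKernel n ε (‖z‖ ^ 2) :=
  ((measurable_norm.pow_const 2).add_const _).pow_const _

theorem hasFDerivAt_integral_regKernel (hn : 3 ≤ n) {ε : ℝ} (hε : ε ≠ 0) {h : Euc n → ℝ}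
    (hi : Integrable h) (x : Euc n) :
    HasFDerivAt (fun x => ∫ y, regKernel n ε (‖y - x‖ ^ 2) * h y)
      (∫ y, h y • regKernelGrad n ε (y - x)) x := by
  have hn' : (3 : ℝ) ≤ n := by exact_mod_cast hn
  have hm : ∀ x, Measurable fun y : Euc n => regKernel n ε (‖y - x‖ ^ 2) := fun x =>
    (measurable_regKernel ε).comp (measurable_id.sub_const x)
  refine hasFDerivAt_integral_of_dominated_of_fderiv_le (s := univ)
    (bound := fun y => |h y| * (((n : ℝ) - 2) * (ε ^ 2) ^ (-(((n : ℝ) - 1) / 2))))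
    (F' := fun x y => h y • regKernelGrad n ε (y - x)) univ_mem
    (Eventually.of_forall fun x => (hm x).aestronglyMeasurable.mul hi.1) ?_ ?_ ?_
    (hi.abs.mul_const _) ?_
  · refine hi.bdd_mul (c := (ε ^ 2) ^ (-(((n : ℝ) - 2) / 2))) (hm x).aestronglyMeasurable
      (Eventually.of_forall fun y => ?_)
    rw [Real.norm_of_nonneg (regKernel_nonneg (sq_nonneg _))]
    exact Real.rpow_le_rpow_of_nonpos (by positivity)
      (le_add_of_nonneg_left (sq_nonneg ‖y - x‖)) (by linarith)
  · exact hi.1.smul ((stronglyMeasurable_regKernelGrad ε).comp_measurable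
      (measurable_id.sub_const x)).aestronglyMeasurable
  · refine Eventually.of_forall fun y x _ => ?_
    rw [norm_smul, Real.norm_eq_abs]
    exact mul_le_mul_of_nonneg_left (norm_regKernelGrad_le_const hn hε _) (abs_nonneg _)
  · refine Eventually.of_forall fun y x _ => ?_
    exact (hasFDerivAt_regKernel_sub hε y x).mul_const (h y)

theorem continuous_integral_regKernelGrad (hn : 3 ≤ n) {ε : ℝ} (hε : ε ≠ 0) {h : Euc n → ℝ}
    (hi : Integrable h) : Continuous fun x => ∫ y, h y • regKernelGrad n ε (y - x) := by
  refine continuous_of_dominated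
    (bound := fun y => |h y| * (((n : ℝ) - 2) * (ε ^ 2) ^ (-(((n : ℝ) - 1) / 2))))
    (fun x => hi.1.smul ((stronglyMeasurable_regKernelGrad ε).comp_measurable
      (measurable_id.sub_const x)).aestronglyMeasurable)
    (fun x => Eventually.of_forall fun y => ?_) (hi.abs.mul_const _)
    (Eventually.of_forall fun y => ?_)
  · rw [norm_smul, Real.norm_eq_abs]
    exact mul_le_mul_of_nonneg_left (norm_regKernelGrad_le_const hn hε _) (abs_nonneg _)
  · exact ((continuous_regKernelGrad hε).comp (continuous_const.sub continuous_id)).const_smul (h y)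

theorem tendsto_setIntegral_norm_regKernelGrad_sub (hn : 3 ≤ n) {R : ℝ} (hR : 0 < R) :
    Tendsto (fun ε => ∫ z in ball (0 : Euc n) R, ‖regKernelGrad n ε z - regKernelGrad n 0 z‖)
      (𝓝 0) (𝓝 0) := by
  have hn' : (3 : ℝ) ≤ n := by exact_mod_cast hn
  have hn0 : 0 < n := by omega
  have hb := (integrableOn_ball_norm_rpow hn0 (a := (n : ℝ) - 1) (by linarith) hR).const_mul
    (2 * ((n : ℝ) - 2))
  have hz : (0 : ℝ) = ∫ z in ball (0 : Euc n) R, (0 : ℝ) := by simp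
  nth_rewrite 3 [hz]
  refine tendsto_integral_filter_of_dominated_convergence _ (Eventually.of_forall fun ε => ?_)
    (Eventually.of_forall fun ε => ?_) hb ?_
  · exact ((stronglyMeasurable_regKernelGrad ε).sub
      (stronglyMeasurable_regKernelGrad 0)).norm.aestronglyMeasurable
  · filter_upwards [ae_restrict_of_ae (ae_ne_point hn0 (0 : Euc n))] with z hz
    rw [norm_norm]
    refine (norm_sub_le _ _).trans ?_
    have h1 := norm_regKernelGrad_le_rpow hn ε hz
    have h2 := norm_regKernelGrad_le_rpow hn 0 hz
    linarith
  · filter_upwards [ae_restrict_of_ae (ae_ne_point hn0 (0 : Euc n))] with z hz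
    exact tendsto_iff_norm_sub_tendsto_zero.mp (tendsto_regKernelGrad hz)

theorem tendstoUniformlyOn_integral_regKernelGrad (hn : 3 ≤ n) {M : ℝ} {h : Euc n → ℝ}
    (hh : AEStronglyMeasurable h) (hM : ∀ᵐ y, |h y| ≤ M) (h0 : ∀ y, 1 ≤ ‖y‖ → h y = 0) :
    TendstoUniformlyOn (fun ε x => ∫ y, h y • regKernelGrad n ε (y - x))
      (fun x => ∫ y, h y • regKernelGrad n 0 (y - x)) (𝓝 0) (ball 0 1) := by
  have hn' : (3 : ℝ) ≤ n := by exact_mod_cast hn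
  have hn0 : 0 < n := by omega
  have hint : ∀ ε x, Integrable fun y => h y • regKernelGrad n ε (y - x) := fun ε x =>
    integrable_smul_comp_sub hn0 (a := (n : ℝ) - 1) (by linarith)
      (stronglyMeasurable_regKernelGrad ε) (fun z hz => norm_regKernelGrad_le_rpow hn ε hz)
      hh hM h0 x
  have hT := (tendsto_setIntegral_norm_regKernelGrad_sub hn two_pos).const_mul M
  rw [mul_zero] at hT
  rw [Metric.tendstoUniformlyOn_iff]
  intro δ hδ
  filter_upwards [hT.eventually (gt_mem_nhds hδ)] with ε hε x hx
  refine lt_of_le_of_lt ?_ hε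
  rw [mem_ball_zero_iff] at hx
  set G : Euc n → ℝ := (ball (0 : Euc n) 2).indicator
    fun z => ‖regKernelGrad n ε z - regKernelGrad n 0 z‖ with hG
  have hGi : Integrable G := by
    rw [hG, integrable_indicator_iff measurableSet_ball]
    refine ((integrableOn_ball_norm_rpow hn0 (a := (n : ℝ) - 1) (by linarith) two_pos).const_mul
      (2 * ((n : ℝ) - 2))).mono' ((stronglyMeasurable_regKernelGrad ε).sub
      (stronglyMeasurable_regKernelGrad 0)).norm.aestronglyMeasurable ?_
    filter_upwards [ae_restrict_of_ae (ae_ne_point hn0 (0 : Euc n))] with z hz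
    rw [norm_norm]
    refine (norm_sub_le _ _).trans ?_
    have h1 := norm_regKernelGrad_le_rpow hn ε hz
    have h2 := norm_regKernelGrad_le_rpow hn 0 hz
    linarith
  have e1 : (∫ y, h y • regKernelGrad n ε (y - x)) - ∫ y, h y • regKernelGrad n 0 (y - x) =
      ∫ y, (h y • regKernelGrad n ε (y - x) - h y • regKernelGrad n 0 (y - x)) :=
    (integral_sub (hint ε x) (hint 0 x)).symm
  have e2 : M * ∫ z in ball (0 : Euc n) 2, ‖regKernelGrad n ε z - regKernelGrad n 0 z‖ =
      ∫ y, M * G (y - x) := by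
    rw [integral_const_mul, integral_sub_right_eq_self G, hG, integral_indicator measurableSet_ball]
  rw [dist_comm, dist_eq_norm, e1, e2]
  refine norm_integral_le_of_norm_le ((hGi.comp_sub_right x).const_mul M) ?_
  filter_upwards [hM] with y hy
  have e3 : h y • regKernelGrad n ε (y - x) - h y • regKernelGrad n 0 (y - x) =
      h y • (regKernelGrad n ε (y - x) - regKernelGrad n 0 (y - x)) := (smul_sub _ _ _).symm
  rw [e3, norm_smul, Real.norm_eq_abs]
  by_cases hy1 : 1 ≤ ‖y‖
  · rw [h0 y hy1, abs_zero, zero_mul]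
    exact mul_nonneg ((abs_nonneg _).trans hy) (indicator_nonneg (fun _ _ => norm_nonneg _) _)
  · have hm : y - x ∈ ball (0 : Euc n) 2 := by
      rw [mem_ball_zero_iff]
      have := norm_sub_le y x
      linarith
    rw [hG, indicator_of_mem hm]
    exact mul_le_mul_of_nonneg_right hy (norm_nonneg _)

theorem tendsto_integral_regKernel (hn : 3 ≤ n) {M : ℝ} {h : Euc n → ℝ}
    (hh : AEStronglyMeasurable h) (hM : ∀ᵐ y, |h y| ≤ M) (h0 : ∀ y, 1 ≤ ‖y‖ → h y = 0)
    (x : Euc n) :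
    Tendsto (fun ε => ∫ y, regKernel n ε (‖y - x‖ ^ 2) * h y) (𝓝 0)
      (𝓝 (∫ y, regKernel n 0 (‖y - x‖ ^ 2) * h y)) := by
  have hn' : (3 : ℝ) ≤ n := by exact_mod_cast hn
  have hn0 : 0 < n := by omega
  have hm : ∀ ε, Measurable fun y : Euc n => regKernel n ε (‖y - x‖ ^ 2) := fun ε =>
    (measurable_regKernel ε).comp (measurable_id.sub_const x)
  have hb := (integrable_smul_comp_sub hn0 (a := (n : ℝ) - 2) (A := 1) (by linarith)
    (F := fun z : Euc n => ‖z‖ ^ (-((n : ℝ) - 2))) (measurable_norm.pow_const _).stronglyMeasurable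
    (fun z _ => by rw [Real.norm_of_nonneg (by positivity), one_mul]) hh hM h0 x).norm
  refine tendsto_integral_filter_of_dominated_convergence _ (Eventually.of_forall fun ε =>
    (hm ε).aestronglyMeasurable.mul hh) (Eventually.of_forall fun ε => ?_) hb ?_
  · filter_upwards [ae_ne_point hn0 x] with y hy
    rw [norm_mul, norm_smul, mul_comm, Real.norm_of_nonneg (regKernel_nonneg (sq_nonneg _)),
      Real.norm_of_nonneg (r := ‖y - x‖ ^ (-((n : ℝ) - 2))) (by positivity)]
    exact mul_le_mul_of_nonneg_left
      (regKernel_sq_le hn ε (norm_pos_iff.mpr (sub_ne_zero.mpr hy))) (norm_nonneg _)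
  · filter_upwards [ae_ne_point hn0 x] with y hy
    have := norm_pos_iff.mpr (sub_ne_zero.mpr hy)
    exact (tendsto_regKernel (by positivity)).mul_const _

/-- The Newtonian potential of a bounded compactly supported function is `C¹`. -/
theorem contDiffAt_integral_regKernel (hn : 3 ≤ n) {M : ℝ} {h : Euc n → ℝ}
    (hh : AEStronglyMeasurable h) (hM : ∀ᵐ y, |h y| ≤ M) (h0 : ∀ y, 1 ≤ ‖y‖ → h y = 0) :
    ContDiffAt ℝ 1 (fun x => ∫ y, regKernel n 0 (‖y - x‖ ^ 2) * h y) 0 := by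
  have hi : Integrable h := by
    have := integrable_smul_comp_sub (n := n) (by omega) (a := 0) (A := 1)
      (by exact_mod_cast (by omega : 0 < n)) (F := fun _ => (1 : ℝ)) stronglyMeasurable_const
      (fun z _ => by simp) hh hM h0 0
    simpa using this
  obtain ⟨e, -, he0, he⟩ := exists_seq_strictAnti_tendsto (0 : ℝ)
  have hU : TendstoUniformlyOn (fun k x => ∫ y, h y • regKernelGrad n (e k) (y - x))
      (fun x => ∫ y, h y • regKernelGrad n 0 (y - x)) atTop (ball 0 1) := fun s hs =>
    he.eventually (tendstoUniformlyOn_integral_regKernelGrad hn hh hM h0 s hs)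
  rw [contDiffAt_one_iff]
  refine ⟨fun x => ∫ y, h y • regKernelGrad n 0 (y - x), ball 0 1, ball_mem_nhds _ one_pos,
    hU.continuousOn (Eventually.of_forall fun k =>
      (continuous_integral_regKernelGrad hn (he0 k).ne' hi).continuousOn).frequently,
    fun x hx => ?_⟩
  exact hasFDerivAt_of_tendstoUniformlyOn isOpen_ball hU
    (fun k x _ => hasFDerivAt_integral_regKernel hn (he0 k).ne' hi x)
    (fun x _ => (tendsto_integral_regKernel hn hh hM h0 x).comp he) hx

theorem IsCPSolution.exists_contDiff_extension (hn : 3 ≤ n) {α lam sig C : ℝ} {u : Euc n → ℝ}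
    (hα0 : 0 < α) (hαn : α < n) (hsig0 : 0 ≤ sig) (hl : (n : ℝ) / ((n : ℝ) - 2) ≤ lam)
    (hC : 0 ≤ C) (hu : IsCPSolution n α lam sig u)
    (hup : ∀ x : Euc n, x ≠ 0 → ‖x‖ < 1 → u x ≤ C) :
    ∃ w : Euc n → ℝ, ContDiff ℝ 1 w ∧ ∀ x : Euc n, x ≠ 0 → u x = w x := by
  have hn' : (3 : ℝ) ≤ n := by exact_mod_cast hn
  have hn0 : 0 < n := by omega
  have hlam : 0 < lam := (div_pos (by linarith) (by linarith)).trans_le hl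
  have hP := hu.posSuperharmonic
  obtain ⟨K, hK0, hK⟩ := hu.exists_lintegral_rpow_le
  obtain ⟨C1, hC10, hC1⟩ := exists_rieszPotential_le_rpow hn0 hu.1 hαn hlam le_rfl hα0.le
    (p := 0) le_rfl (by linarith) (Or.inr (by linarith)) hC
    (fun x hx hx1 => by simpa using hup x hx hx1) hK0 hK
  obtain ⟨W, hWu, hWC, -, hL0, hLu, hrep⟩ := hP.exists_representation hn hl hu.2.2.1
  have hLc : ContinuousOn (lap W) {0}ᶜ := fun x hx =>
    (continuousAt_lap (hWC x hx)).continuousWithinAt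
  have hf : ∀ x : Euc n, x ≠ 0 → ‖x‖ < 1 / 2 → |lap W x| ≤ C1 * C ^ sig * ‖x‖ ^ (-(0 : ℝ)) := by
    intro x hx hx2
    have hxm : x ∈ ball (0 : Euc n) 2 \ {0} := ⟨mem_ball_zero_iff.mpr (by linarith), hx⟩
    rw [hLu x hx hx2, ← abs_neg, abs_of_nonneg (hP.neg_lap_nonneg x hxm),
      ← ENNReal.ofReal_le_ofReal_iff (by positivity)]
    refine (hu.lap_le x hxm).trans ((mul_le_mul' (hC1 x hx hx2) (ENNReal.ofReal_le_ofReal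
      (Real.rpow_le_rpow (hu.1 x) (hup x hx (by linarith)) hsig0))).trans (le_of_eq ?_))
    rw [← ENNReal.ofReal_mul (by positivity)]
    congr 1
    ring
  obtain ⟨M, hM0, hM⟩ := exists_abs_le_mul_rpow_of_continuousOn hLc le_rfl (by positivity) hf
  have hMh : ∀ᵐ y : Euc n, |-lap W y| ≤ M := by
    filter_upwards [ae_ne_point hn0 (0 : Euc n)] with y hy
    rw [abs_neg]
    rcases lt_or_ge ‖y‖ 1 with h | h
    · simpa using hM y hy h
    · rw [hL0 y h, abs_zero]
      exact hM0
  have hh : AEStronglyMeasurable fun y => -lap W y :=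
    (aestronglyMeasurable_of_continuousOn_compl hn0 hLc).neg
  have hh0 : ∀ y : Euc n, 1 ≤ ‖y‖ → -lap W y = 0 := fun y hy => by rw [hL0 y hy, neg_zero]
  have hc := newtonConst_pos hn
  obtain ⟨V, hV⟩ : ∃ V : Euc n → ℝ, V = fun x => ∫ y, regKernel n 0 (‖y - x‖ ^ 2) * -lap W y :=
    ⟨_, rfl⟩
  have hVC : ContDiffAt ℝ 1 V 0 := by
    rw [hV]
    exact contDiffAt_integral_regKernel hn hh hMh hh0
  have hVu : ∀ x, x ≠ 0 → ‖x‖ ≤ 1 / 2 → u x = (newtonConst n)⁻¹ * V x := by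
    intro x hx hx2
    have h1 := tendsto_nhds_unique (hrep x hx)
      ((tendsto_integral_regKernel hn hh hMh hh0 x).mono_left nhdsWithin_le_nhds)
    rw [hWu x hx2] at h1
    rw [hV]
    simp only
    rw [← h1, inv_mul_cancel_left₀ hc.ne']
  refine ⟨Function.update u 0 ((newtonConst n)⁻¹ * V 0), contDiff_iff_contDiffAt.mpr fun x => ?_,
    fun x hx => (Function.update_of_ne hx _ _).symm⟩
  rcases eq_or_ne x 0 with rfl | hx
  · refine (contDiffAt_const.mul hVC).congr_of_eventuallyEq (f := fun x => (newtonConst n)⁻¹ * V x) ?_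
    filter_upwards [ball_mem_nhds (0 : Euc n) (half_pos one_pos)] with x hx
    rcases eq_or_ne x 0 with rfl | hx0
    · simp
    · rw [Function.update_of_ne hx0]
      exact hVu x hx0 (mem_ball_zero_iff.mp hx).le
  · have h1 : ContDiffAt ℝ 1 u x :=
      ((hu.2.1 x hx).contDiffAt (isOpen_compl_singleton.mem_nhds hx)).of_le (by norm_num)
    refine h1.congr_of_eventuallyEq ?_
    filter_upwards [isOpen_compl_singleton.mem_nhds hx] with y hy
    exact Function.update_of_ne hy _ _

end Regularity

theorem stmt0 (n : ℕ) (hn : 3 ≤ n) (α lam sig : ℝ)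
    (hα0 : 0 < α) (hαn : α < n) (hlam : 0 < lam)
    (hsig0 : 0 ≤ sig) (hsig1 : sig < gAlpha n α lam)
    (u : Euc n → ℝ) (hu : IsCPSolution n α lam sig u) :
    (lam < (n : ℝ) / ((n : ℝ) - 2) →
      u =O[𝓝[≠] (0 : Euc n)] fun x => ‖x‖ ^ (-((n : ℝ) - 2))) ∧
    ((n : ℝ) / ((n : ℝ) - 2) ≤ lam →
      (u =O[𝓝[≠] (0 : Euc n)] fun _ => (1 : ℝ)) ∧
      ∃ w : Euc n → ℝ, ContDiff ℝ 1 w ∧ ∀ x : Euc n, x ≠ 0 → u x = w x) := by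
  refine ⟨fun hl => ?_, fun hl => ?_⟩
  · obtain ⟨C, hC⟩ := hu.exists_le_rpow_of_lt hn hα0 hαn hlam hsig0 hsig1 hl
    refine IsBigO.of_bound C ?_
    filter_upwards [self_mem_nhdsWithin,
      mem_nhdsWithin_of_mem_nhds (ball_mem_nhds (0 : Euc n) (by norm_num : (0 : ℝ) < 2 / 9))]
      with x hx hx2
    rw [Real.norm_of_nonneg (hu.1 x), Real.norm_of_nonneg (by positivity)]
    exact hC x hx (mem_ball_zero_iff.mp hx2)
  · obtain ⟨C, hC0, hC⟩ := hu.exists_bound hn hα0 hαn hsig0 hl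
      (gap_of_lt_gAlpha hn hαn hsig0 hsig1 hl)
    refine ⟨IsBigO.of_bound C ?_,
      hu.exists_contDiff_extension hn hα0 hαn hsig0 hl hC0 hC⟩
    filter_upwards [self_mem_nhdsWithin,
      mem_nhdsWithin_of_mem_nhds (ball_mem_nhds (0 : Euc n) one_pos)] with x hx hx1
    rw [Real.norm_of_nonneg (hu.1 x), norm_one, mul_one]
    exact hC x hx (mem_ball_zero_iff.mp hx1)
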